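/- arXiv:1812.03195 — 3 statements merged into one kernel-verified Lean document; each statement's English description precedes it below -/
import Mathlib

section
/- Let G be a bipartite, hole-free, fast finite simple graph with bipartition (A,B) into two nonempty independent sets. Then pw(G) ≤ min( max_{v ∈ A} deg(v), max_{v ∈ B} deg(v) ). -/
open SimpleGraph

/-- A path decomposition of a simple graph `G`: a nonempty finite sequence of bags
covering all vertices and edges, such that each vertex occurs in an interval of bags. -/
structure PathDecomp {V : Type*} (G : SimpleGraph V) where
  len : ℕ
  len_pos : 0 < len
  bags : Fin len → Finset V
  mem_bag : ∀ v : V, ∃ i, v ∈ bags i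
  edge_bag : ∀ ⦃u v : V⦄, G.Adj u v → ∃ i, u ∈ bags i ∧ v ∈ bags i
  interval : ∀ (v : V) (i j k : Fin len), i ≤ j → j ≤ k →
    v ∈ bags i → v ∈ bags k → v ∈ bags j

/-- The width of a path decomposition: maximum bag size minus one. -/
def PathDecomp.width {V : Type*} {G : SimpleGraph V} (D : PathDecomp G) : ℕ :=
  (Finset.univ.sup fun i => (D.bags i).card) - 1

/-- The pathwidth of a graph: minimum width over all path decompositions. -/
noncomputable def pathwidth {V : Type*} (G : SimpleGraph V) : ℕ :=
  sInf {w : ℕ | ∃ D : PathDecomp G, D.width = w}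

/-- A set of vertices is independent if no two of its members are adjacent. -/
def IndepVertexSet {V : Type*} (G : SimpleGraph V) (A : Set V) : Prop :=
  ∀ ⦃u⦄, u ∈ A → ∀ ⦃v⦄, v ∈ A → ¬ G.Adj u v

/-- A graph is bipartite if its vertex set is partitioned into two independent sets. -/
def IsBipartiteGraph {V : Type*} (G : SimpleGraph V) : Prop :=
  ∃ A B : Set V, A ∪ B = Set.univ ∧ Disjoint A B ∧
    IndepVertexSet G A ∧ IndepVertexSet G B

/-- `G` contains an induced subgraph isomorphic to `H`. -/
def HasInducedCopy {V W : Type*} (G : SimpleGraph V) (H : SimpleGraph W) : Prop :=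
  ∃ S : Set V, Nonempty (G.induce S ≃g H)

/-- The armchair: a 4-cycle 0-1-2-3 with pendant vertices 4, 5, 6 attached to 0, 1, 2. -/
def armchair : SimpleGraph (Fin 7) :=
  SimpleGraph.fromRel (fun a b =>
    (a = 0 ∧ b = 1) ∨ (a = 1 ∧ b = 2) ∨ (a = 2 ∧ b = 3) ∨ (a = 3 ∧ b = 0) ∨
    (a = 0 ∧ b = 4) ∨ (a = 1 ∧ b = 5) ∨ (a = 2 ∧ b = 6))

/-- The stirrer: two 4-cycles 0-1-2-3 and 0-1-4-5 sharing exactly the edge 0-1,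
with a pendant vertex 6 attached to the endpoint 0 of the shared edge. -/
def stirrer : SimpleGraph (Fin 7) :=
  SimpleGraph.fromRel (fun a b =>
    (a = 0 ∧ b = 1) ∨ (a = 1 ∧ b = 2) ∨ (a = 2 ∧ b = 3) ∨ (a = 3 ∧ b = 0) ∨
    (a = 1 ∧ b = 4) ∨ (a = 4 ∧ b = 5) ∨ (a = 5 ∧ b = 0) ∨ (a = 0 ∧ b = 6))

/-- The tripod: the star K_{1,3} with each edge subdivided once
(centre 0 with paths 0-1-2, 0-3-4, 0-5-6). -/
def tripod : SimpleGraph (Fin 7) :=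
  SimpleGraph.fromRel (fun a b =>
    (a = 0 ∧ b = 1) ∨ (a = 1 ∧ b = 2) ∨ (a = 0 ∧ b = 3) ∨ (a = 3 ∧ b = 4) ∨
    (a = 0 ∧ b = 5) ∨ (a = 5 ∧ b = 6))

/-- A graph is fast if it contains no induced armchair, stirrer or tripod. -/
def Fast {V : Type*} (G : SimpleGraph V) : Prop :=
  ¬ HasInducedCopy G armchair ∧ ¬ HasInducedCopy G stirrer ∧ ¬ HasInducedCopy G tripod

/-- A graph is hole-free if it contains no induced cycle of length at least 5. -/
def HoleFree {V : Type*} (G : SimpleGraph V) : Prop :=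
  ∀ n : ℕ, 5 ≤ n → ¬ HasInducedCopy G (SimpleGraph.cycleGraph n)


namespace FastPW

lemma hasInducedCopy_iff {V W : Type*} (G : SimpleGraph V) (H : SimpleGraph W) :
    HasInducedCopy G H ↔ Nonempty (H ↪g G) := by
  constructor
  · rintro ⟨S, ⟨e⟩⟩
    exact ⟨(SimpleGraph.Embedding.induce S).comp e.symm.toEmbedding⟩
  · rintro ⟨f⟩
    exact ⟨Set.range f, ⟨f.isoInduceRange.symm⟩⟩

lemma hasInducedCopy_of_map {V W : Type*} (G : SimpleGraph V) (H : SimpleGraph W)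
    (f : W → V) (hf : Function.Injective f) (h : ∀ i j, G.Adj (f i) (f j) ↔ H.Adj i j) :
    HasInducedCopy G H :=
  (hasInducedCopy_iff G H).2 ⟨⟨⟨f, hf⟩, h _ _⟩⟩

lemma hasInducedCopy_of_twinfree {V W : Type*} (G : SimpleGraph V) (H : SimpleGraph W)
    (f : W → V) (hH : ∀ i j, (∀ k, H.Adj i k ↔ H.Adj j k) → i = j)
    (h : ∀ i j, G.Adj (f i) (f j) ↔ H.Adj i j) :
    HasInducedCopy G H :=
  hasInducedCopy_of_map G H f
    (fun i j hij => hH i j fun k => by rw [← h, ← h, hij]) h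

instance : DecidableRel armchair.Adj := by unfold armchair; infer_instance
instance : DecidableRel stirrer.Adj := by unfold stirrer; infer_instance
instance : DecidableRel tripod.Adj := by unfold tripod; infer_instance

/-- The working hypotheses: a graph with a proper 2-colouring, fast and hole-free. -/
structure Good {V : Type*} (G : SimpleGraph V) (col : V → Bool) : Prop where
  col : ∀ ⦃x y⦄, G.Adj x y → col x ≠ col y
  hole : HoleFree G
  fast : Fast G

variable {V : Type*} {G : SimpleGraph V} {col : V → Bool}

/-- Reduction of an embedding check to ordered pairs `i < j`. -/
lemma adj_iff_of_lt {n : ℕ} {H : SimpleGraph (Fin n)} (f : Fin n → V)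
    (h : ∀ i j, i < j → (G.Adj (f i) (f j) ↔ H.Adj i j)) (i j : Fin n) :
    G.Adj (f i) (f j) ↔ H.Adj i j := by
  rcases lt_trichotomy i j with hij | rfl | hij
  · exact h i j hij
  · simp
  · rw [G.adj_comm, H.adj_comm]; exact h j i hij

lemma Good.nadj (hG : Good G col) {x y z : V} (h1 : G.Adj x z) (h2 : G.Adj y z) :
    ¬ G.Adj x y := by
  intro h
  have a := hG.col h1
  have b := hG.col h2
  have c := hG.col h
  revert a b c
  cases col x <;> cases col y <;> cases col z <;> simp

lemma Good.ne_iff (hG : Good G col) {x y : V} (h : G.Adj x y) : col y = !col x := by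
  have := hG.col h
  revert this
  cases col x <;> cases col y <;> simp

lemma Good.nadj_of_col (hG : Good G col) {x y : V} (h : col x = col y) : ¬ G.Adj x y :=
  fun hadj => hG.col hadj h

/-- No induced armchair, in explicit form. -/
lemma Good.armchair (hG : Good G col) {c1 c2 c3 c4 p1 p2 p3 : V}
    (e1 : G.Adj c1 c2) (e2 : G.Adj c2 c3) (e3 : G.Adj c3 c4) (e4 : G.Adj c4 c1)
    (e5 : G.Adj c1 p1) (e6 : G.Adj c2 p2) (e7 : G.Adj c3 p3)
    (n1 : ¬ G.Adj c1 p3) (n2 : ¬ G.Adj c3 p1) (n3 : ¬ G.Adj p2 c4) (n4 : ¬ G.Adj p2 p1)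
    (n5 : ¬ G.Adj p2 p3) : False := by
  refine hG.fast.1 (hasInducedCopy_of_twinfree G _ ![c1, c2, c3, c4, p1, p2, p3] (by decide) ?_)
  have k1 := hG.ne_iff e1
  have k2 := hG.ne_iff e2
  have k3 := hG.ne_iff e3
  have k5 := hG.ne_iff e5
  have k6 := hG.ne_iff e6
  have k7 := hG.ne_iff e7
  have e4' := e4.symm
  have n3' : ¬ G.Adj c4 p2 := fun h => n3 h.symm
  have n4' : ¬ G.Adj p1 p2 := fun h => n4 h.symm
  refine adj_iff_of_lt _ ?_
  intro i j hij
  fin_cases i <;> fin_cases j <;> first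
    | exact absurd hij (by decide)
    | exact iff_of_true (by assumption) (by decide)
    | exact iff_of_false (by assumption) (by decide)
    | exact iff_of_false (hG.nadj_of_col (by simp_all)) (by decide)

/-- No induced stirrer, in explicit form. -/
lemma Good.stirrer (hG : Good G col) {a b c d e f p : V}
    (e1 : G.Adj a b) (e2 : G.Adj b c) (e3 : G.Adj c d) (e4 : G.Adj d a)
    (e5 : G.Adj b e) (e6 : G.Adj e f) (e7 : G.Adj f a) (e8 : G.Adj a p)
    (n1 : ¬ G.Adj c f) (n2 : ¬ G.Adj c p) (n3 : ¬ G.Adj d e) (n4 : ¬ G.Adj e p) : False := by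
  refine hG.fast.2.1 (hasInducedCopy_of_twinfree G _ ![a, b, c, d, e, f, p] (by decide) ?_)
  have k1 := hG.ne_iff e1
  have k2 := hG.ne_iff e2
  have k3 := hG.ne_iff e3
  have k5 := hG.ne_iff e5
  have k6 := hG.ne_iff e6
  have k8 := hG.ne_iff e8
  have e4' := e4.symm
  have e7' := e7.symm
  refine adj_iff_of_lt _ ?_
  intro i j hij
  fin_cases i <;> fin_cases j <;> first
    | exact absurd hij (by decide)
    | exact iff_of_true (by assumption) (by decide)
    | exact iff_of_false (by assumption) (by decide)
    | exact iff_of_false (hG.nadj_of_col (by simp_all)) (by decide)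

/-- No induced tripod, in explicit form. -/
lemma Good.tripod (hG : Good G col) {o a a' b b' c c' : V}
    (e1 : G.Adj o a) (e2 : G.Adj a a') (e3 : G.Adj o b) (e4 : G.Adj b b')
    (e5 : G.Adj o c) (e6 : G.Adj c c')
    (n1 : ¬ G.Adj a b') (n2 : ¬ G.Adj a c') (n3 : ¬ G.Adj b a') (n4 : ¬ G.Adj b c')
    (n5 : ¬ G.Adj c a') (n6 : ¬ G.Adj c b') : False := by
  refine hG.fast.2.2 (hasInducedCopy_of_twinfree G _ ![o, a, a', b, b', c, c'] (by decide) ?_)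
  have k1 := hG.ne_iff e1
  have k2 := hG.ne_iff e2
  have k3 := hG.ne_iff e3
  have k4 := hG.ne_iff e4
  have k5 := hG.ne_iff e5
  have k6 := hG.ne_iff e6
  have n3' : ¬ G.Adj a' b := fun h => n3 h.symm
  have n5' : ¬ G.Adj a' c := fun h => n5 h.symm
  have n6' : ¬ G.Adj b' c := fun h => n6 h.symm
  refine adj_iff_of_lt _ ?_
  intro i j hij
  fin_cases i <;> fin_cases j <;> first
    | exact absurd hij (by decide)
    | exact iff_of_true (by assumption) (by decide)
    | exact iff_of_false (by assumption) (by decide)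
    | exact iff_of_false (hG.nadj_of_col (by simp_all)) (by decide)

lemma cycle_adj_iff {n : ℕ} (i j : Fin (n + 2)) (hn : 1 ≤ n) :
    (SimpleGraph.cycleGraph (n + 2)).Adj i j ↔
      (i.val + 1 = j.val ∨ j.val + 1 = i.val ∨ (i.val = 0 ∧ j.val = n + 1) ∨
        (j.val = 0 ∧ i.val = n + 1)) := by
  rw [SimpleGraph.cycleGraph_adj']
  have hi := i.isLt
  have hj := j.isLt
  have key : ∀ a b : Fin (n + 2), (a - b).val = 1 ↔
      (b.val + 1 = a.val ∨ (a.val = 0 ∧ b.val = n + 1)) := by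
    intro a b
    have ha := a.isLt
    have hb := b.isLt
    rw [Fin.sub_def]
    simp only
    by_cases hab : b.val ≤ a.val
    · have : (n + 2 - b.val + a.val) = (a.val - b.val) + (n + 2) := by omega
      rw [this, Nat.add_mod_right, Nat.mod_eq_of_lt (by omega)]
      omega
    · rw [Nat.mod_eq_of_lt (by omega)]
      omega
  rw [key, key]
  tauto

/-- No induced 6-cycle, in explicit form. -/
lemma Good.c6 (hG : Good G col) {a b c d e f : V}
    (e1 : G.Adj a b) (e2 : G.Adj b c) (e3 : G.Adj c d) (e4 : G.Adj d e)
    (e5 : G.Adj e f) (e6 : G.Adj f a)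
    (n1 : ¬ G.Adj a d) (n2 : ¬ G.Adj b e) (n3 : ¬ G.Adj c f) : False := by
  refine hG.hole 6 (by norm_num)
    (hasInducedCopy_of_twinfree G _ ![a, b, c, d, e, f] ?_ ?_)
  · intro i j
    simp only [cycle_adj_iff (n := 4) _ _ (by norm_num)]
    revert i j
    decide
  have k1 := hG.ne_iff e1
  have k2 := hG.ne_iff e2
  have k3 := hG.ne_iff e3
  have k4 := hG.ne_iff e4
  have k5 := hG.ne_iff e5
  have e6' := e6.symm
  refine adj_iff_of_lt _ ?_
  intro i j hij
  rw [cycle_adj_iff (n := 4) _ _ (by norm_num)]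
  fin_cases i <;> fin_cases j <;> first
    | exact absurd hij (by decide)
    | exact iff_of_true (by assumption) (by decide)
    | exact iff_of_false (by assumption) (by decide)
    | exact iff_of_false (hG.nadj_of_col (by simp_all)) (by decide)

/-- A breadth-first level function from the base vertex `u` (in the bipartite case). -/
structure Lev (G : SimpleGraph V) (u : V) (f : V → ℕ) : Prop where
  zero : ∀ x, f x = 0 ↔ x = u
  adj : ∀ ⦃x y⦄, G.Adj x y → f y = f x + 1 ∨ f x = f y + 1
  parent : ∀ x, 0 < f x → ∃ y, G.Adj y x ∧ f y + 1 = f x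

lemma Good.lev (hG : Good G col) (hc : G.Connected) (u : V) : Lev G u (G.dist u) := by
  have hpar : ∀ x y, G.Adj x y → (Even (G.dist u x) ↔ ¬ Even (G.dist u y)) := by
    intro x y hxy
    let C : G.Coloring Bool := SimpleGraph.Coloring.mk col (fun {a b} h => hG.col h)
    obtain ⟨p, hp⟩ := hc.exists_walk_length_eq_dist u x
    obtain ⟨q, hq⟩ := hc.exists_walk_length_eq_dist u y
    have h1 := C.even_length_iff_congr p
    have h2 := C.even_length_iff_congr q
    have h3 := hG.ne_iff hxy
    rw [← hp, ← hq, h1, h2]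
    change (col u = true ↔ col x = true) ↔ ¬ (col u = true ↔ col y = true)
    rw [h3]
    cases col u <;> cases col x <;> simp
  refine ⟨?_, ?_, ?_⟩
  · intro x
    rw [hc.dist_eq_zero_iff]
    exact eq_comm
  · intro x y hxy
    have h1 := hpar x y hxy
    have h2 : G.dist u y ≤ G.dist u x + G.dist x y := hc.dist_triangle
    have h3 : G.dist u x ≤ G.dist u y + G.dist y x := hc.dist_triangle
    rw [SimpleGraph.dist_eq_one_iff_adj.2 hxy] at h2
    rw [SimpleGraph.dist_eq_one_iff_adj.2 hxy.symm] at h3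
    have h4 : G.dist u x ≠ G.dist u y := by
      intro h; rw [h] at h1; tauto
    omega
  · intro x hx
    obtain ⟨p, hp⟩ := hc.exists_walk_length_eq_dist x u
    cases p with
    | nil => simp at hx
    | @cons _ y _ h q =>
      refine ⟨y, h.symm, ?_⟩
      have h1 : G.dist y u ≤ q.length := SimpleGraph.dist_le q
      simp only [SimpleGraph.Walk.length_cons] at hp
      have h2 : G.dist x u ≤ G.dist x y + G.dist y u := hc.dist_triangle
      rw [SimpleGraph.dist_eq_one_iff_adj.2 h] at h2
      rw [SimpleGraph.dist_comm (u := u) (v := y), SimpleGraph.dist_comm (u := u) (v := x)]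
      omega

/-- Hole lemma: two vertices on one level with a common child have a common parent. -/
lemma Good.common_parent (hG : Good G col) {u : V} {f : V → ℕ} (hL : Lev G u f) {p q v : V}
    (hp : G.Adj p v) (hq : G.Adj q v) (hv : f v = f p + 1) (hpq : f q = f p) (hpos : 0 < f p) :
    ∃ w, G.Adj w p ∧ G.Adj w q ∧ f w + 1 = f p := by
  by_cases hne : p = q
  · subst hne
    obtain ⟨w, h1, h2⟩ := hL.parent p hpos
    exact ⟨w, h1, h1, h2⟩
  by_contra hno
  let S : Set V := {x | f x < f p ∨ x = p ∨ x = q}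
  let H := G.induce S
  have hadj : ∀ a b : S, H.Adj a b ↔ G.Adj a.1 b.1 := fun a b => by simp [H]
  have huS : u ∈ S := Or.inl (by rw [(hL.zero u).2 rfl]; exact hpos)
  have hreach : ∀ n, ∀ x : S, f x.1 = n → H.Reachable ⟨u, huS⟩ x := by
    intro n
    induction n with
    | zero =>
      intro x hx
      have : x = ⟨u, huS⟩ := Subtype.ext ((hL.zero _).1 hx)
      rw [this]
    | succ n ih =>
      intro x hx
      obtain ⟨y, hy, hfy⟩ := hL.parent x.1 (by omega)
      have hyS : y ∈ S := by
        refine Or.inl ?_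
        rcases x.2 with h | h | h
        · omega
        · rw [h] at hfy; omega
        · rw [h] at hfy; omega
      have := ih ⟨y, hyS⟩ (by simp only; omega)
      exact this.trans ((hadj ⟨y, hyS⟩ x).2 hy).reachable
  let P : S := ⟨p, Or.inr (Or.inl rfl)⟩
  let Q : S := ⟨q, Or.inr (Or.inr rfl)⟩
  have hconn : ∀ a b : S, H.Reachable a b := fun a b =>
    (hreach _ a rfl).symm.trans (hreach _ b rfl)
  obtain ⟨W, hW⟩ := (hconn P Q).exists_walk_length_eq_dist
  set n := H.dist P Q with hn
  have hHc : H.Connected := { preconnected := hconn, nonempty := ⟨P⟩ }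
  let g : ℕ → S := fun i => W.getVert i
  have hg0 : g 0 = P := by simp [g]
  have hgn : g n = Q := by simp [g, ← hW]
  have hgd : ∀ i, i ≤ n → H.dist P (g i) = i := by
    intro i hi
    have h1 : H.dist P (g i) ≤ (W.take i).length := SimpleGraph.dist_le _
    have h2 : H.dist (g i) Q ≤ (W.drop i).length := SimpleGraph.dist_le _
    have h3 : H.dist P Q ≤ H.dist P (g i) + H.dist (g i) Q := hHc.dist_triangle
    have h4 : (W.take i).length ≤ i := by simp [SimpleGraph.Walk.take_length]
    have h5 : (W.drop i).length = W.length - i := by simp [SimpleGraph.Walk.drop_length]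
    omega
  have hgadj : ∀ i, i < n → G.Adj (g i).1 (g (i + 1)).1 := fun i hi =>
    (hadj _ _).1 (W.adj_getVert_succ (by omega))
  have hgadj' : ∀ i k, i ≤ n → k ≤ n → G.Adj (g i).1 (g k).1 → i + 1 = k ∨ k + 1 = i := by
    intro i k hi hk h
    have h0 := (hadj _ _).2 h
    have h1 : H.dist P (g k) ≤ H.dist P (g i) + H.dist (g i) (g k) := hHc.dist_triangle
    have h2 : H.dist P (g i) ≤ H.dist P (g k) + H.dist (g k) (g i) := hHc.dist_triangle
    rw [SimpleGraph.dist_eq_one_iff_adj.2 h0, hgd i hi, hgd k hk] at h1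
    rw [SimpleGraph.dist_eq_one_iff_adj.2 h0.symm, hgd i hi, hgd k hk] at h2
    have h3 : i ≠ k := by
      rintro rfl
      exact G.loopless.irrefl _ h
    omega
  have hginj : ∀ i k, i ≤ n → k ≤ n → (g i).1 = (g k).1 → i = k := by
    intro i k hi hk h
    have h1 := hgd i hi
    have h2 := hgd k hk
    rw [Subtype.ext h] at h1
    omega
  have hvS : v ∉ S := by
    rintro (h | h | h)
    · omega
    · subst h; omega
    · subst h; omega
  have hgv : ∀ i, i ≤ n → G.Adj (g i).1 v → i = 0 ∨ i = n := by
    intro i hi h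
    rcases (g i).2 with h' | h' | h'
    · have := hL.adj h
      omega
    · left
      have h2 := hgd i hi
      have h3 : g i = P := Subtype.ext h'
      rw [h3, SimpleGraph.dist_self] at h2
      omega
    · right
      have h2 := hgd i hi
      have h3 : g i = Q := Subtype.ext h'
      rw [h3] at h2
      omega
  have hn3 : 3 ≤ n := by
    by_contra hlt
    have h012 : n = 0 ∨ n = 1 ∨ n = 2 := by omega
    rcases h012 with h | h | h
    · rw [h, hg0] at hgn
      exact hne (congrArg Subtype.val hgn)
    · have := hgadj 0 (by omega)
      rw [hg0, zero_add, ← h, hgn] at this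
      have := hL.adj this
      simp only [P, Q] at this
      omega
    · have a1 := hgadj 0 (by omega)
      have a2 := hgadj 1 (by omega)
      rw [hg0, zero_add] at a1
      have e2 : g (1 + 1) = Q := by rw [← hgn, h]
      rw [e2] at a2
      refine hno ⟨(g 1).1, a1.symm, a2, ?_⟩
      have b1 := hL.adj a1
      rcases (g 1).2 with h' | h' | h'
      · simp only [P] at b1
        omega
      · rw [h'] at b1; simp only [P] at b1; omega
      · rw [h'] at b1; simp only [P] at b1; omega
  let F : Fin (n + 2) → V := fun i => if i.val ≤ n then (g i.val).1 else v
  have hF1 : ∀ i : Fin (n + 2), i.val ≤ n → F i = (g i.val).1 := fun i hi => if_pos hi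
  have hF2 : ∀ i : Fin (n + 2), i.val = n + 1 → F i = v := fun i hi => if_neg (by omega)
  refine hG.hole (n + 2) (by omega) (hasInducedCopy_of_map G _ F ?_ (adj_iff_of_lt F ?_))
  · intro i k hik
    have hi := i.isLt
    have hk := k.isLt
    apply Fin.ext
    by_cases h1 : i.val ≤ n <;> by_cases h2 : k.val ≤ n
    · rw [hF1 i h1, hF1 k h2] at hik
      exact hginj _ _ h1 h2 hik
    · rw [hF1 i h1, hF2 k (by omega)] at hik
      exact absurd (hik ▸ (g i.val).2) hvS
    · rw [hF2 i (by omega), hF1 k h2] at hik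
      exact absurd (hik ▸ (g k.val).2) hvS
    · omega
  · intro i k hik
    have hi := i.isLt
    have hk := k.isLt
    have hik' : i.val < k.val := hik
    rw [cycle_adj_iff _ _ (by omega)]
    by_cases h2 : k.val ≤ n
    · rw [hF1 i (by omega), hF1 k h2]
      constructor
      · intro h
        have := hgadj' _ _ (by omega) h2 h
        omega
      · intro h
        have h3 : k.val = i.val + 1 := by omega
        rw [h3]
        exact hgadj _ (by omega)
    · rw [hF1 i (by omega), hF2 k (by omega)]
      constructor
      · intro h
        have := hgv _ (by omega) h
        omega
      · intro h
        have h3 : i.val = 0 ∨ i.val = n := by omega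
        rcases h3 with h3 | h3
        · rw [h3, hg0]; exact hp
        · rw [h3, hgn]; exact hq

lemma Lev.na {u : V} {f : V → ℕ} (hL : Lev G u f) {x y : V}
    (h : f y ≠ f x + 1 ∧ f x ≠ f y + 1) : ¬ G.Adj x y := by
  intro h'
  have := hL.adj h'
  omega

/-- `v` is an end vertex: it is farthest from `u`, with an inclusion-minimal neighbourhood. -/
structure EndV (G : SimpleGraph V) (u v : V) (f : V → ℕ) : Prop where
  lev : Lev G u f
  max : ∀ x, f x ≤ f v
  three : 3 ≤ f v
  min : ∀ y, f y = f v → (∀ s, G.Adj y s → G.Adj v s) → ∀ s, G.Adj v s → G.Adj y s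

lemma EndV.nbr {u v : V} {f : V → ℕ} (hE : EndV G u v f) {p : V} (h : G.Adj p v) :
    f v = f p + 1 := by
  have h1 := hE.lev.adj h
  have h2 := hE.max p
  omega

lemma EndV.lev_two {u v : V} {f : V → ℕ} (hE : EndV G u v f) {p x : V} (h : G.Adj p v)
    (hx : G.Adj p x) : f x = f v ∨ f x + 2 = f v := by
  have h1 := hE.lev.adj hx
  have h2 := hE.nbr h
  omega

/-- A vertex at distance two from `v` missing a neighbour of `v` has a private neighbour. -/
lemma EndV.priv {u v : V} {f : V → ℕ} (hE : EndV G u v f) {p q y : V}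
    (hp : G.Adj p v) (hpy : ¬ G.Adj p y) (hq : G.Adj q v) (hqy : G.Adj q y) :
    ∃ s, G.Adj y s ∧ ¬ G.Adj v s := by
  have h3 := hE.three
  rcases hE.lev_two hq hqy with h | h
  · by_contra hno
    push Not at hno
    exact hpy (hE.min y h hno p hp.symm).symm
  · obtain ⟨z, hz, hfz⟩ := hE.lev.parent y (by omega)
    exact ⟨z, hz.symm, hE.lev.na (by omega)⟩

lemma Good.claim_two_mixed (hG : Good G col) {u v : V} {f : V → ℕ} (hE : EndV G u v f)
    {p q x y : V} (hp : G.Adj p v) (hq : G.Adj q v) (hpx : G.Adj p x) (hqy : G.Adj q y)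
    (npy : ¬ G.Adj p y) (nqx : ¬ G.Adj q x) (_ : f x + 2 = f v) (hfy : f y = f v) : False := by
  have h3 := hE.three
  have fp := hE.nbr hp
  have fq := hE.nbr hq
  obtain ⟨s, hys, nvs⟩ := hE.priv hp npy hq hqy
  have fs : f y = f s + 1 := by
    have h1 := hE.lev.adj hys
    have h2 := hE.max s
    omega
  have nxq : ¬ G.Adj x q := fun h => nqx h.symm
  have nsx : ¬ G.Adj s x := fun h =>
    hG.c6 hpx.symm hp hq.symm hqy hys h nxq npy nvs
  have key : ∀ r, G.Adj r p → G.Adj r q → f r + 1 = f p → ¬ G.Adj r s := by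
    intro r hrp hrq hfr hrs
    obtain ⟨r', hr', hfr'⟩ := hE.lev.parent r (by omega)
    exact hG.stirrer hrq hq hp.symm hrp.symm hqy hys hrs.symm hr'.symm nvs
      (hE.lev.na (by omega)) npy (hE.lev.na (by omega))
  obtain ⟨r, hrp, hrq, hfr⟩ := hG.common_parent hE.lev hp hq fp (by omega) (by omega)
  have nrs := key r hrp hrq hfr
  obtain ⟨t, htq, hts, hft⟩ := hG.common_parent hE.lev hqy hys.symm (by omega) (by omega) (by omega)
  have ntp : ¬ G.Adj t p := fun h => key t h htq (by omega) hts
  obtain ⟨z, hzr, hzt, hfz⟩ := hG.common_parent hE.lev hrq htq (by omega) (by omega) (by omega)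
  by_cases hzx : G.Adj z x
  · exact hG.c6 hzx hpx.symm hp hq.symm htq.symm hzt.symm (hE.lev.na (by omega)) nxq
      (fun h => ntp h.symm)
  · exact hG.armchair hrp.symm hrq hq hp.symm hpx hzr.symm hqy npy nqx
      (hE.lev.na (by omega)) hzx (hE.lev.na (by omega))

/-- An end vertex is not the middle of an induced path on five vertices. -/
lemma Good.claim_two (hG : Good G col) {u v : V} {f : V → ℕ} (hE : EndV G u v f)
    {p q x y : V} (hp : G.Adj p v) (hq : G.Adj q v) (hpx : G.Adj p x) (hqy : G.Adj q y)
    (npy : ¬ G.Adj p y) (nqx : ¬ G.Adj q x) : False := by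
  have h3 := hE.three
  have fp := hE.nbr hp
  have fq := hE.nbr hq
  obtain ⟨r, hrp, hrq, hfr⟩ := hG.common_parent hE.lev hp hq fp (by omega) (by omega)
  rcases hE.lev_two hp hpx with hx | hx <;> rcases hE.lev_two hq hqy with hy | hy
  · obtain ⟨r', hr', hfr'⟩ := hE.lev.parent r (by omega)
    exact hG.armchair hrp.symm hrq hq hp.symm hpx hr'.symm hqy npy nqx
      (hE.lev.na (by omega)) (hE.lev.na (by omega)) (hE.lev.na (by omega))
  · exact hG.claim_two_mixed hE hq hp hqy hpx nqx npy hy hx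
  · exact hG.claim_two_mixed hE hp hq hpx hqy npy nqx hx hy
  · obtain ⟨z1, hz1x, hz1r, hf1⟩ :=
      hG.common_parent hE.lev hpx.symm hrp (by omega) (by omega) (by omega)
    obtain ⟨z2, hz2y, hz2r, hf2⟩ :=
      hG.common_parent hE.lev hqy.symm hrq (by omega) (by omega) (by omega)
    have n2 : ¬ G.Adj x z2 := fun h =>
      hG.c6 hpx.symm hp hq.symm hqy hz2y.symm h.symm (fun h => nqx h.symm) npy
        (hE.lev.na (by omega))
    exact hG.stirrer hrp hp hq.symm hrq.symm hpx hz1x.symm hz1r hz2r.symm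
      (hE.lev.na (by omega)) (hE.lev.na (by omega)) nqx n2

lemma Good.claim_three_aux (hG : Good G col) {u v : V} {f : V → ℕ} (hE : EndV G u v f)
    {w p q x y : V} (hw : G.Adj w v) (hwp : G.Adj w p) (hwq : G.Adj w q) (hpx : G.Adj p x)
    (hqy : G.Adj q y) (npy : ¬ G.Adj p y) (nqx : ¬ G.Adj q x) (nvx : ¬ G.Adj v x)
    (nvy : ¬ G.Adj v y) (hfp : f p = f v) :
    ∃ r, G.Adj r w ∧ G.Adj r x ∧ f r + 1 = f w ∧ ¬ G.Adj r y := by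
  have h3 := hE.three
  have fw := hE.nbr hw
  have fx : f p = f x + 1 := by
    have h1 := hE.lev.adj hpx
    have h2 := hE.max x
    omega
  obtain ⟨r, hrw, hrx, hfr⟩ :=
    hG.common_parent hE.lev hwp hpx.symm (by omega) (by omega) (by omega)
  refine ⟨r, hrw, hrx, hfr, fun hry => ?_⟩
  exact hG.stirrer hrw.symm hry hqy.symm hwq.symm hrx hpx.symm hwp.symm hw
    (fun h => npy h.symm) (fun h => nvy h.symm) nqx (fun h => nvx h.symm)

/-- The second obstruction near an end vertex. -/
lemma Good.claim_three (hG : Good G col) {u v : V} {f : V → ℕ} (hE : EndV G u v f)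
    {w p q x y : V} (hw : G.Adj w v) (hwp : G.Adj w p) (hwq : G.Adj w q) (hpx : G.Adj p x)
    (hqy : G.Adj q y) (npy : ¬ G.Adj p y) (nqx : ¬ G.Adj q x) (nvx : ¬ G.Adj v x)
    (nvy : ¬ G.Adj v y) : False := by
  have h3 := hE.three
  have fw := hE.nbr hw
  -- reduce to two vertices `a`, `b` one level below `w`
  have fin : ∀ a b, G.Adj a w → G.Adj b w → f a + 1 = f w → f b + 1 = f w →
      G.Adj a x → G.Adj b y → ¬ G.Adj a y → ¬ G.Adj b x → False := by
    intro a b haw hbw hfa hfb hax hby nay nbx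
    obtain ⟨z, hza, hzb, hfz⟩ :=
      hG.common_parent hE.lev haw hbw (by omega) (by omega) (by omega)
    exact hG.armchair haw hbw.symm hzb.symm hza hax hw hby nay nbx
      (hE.lev.na (by omega)) nvx nvy
  have ex1 : ∃ a, G.Adj a w ∧ G.Adj a x ∧ f a + 1 = f w ∧ ¬ G.Adj a y := by
    rcases hE.lev_two hw hwp with h | h
    · exact hG.claim_three_aux hE hw hwp hwq hpx hqy npy nqx nvx nvy h
    · exact ⟨p, hwp.symm, hpx, by omega, npy⟩
  have ex2 : ∃ b, G.Adj b w ∧ G.Adj b y ∧ f b + 1 = f w ∧ ¬ G.Adj b x := by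
    rcases hE.lev_two hw hwq with h | h
    · exact hG.claim_three_aux hE hw hwq hwp hqy hpx nqx npy nvy nvx h
    · exact ⟨q, hwq.symm, hqy, by omega, nqx⟩
  obtain ⟨a, a1, a2, a3, a4⟩ := ex1
  obtain ⟨b, b1, b2, b3, b4⟩ := ex2
  exact fin a b a1 b1 a3 b3 a2 b2 a4 b4

/-- No induced matching of size two between consecutive levels from an end vertex. -/
lemma Good.no_matching (hG : Good G col) {u v : V} {f l : V → ℕ} (hE : EndV G u v f)
    (hL : Lev G v l) : ∀ (n : ℕ) {p q x y : V}, l p = n → l q = n → l x = n + 1 → l y = n + 1 →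
    G.Adj p x → G.Adj q y → ¬ G.Adj p y → ¬ G.Adj q x → False := by
  intro n
  induction n with
  | zero =>
    intro p q x y hp hq _ _ hpx _ _ nqx
    rw [(hL.zero p).1 hp] at hpx
    rw [(hL.zero q).1 hq] at nqx
    exact nqx hpx
  | succ n ih =>
    intro p q x y hp hq hx hy hpx hqy npy nqx
    by_cases hw : ∃ w, G.Adj w p ∧ G.Adj w q ∧ l w = n
    · obtain ⟨w, hwp, hwq, hlw⟩ := hw
      by_cases h0 : n = 0
      · have := (hL.zero w).1 (by omega)
        subst this
        exact hG.claim_two hE hwp.symm hwq.symm hpx hqy npy nqx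
      obtain ⟨z, hzw, hlz⟩ := hL.parent w (by omega)
      by_cases h1 : n = 1
      · have := (hL.zero z).1 (by omega)
        subst this
        exact hG.claim_three hE hzw.symm hwp hwq hpx hqy npy nqx (hL.na (by omega))
          (hL.na (by omega))
      obtain ⟨z', hzz, hlz'⟩ := hL.parent z (by omega)
      exact hG.tripod hwp hpx hwq hqy hzw.symm hzz.symm npy (hL.na (by omega)) nqx
        (hL.na (by omega)) (hL.na (by omega)) (hL.na (by omega))
    · obtain ⟨p', hp', hlp'⟩ := hL.parent p (by omega)
      obtain ⟨q', hq', hlq'⟩ := hL.parent q (by omega)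
      exact ih (p := p') (q := q') (x := p) (y := q) (by omega) (by omega) hp hq hp' hq'
        (fun h => hw ⟨p', hp', h, by omega⟩) (fun h => hw ⟨q', h, hq', by omega⟩)

/-- The third obstruction: a parent and a child of `x` both missed by `y` on the same level. -/
lemma Good.no_dominate (hG : Good G col) {u v : V} {f l : V → ℕ} (hE : EndV G u v f)
    (hL : Lev G v l) {p r x y : V} (hxy : l x = l y) (hp : l p + 1 = l x) (hr : l r = l x + 1)
    (hpx : G.Adj p x) (hrx : G.Adj r x) (npy : ¬ G.Adj p y) (nry : ¬ G.Adj r y) : False := by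
  obtain ⟨q, hqy, hlq⟩ := hL.parent y (by omega)
  have hqx : G.Adj q x := by
    by_contra h
    exact hG.no_matching hE hL (l p) (p := p) (q := q) (x := x) (y := y) rfl (by omega)
      (by omega) (by omega) hpx hqy npy h
  have hp0 : 0 < l p := by
    by_contra h
    have e1 := (hL.zero p).1 (by omega)
    have e2 := (hL.zero q).1 (by omega)
    rw [e1, ← e2] at npy
    exact npy hqy
  obtain ⟨w, hwp, hwq, hlw⟩ := hG.common_parent hL hpx hqx (by omega) (by omega) hp0
  by_cases hw0 : l w = 0
  · have := (hL.zero w).1 hw0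
    subst this
    obtain ⟨s, hys, nws⟩ := hE.priv hwp.symm npy hwq.symm hqy
    have hls : l s = l y + 1 := by
      have h1 := hL.adj hys
      rcases h1 with h1 | h1
      · exact h1
      · exfalso
        obtain ⟨t, hts, hlt⟩ := hL.parent s (by omega)
        have := (hL.zero t).1 (by omega)
        subst this
        exact nws hts
    have hsx : G.Adj x s := by
      by_contra h
      exact hG.no_matching hE hL (l x) (p := x) (q := y) (x := r) (y := s) rfl (by omega)
        (by omega) (by omega) hrx.symm hys h (fun h => nry h.symm)
    exact hG.stirrer hqx.symm hqy hys hsx.symm hwq.symm hwp hpx hrx.symm (fun h => npy h.symm)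
      (fun h => nry h.symm) (hL.na (by omega)) (hL.na (by omega))
  · obtain ⟨w', hw', hlw'⟩ := hL.parent w (by omega)
    exact hG.armchair hqx.symm hwq.symm hwp hpx hrx.symm hqy hw'.symm (hL.na (by omega))
      (hL.na (by omega)) (fun h => npy h.symm) (fun h => nry h.symm) (hL.na (by omega))

/-- The comparison relation within a level. -/
def lle (G : SimpleGraph V) (l : V → ℕ) (x y : V) : Prop :=
  (∀ p, l p + 1 = l x → G.Adj p y → G.Adj p x) ∧ (∀ r, l r = l x + 1 → G.Adj r x → G.Adj r y)

lemma Good.lle_total (hG : Good G col) {u v : V} {f l : V → ℕ} (hE : EndV G u v f)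
    (hL : Lev G v l) {x y : V} (hxy : l x = l y) : lle G l x y ∨ lle G l y x := by
  by_contra hno
  push Not at hno
  obtain ⟨h1, h2⟩ := hno
  unfold lle at h1 h2
  rw [not_and_or] at h1 h2
  push Not at h1 h2
  rcases h1 with ⟨p, hp, hpy, npx⟩ | ⟨r, hr, hrx, nry⟩ <;>
    rcases h2 with ⟨p', hp', hpx', npy'⟩ | ⟨r', hr', hry', nrx'⟩
  · exact hG.no_matching hE hL (l p) (p := p) (q := p') (x := y) (y := x) rfl (by omega)
      (by omega) (by omega) hpy hpx' npx npy'
  · exact hG.no_dominate hE hL hxy.symm (by omega) hr' hpy hry' npx nrx'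
  · exact hG.no_dominate hE hL hxy (by omega) hr hpx' hrx npy' nry
  · exact hG.no_matching hE hL (l x) (p := x) (q := y) (x := r) (y := r') rfl (by omega)
      (by omega) (by omega) hrx.symm hry'.symm (fun h => nrx' h.symm) (fun h => nry h.symm)

lemma Good.parity (hG : Good G col) {u : V} {l : V → ℕ} (hL : Lev G u l) :
    ∀ (n : ℕ) (x : V), l x = n → (col x = col u ↔ n % 2 = 0) := by
  intro n
  induction n with
  | zero =>
    intro x hx
    rw [(hL.zero x).1 hx]
    simp
  | succ n ih =>
    intro x hx
    obtain ⟨y, hy, hly⟩ := hL.parent x (by omega)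
    have h1 := ih y (by omega)
    rw [hG.ne_iff hy]
    have h2 : (!col y) = col u ↔ ¬ (col y = col u) := by
      cases col y <;> cases col u <;> simp
    rw [h2, h1]
    omega

lemma Good.parity_eq (hG : Good G col) {u : V} {l : V → ℕ} (hL : Lev G u l) {x y : V}
    (h : col x = col y) : l x % 2 = l y % 2 := by
  have h1 := hG.parity hL _ x rfl
  have h2 := hG.parity hL _ y rfl
  rw [h] at h1
  have := h1.symm.trans h2
  omega

/-- A connected good graph has an end vertex, or diameter at most two. -/
lemma Good.exists_end [Finite V] (_ : Good G col) (hc : G.Connected)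
    (hlev : ∀ u, Lev G u (G.dist u)) :
    (∀ x y, G.dist x y ≤ 2) ∨ ∃ u v, EndV G u v (G.dist u) := by
  classical
  haveI := hc.nonempty
  obtain ⟨⟨u0, v0⟩, hmax⟩ := Finite.exists_max (fun z : V × V => G.dist z.1 z.2)
  by_cases hD : G.dist u0 v0 ≤ 2
  · left
    intro x y
    exact (hmax (x, y)).trans hD
  right
  let S : Set V := {v | ∃ u, G.dist u v = G.dist u0 v0}
  obtain ⟨v, ⟨u, huv⟩, hmin⟩ := Set.exists_min_image S (fun v => (G.neighborSet v).ncard)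
    (Set.toFinite S) ⟨v0, u0, rfl⟩
  refine ⟨u, v, hlev u, ?_, by omega, ?_⟩
  · intro x
    rw [huv]
    exact hmax (u, x)
  · intro y hy hsub s hs
    have h1 := hmin y ⟨u, by rw [hy, huv]⟩
    have h2 : G.neighborSet y = G.neighborSet v :=
      Set.eq_of_subset_of_ncard_le (fun t ht => hsub t ht) h1 (Set.toFinite _)
    have h3 : s ∈ G.neighborSet v := hs
    rw [← h2] at h3
    exact h3

/-- Consecutive-ones preorder for a connected good graph. -/
lemma Good.exists_order [Finite V] (hG : Good G col) (hc : G.Connected) :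
    ∃ R : V → V → Prop, (∀ x y, R x y ∨ R y x) ∧ (∀ x y z, R x y → R y z → R x z) ∧
      ∀ a a' a'' b, col a = col a' → R a a' → R a' a'' → G.Adj b a → G.Adj b a'' →
        G.Adj b a' := by
  have hlev := fun u => hG.lev hc u
  rcases hG.exists_end hc hlev with h2 | ⟨u, v, hE⟩
  · refine ⟨fun _ _ => True, by simp, by simp, ?_⟩
    intro a a' a'' b hcol _ _ hba _
    have hL := hlev b
    have h1 := hG.parity_eq hL hcol
    have h3 := h2 b a'
    rw [SimpleGraph.dist_eq_one_iff_adj.2 hba] at h1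
    exact SimpleGraph.dist_eq_one_iff_adj.1 (by omega)
  · have hL := hlev v
    generalize G.dist v = l at hL
    refine ⟨fun x y => l x < l y ∨ (l x = l y ∧ lle G l x y), ?_, ?_, ?_⟩
    · intro x y
      rcases lt_trichotomy (l x) (l y) with h | h | h
      · exact Or.inl (Or.inl h)
      · rcases hG.lle_total hE hL h with h' | h'
        · exact Or.inl (Or.inr ⟨h, h'⟩)
        · exact Or.inr (Or.inr ⟨h.symm, h'⟩)
      · exact Or.inr (Or.inl h)
    · rintro x y z (h1 | ⟨h1, h1'⟩) (h2 | ⟨h2, h2'⟩)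
      · left; omega
      · left; omega
      · left; omega
      · right
        refine ⟨by omega, fun p hp hpz => h1'.1 p hp (h2'.1 p (by omega) hpz),
          fun r hr hrx => h2'.2 r (by omega) (h1'.2 r hr hrx)⟩
    · intro a a' a'' b hcol h1 h2 hba hba''
      have hpar := hG.parity_eq hL hcol
      have k1 := hL.adj hba
      have k2 := hL.adj hba''
      rcases h1 with h1 | ⟨h1, h1'⟩
      · have : l a' = l a'' := by omega
        rcases h2 with h2 | ⟨h2, h2'⟩
        · omega
        · exact h2'.1 b (by omega) hba''
      · by_cases hb : l b = l a + 1
        · exact h1'.2 b hb hba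
        · rcases h2 with h2 | ⟨h2, h2'⟩
          · omega
          · exact h2'.1 b (by omega) hba''

lemma Good.induce (hG : Good G col) (S : Set V) : Good (G.induce S) (fun x => col x.1) := by
  have key : ∀ {W : Type} (H : SimpleGraph W), HasInducedCopy (G.induce S) H →
      HasInducedCopy G H := by
    intro W H h
    obtain ⟨e⟩ := (hasInducedCopy_iff _ _).1 h
    exact (hasInducedCopy_iff _ _).2 ⟨(SimpleGraph.Embedding.induce S).comp e⟩
  refine ⟨fun x y h => hG.col h, fun n hn h => hG.hole n hn (key _ h), ?_⟩
  exact ⟨fun h => hG.fast.1 (key _ h), fun h => hG.fast.2.1 (key _ h),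
    fun h => hG.fast.2.2 (key _ h)⟩

/-- Consecutive-ones preorder for an arbitrary good graph. -/
lemma Good.exists_order' [Finite V] (hG : Good G col) :
    ∃ R : V → V → Prop, (∀ x y, R x y ∨ R y x) ∧ (∀ x y z, R x y → R y z → R x z) ∧
      ∀ a a' a'' b, col a = col a' → R a a' → R a' a'' → G.Adj b a → G.Adj b a'' →
        G.Adj b a' := by
  classical
  have h1 : ∀ c : G.ConnectedComponent, ∃ R : V → V → Prop,
      (∀ x ∈ c.supp, ∀ y ∈ c.supp, R x y ∨ R y x) ∧
      (∀ x y z, R x y → R y z → R x z) ∧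
      ∀ a a' a'' b, b ∈ c.supp → col a = col a' → R a a' → R a' a'' → G.Adj b a →
        G.Adj b a'' → G.Adj b a' := by
    intro c
    have hc : (G.induce c.supp).Connected := c.connected_toSimpleGraph
    obtain ⟨R, r1, r2, r3⟩ := (hG.induce c.supp).exists_order hc
    refine ⟨fun x y => ∃ (hx : x ∈ c.supp) (hy : y ∈ c.supp), R ⟨x, hx⟩ ⟨y, hy⟩, ?_, ?_, ?_⟩
    · intro x hx y hy
      rcases r1 ⟨x, hx⟩ ⟨y, hy⟩ with h | h
      · exact Or.inl ⟨hx, hy, h⟩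
      · exact Or.inr ⟨hy, hx, h⟩
    · rintro x y z ⟨hx, hy, h⟩ ⟨_, hz, h'⟩
      exact ⟨hx, hz, r2 _ _ _ h h'⟩
    · rintro a a' a'' b hb hcol ⟨ha, ha', h⟩ ⟨_, ha'', h'⟩ hba hba''
      exact r3 ⟨a, ha⟩ ⟨a', ha'⟩ ⟨a'', ha''⟩ ⟨b, hb⟩ hcol h h' hba hba''
  choose R r1 r2 r3 using h1
  haveI : Finite G.ConnectedComponent :=
    Finite.of_surjective G.connectedComponentMk (fun c => c.exists_rep)
  obtain ⟨n, ⟨e⟩⟩ := Finite.exists_equiv_fin G.ConnectedComponent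
  let k : V → Fin n := fun x => e (G.connectedComponentMk x)
  have hk : ∀ x y, k x = k y ↔ G.connectedComponentMk x = G.connectedComponentMk y :=
    fun x y => e.injective.eq_iff
  have hkadj : ∀ x y, G.Adj x y → k x = k y := fun x y h =>
    (hk x y).2 (SimpleGraph.ConnectedComponent.eq.2 h.reachable)
  refine ⟨fun x y => k x < k y ∨ (k x = k y ∧ R (G.connectedComponentMk x) x y), ?_, ?_, ?_⟩
  · intro x y
    rcases lt_trichotomy (k x) (k y) with h | h | h
    · exact Or.inl (Or.inl h)
    · have h' := (hk x y).1 h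
      rcases r1 (G.connectedComponentMk x) x rfl y h'.symm with h2 | h2
      · exact Or.inl (Or.inr ⟨h, h2⟩)
      · exact Or.inr (Or.inr ⟨h.symm, h' ▸ h2⟩)
    · exact Or.inr (Or.inl h)
  · rintro x y z (h1 | ⟨h1, h1'⟩) (h2 | ⟨h2, h2'⟩)
    · exact Or.inl (h1.trans h2)
    · exact Or.inl (h2 ▸ h1)
    · exact Or.inl (h1 ▸ h2)
    · refine Or.inr ⟨h1.trans h2, r2 _ x y z h1' ?_⟩
      rw [(hk x y).1 h1]
      exact h2'
  · intro a a' a'' b hcol h1 h2 hba hba''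
    have e1 := hkadj _ _ hba
    have e2 := hkadj _ _ hba''
    rcases h1 with h1 | ⟨h1, h1'⟩ <;> rcases h2 with h2 | ⟨h2, h2'⟩
    · exact absurd (h1.trans h2) (by rw [← e1, ← e2]; exact lt_irrefl _)
    · exact absurd h1 (by rw [h2, ← e1, ← e2]; exact lt_irrefl _)
    · exact absurd h2 (by rw [← h1, ← e1, ← e2]; exact lt_irrefl _)
    · rw [← (hk a a').1 h1] at h2'
      exact (r3 _ a a' a'' b ((hk b a).1 e1) hcol h1' h2' hba hba'' : G.Adj b _)

/-- One half of the bound. -/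
lemma half_bound {V : Type*} [Fintype V] [DecidableEq V]
    (G : SimpleGraph V) [DecidableRel G.Adj]
    (hhole : HoleFree G) (hfast : Fast G)
    (A B : Finset V) (hpart : A ∪ B = Finset.univ) (hdisj : Disjoint A B)
    (hA : A.Nonempty)
    (hAi : IndepVertexSet G ↑A) (hBi : IndepVertexSet G ↑B) :
    pathwidth G ≤ A.sup fun v => G.degree v := by
  classical
  have hmem : ∀ x, x ∉ A → x ∈ B := fun x hx => by
    have : x ∈ A ∪ B := by rw [hpart]; exact Finset.mem_univ x
    rcases Finset.mem_union.1 this with h | h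
    · exact absurd h hx
    · exact h
  have hmem2 : ∀ x, x ∈ A → x ∉ B := fun x hx hx' => Finset.disjoint_left.1 hdisj hx hx'
  have hadjA : ∀ x y, G.Adj x y → (x ∈ A ↔ y ∉ A) := by
    intro x y h
    constructor
    · intro hx hy
      exact hAi hx hy h
    · intro hy
      by_contra hx
      exact hBi (hmem x hx) (hmem y hy) h
  have hG : Good G (fun x => decide (x ∈ A)) := by
    refine ⟨fun x y h => ?_, hhole, hfast⟩
    have := hadjA x y h
    intro h'
    rw [decide_eq_decide] at h'
    tauto
  obtain ⟨R, r1, r2, r3⟩ := hG.exists_order'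
  let R' : V → V → Prop := fun x y => y ∉ A ∨ (x ∈ A ∧ R x y)
  have t1 : ∀ x y, R' x y ∨ R' y x := by
    intro x y
    have := r1 x y
    by_cases hx : x ∈ A <;> by_cases hy : y ∈ A <;> simp only [R'] <;> tauto
  have t2 : ∀ x y z, R' x y → R' y z → R' x z := by
    intro x y z h1 h2
    have := r2 x y z
    simp only [R'] at h1 h2 ⊢
    tauto
  haveI : Std.Total R' := ⟨t1⟩
  haveI : IsTrans V R' := ⟨t2⟩
  let T : Finset V := Finset.univ.filter fun x => x ∈ A ∨ ∀ y, ¬ G.Adj x y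
  let L : List V := T.toList.insertionSort R'
  have hLmem : ∀ x, x ∈ L ↔ (x ∈ A ∨ ∀ y, ¬ G.Adj x y) := by
    intro x
    simp [L, T]
  have hLnd : L.Nodup := (List.perm_insertionSort R' T.toList).nodup_iff.2 T.nodup_toList
  have hLpw : L.Pairwise R' := List.pairwise_insertionSort R' _
  have hget : ∀ x, x ∈ L → ∃ i : Fin L.length, L.get i = x := fun x hx => List.mem_iff_get.1 hx
  obtain ⟨a0, ha0⟩ := hA
  let D : PathDecomp G :=
    { len := L.length
      len_pos := List.length_pos_of_mem ((hLmem a0).2 (Or.inl ha0))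
      bags := fun i => insert (L.get i) (G.neighborFinset (L.get i))
      mem_bag := by
        intro v
        by_cases hv : v ∈ L
        · obtain ⟨i, hi⟩ := hget v hv
          exact ⟨i, by rw [hi]; exact Finset.mem_insert_self _ _⟩
        · rw [hLmem] at hv
          push Not at hv
          obtain ⟨hvA, y, hy⟩ := hv
          obtain ⟨i, hi⟩ := hget y ((hLmem y).2 (Or.inl ((hadjA y v hy.symm).2 hvA)))
          exact ⟨i, by rw [hi]; simp [hy.symm]⟩
      edge_bag := by
        intro x y h
        by_cases hx : x ∈ A
        · obtain ⟨i, hi⟩ := hget x ((hLmem x).2 (Or.inl hx))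
          exact ⟨i, by rw [hi]; simp [h]⟩
        · obtain ⟨i, hi⟩ := hget y ((hLmem y).2 (Or.inl ((hadjA y x h.symm).2 hx)))
          exact ⟨i, by rw [hi]; simp [h.symm]⟩
      interval := by
        intro v i j k hij hjk hi hk
        have hin : ∀ i : Fin L.length, v ∈ insert (L.get i) (G.neighborFinset (L.get i)) →
            v ∈ L → L.get i = v := by
          intro i hi hvL
          rw [Finset.mem_insert, SimpleGraph.mem_neighborFinset] at hi
          rcases hi with hi | hi
          · exact hi.symm
          · exfalso
            rcases (hLmem v).1 hvL with hv | hv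
            · rcases (hLmem _).1 (L.get_mem i) with h | h
              · exact (hadjA _ _ hi).1 h hv
              · exact h _ hi
            · exact hv _ hi.symm
        by_cases hvL : v ∈ L
        · have e1 := hin i hi hvL
          have e2 := hin k hk hvL
          have e3 : i = k := hLnd.injective_get (e1.trans e2.symm)
          have e4 : j = i := le_antisymm (e3 ▸ hjk) hij
          rw [e4]
          exact hi
        · have hadj : ∀ i : Fin L.length,
              v ∈ insert (L.get i) (G.neighborFinset (L.get i)) → G.Adj (L.get i) v := by
            intro i hi
            rw [Finset.mem_insert, SimpleGraph.mem_neighborFinset] at hi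
            rcases hi with hi | hi
            · exact absurd (hi ▸ L.get_mem i) hvL
            · exact hi
          have a1 := hadj i hi
          have a2 := hadj k hk
          have hvA : v ∉ A := fun h => hvL ((hLmem v).2 (Or.inl h))
          have m1 := (hadjA _ _ a1).2 hvA
          have m2 := (hadjA _ _ a2).2 hvA
          rcases eq_or_lt_of_le hij with e | hij'
          · rw [← e]; exact hi
          rcases eq_or_lt_of_le hjk with e | hjk'
          · rw [e]; exact hk
          have p1 := List.pairwise_iff_get.1 hLpw i j hij'
          have p2 := List.pairwise_iff_get.1 hLpw j k hjk'
          have q2 : L.get j ∈ A ∧ R (L.get j) (L.get k) := p2.resolve_left (fun h => h m2)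
          have q1 : L.get i ∈ A ∧ R (L.get i) (L.get j) := p1.resolve_left (fun h => h q2.1)
          have := r3 (L.get i) (L.get j) (L.get k) v (by simp only [q1.1, q2.1]) q1.2 q2.2
            a1.symm a2.symm
          rw [Finset.mem_insert, SimpleGraph.mem_neighborFinset]
          exact Or.inr this.symm }
  have hw : D.width ≤ A.sup fun v => G.degree v := by
    unfold PathDecomp.width
    rw [Nat.sub_le_iff_le_add]
    refine Finset.sup_le fun i _ => ?_
    change (insert (L.get i) (G.neighborFinset (L.get i))).card ≤ _
    refine (Finset.card_insert_le _ _).trans ?_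
    rw [SimpleGraph.card_neighborFinset_eq_degree]
    refine Nat.add_le_add_right ?_ 1
    rcases (hLmem _).1 (L.get_mem i) with h | h
    · exact Finset.le_sup (f := fun v => G.degree v) h
    · have : G.degree (L.get i) = 0 := by
        rw [← SimpleGraph.card_neighborFinset_eq_degree, Finset.card_eq_zero]
        ext y
        simp only [SimpleGraph.mem_neighborFinset]
        simpa using h y
      rw [this]
      exact Nat.zero_le _
  have hs : pathwidth G ≤ D.width := Nat.sInf_le ⟨D, rfl⟩
  exact hs.trans hw

end FastPW

/-- For a bipartite, hole-free, fast finite simple graph with bipartition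
`(A, B)` into nonempty independent sets,
`pw(G) ≤ min(max_{v ∈ A} deg v, max_{v ∈ B} deg v)`. -/
theorem fast_holeFree_pathwidth_le_min_maxDegree {V : Type*} [Fintype V] [DecidableEq V]
    (G : SimpleGraph V) [DecidableRel G.Adj]
    (hhole : HoleFree G) (hfast : Fast G)
    (A B : Finset V) (hpart : A ∪ B = Finset.univ) (hdisj : Disjoint A B)
    (hA : A.Nonempty) (hB : B.Nonempty)
    (hAi : IndepVertexSet G ↑A) (hBi : IndepVertexSet G ↑B) :
    pathwidth G ≤ min (A.sup fun v => G.degree v) (B.sup fun v => G.degree v) := by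
  refine le_min ?_ ?_
  · exact FastPW.half_bound G hhole hfast A B hpart hdisj hA hAi hBi
  · exact FastPW.half_bound G hhole hfast B A (by rw [Finset.union_comm]; exact hpart)
      hdisj.symm hB hBi hAi
end

section
/- Every bipartite fast finite simple graph G with at least one vertex satisfies pw(G) ≤ 2Δ(G), where Δ(G) is the maximum degree of G. -/
open SimpleGraph

/-- Abstract excluded configurations for a bipartite relation. -/
structure Sys {V : Type*} (r : V → V → Prop) (A : Finset V) : Prop where
  anti : ∀ a ∈ A, ∀ a' ∈ A, a ≠ a' → ∃ b, r a b ∧ ¬ r a' b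
  TB : ∀ d b1 b2 b3, ∀ a1 ∈ A, ∀ a2 ∈ A, ∀ a3 ∈ A, r a1 d → r a2 d → r a3 d →
    r a1 b1 → ¬ r a1 b2 → ¬ r a1 b3 → ¬ r a2 b1 → r a2 b2 → ¬ r a2 b3 →
    ¬ r a3 b1 → ¬ r a3 b2 → r a3 b3 → False
  TA : ∀ d1 d2 d3, ∀ a ∈ A, ∀ a1 ∈ A, ∀ a2 ∈ A, ∀ a3 ∈ A, r a d1 → r a d2 → r a d3 →
    r a1 d1 → ¬ r a1 d2 → ¬ r a1 d3 → ¬ r a2 d1 → r a2 d2 → ¬ r a2 d3 →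
    ¬ r a3 d1 → ¬ r a3 d2 → r a3 d3 → False
  ST : ∀ s s' b1 b2, ∀ a ∈ A, ∀ u0 ∈ A, ∀ u1 ∈ A, r a s → r a s' → ¬ r a b1 → ¬ r a b2 →
    r u0 s → ¬ r u0 s' → r u0 b1 → ¬ r u0 b2 → r u1 s → r u1 s' → r u1 b1 → r u1 b2 → False
  CY : ∀ (m : ℕ) (u b : ℕ → V) (s : V), 2 ≤ m → (∀ i ≤ m, u i ∈ A) →
    (∀ i ≤ m, ∀ j < m, r (u i) (b j) ↔ (i = j ∨ i = j + 1)) →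
    (∀ i ≤ m, r (u i) s ↔ (i = 0 ∨ i = m)) → False

theorem Sys.mono {V : Type*} {r : V → V → Prop} {A A' : Finset V} (h : Sys r A) (hs : A' ⊆ A) :
    Sys r A' where
  anti := fun a ha a' ha' => h.anti a (hs ha) a' (hs ha')
  TB := fun d b1 b2 b3 a1 h1 a2 h2 a3 h3 => h.TB d b1 b2 b3 a1 (hs h1) a2 (hs h2) a3 (hs h3)
  TA := fun d1 d2 d3 a h0 a1 h1 a2 h2 a3 h3 =>
    h.TA d1 d2 d3 a (hs h0) a1 (hs h1) a2 (hs h2) a3 (hs h3)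
  ST := fun s s' b1 b2 a h1 u0 h2 u1 h3 => h.ST s s' b1 b2 a (hs h1) u0 (hs h2) u1 (hs h3)
  CY := fun m u b s hm hu => h.CY m u b s hm (fun i hi => hs (hu i hi))

/-- `C` cannot be split without a crossing `b` not related to `x`. -/
def ConnOff {V : Type*} (r : V → V → Prop) (x : V) (C : Finset V) : Prop :=
  ∀ S ⊆ C, S.Nonempty → S ≠ C →
    ∃ b, ¬ r x b ∧ (∃ u ∈ S, r u b) ∧ ∃ w ∈ C, w ∉ S ∧ r w b

def IsPth {V : Type*} (r : V → V → Prop) (a : V) (Q : Finset V) (k : ℕ) (f g : ℕ → V) : Prop :=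
  (∀ i ≤ k, f i ∈ Q) ∧ ∀ i < k, r (f i) (g i) ∧ r (f (i + 1)) (g i) ∧ ¬ r a (g i)

theorem IsPth.shift {V : Type*} {r : V → V → Prop} {a : V} {Q : Finset V} {k : ℕ} {f g : ℕ → V}
    (h : IsPth r a Q k f g) (i : ℕ) (hi : i ≤ k) :
    IsPth r a Q (k - i) (fun t => f (t + i)) (fun t => g (t + i)) := by
  refine ⟨fun t ht => h.1 _ (by omega), fun t ht => ?_⟩
  have := h.2 (t + i) (by omega)
  dsimp only
  rw [show t + 1 + i = t + i + 1 by omega]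
  exact this

theorem IsPth.trunc {V : Type*} {r : V → V → Prop} {a : V} {Q : Finset V} {k : ℕ} {f g : ℕ → V}
    (h : IsPth r a Q k f g) (i : ℕ) (hi : i ≤ k) : IsPth r a Q i f g :=
  ⟨fun t ht => h.1 _ (by omega), fun t ht => h.2 t (by omega)⟩

theorem IsPth.short {V : Type*} {r : V → V → Prop} {a : V} {Q : Finset V} {k : ℕ} {f g : ℕ → V}
    (h : IsPth r a Q k f g) (p q : ℕ) (hpq : p + 2 ≤ q) (hq : q ≤ k) (b : V)
    (hb : ¬ r a b) (hp : r (f p) b) (hqb : r (f q) b) :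
    ∃ f' g' : ℕ → V, IsPth r a Q (k - (q - p - 1)) f' g' ∧ f' 0 = f 0 ∧
      f' (k - (q - p - 1)) = f k := by
  refine ⟨fun t => if t ≤ p then f t else f (t + (q - p - 1)),
    fun t => if t < p then g t else if t = p then b else g (t + (q - p - 1)), ⟨?_, ?_⟩, ?_, ?_⟩
  · intro i hi
    dsimp only
    split_ifs
    · exact h.1 _ (by omega)
    · exact h.1 _ (by omega)
  · intro i hi
    dsimp only
    rcases lt_trichotomy i p with h1 | h1 | h1
    · rw [if_pos h1.le, if_pos h1, if_pos (by omega)]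
      exact h.2 i (by omega)
    · subst h1
      rw [if_pos le_rfl, if_neg (by omega), if_pos rfl, if_neg (by omega),
        show i + 1 + (q - i - 1) = q by omega]
      exact ⟨hp, hqb, hb⟩
    · rw [if_neg (by omega), if_neg (by omega), if_neg (by omega), if_neg (by omega),
        show i + 1 + (q - p - 1) = i + (q - p - 1) + 1 by omega]
      exact h.2 _ (by omega)
  · simp
  · dsimp only
    rw [if_neg (by omega)]
    congr 1
    omega

theorem exists_pth {V : Type*} {r : V → V → Prop} {a : V} {Q : Finset V}
    (hc : ConnOff r a Q) {u w : V} (hu : u ∈ Q) (hw : w ∈ Q) :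
    ∃ k f g, IsPth r a Q k f g ∧ f 0 = u ∧ f k = w := by
  classical
  by_contra hcon
  set S := Q.filter (fun w => ∃ k f g, IsPth r a Q k f g ∧ f 0 = u ∧ f k = w) with hS
  have huS : u ∈ S := by
    rw [hS, Finset.mem_filter]
    exact ⟨hu, 0, fun _ => u, fun _ => u, ⟨fun _ _ => hu, fun i hi => by omega⟩, rfl, rfl⟩
  have hne : S ≠ Q := by
    intro h
    rw [← h, hS, Finset.mem_filter] at hw
    exact hcon hw.2
  obtain ⟨b, hb, ⟨x, hx, hxb⟩, y, hy, hyS, hyb⟩ := hc S (Finset.filter_subset _ _) ⟨u, huS⟩ hne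
  apply hyS
  rw [hS, Finset.mem_filter] at hx ⊢
  obtain ⟨hxQ, k, f, g, hp, h0, hk⟩ := hx
  refine ⟨hy, k + 1, fun t => if t ≤ k then f t else y, fun t => if t < k then g t else b,
    ⟨?_, ?_⟩, ?_, ?_⟩
  · intro i hi
    dsimp only
    split_ifs with h
    · exact hp.1 _ h
    · exact hy
  · intro i hi
    dsimp only
    rcases Nat.lt_or_ge i k with h | h
    · rw [if_pos h.le, if_pos h, if_pos (by omega)]
      exact hp.2 i h
    · have : i = k := by omega
      subst this
      rw [if_pos le_rfl, if_neg (by omega), if_neg (by omega), hk]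
      exact ⟨hxb, hyb, hb⟩
  · simp [h0]
  · simp

/-- Nestedness of the neighbourhoods in `Q` of the neighbours of `a`. -/
theorem Sys.nested {V : Type*} {r : V → V → Prop} {A : Finset V} (h : Sys r A)
    {a : V} {Q : Finset V} (ha : a ∈ A) (hQ : Q ⊆ A) (hc : ConnOff r a Q)
    {s s' u w : V} (hs : r a s) (hs' : r a s') (hu : u ∈ Q) (hw : w ∈ Q)
    (hus : r u s) (hus' : ¬ r u s') (hws' : r w s') (hws : ¬ r w s) : False := by
  classical
  have hex : ∃ k, ∃ s s' f g, IsPth r a Q k f g ∧ r a s ∧ r a s' ∧ r (f 0) s ∧ ¬ r (f 0) s' ∧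
      r (f k) s' ∧ ¬ r (f k) s := by
    obtain ⟨k, f, g, hp, h0, hk⟩ := exists_pth hc hu hw
    refine ⟨k, s, s', f, g, hp, hs, hs', ?_, ?_, ?_, ?_⟩ <;> first | rw [h0] | rw [hk]
    all_goals assumption
  have hmin := fun m => @Nat.find_min _ _ hex m
  obtain ⟨s, s', f, g, hp, hs, hs', h0s, h0s', hks', hks⟩ := Nat.find_spec hex
  generalize Nat.find hex = k at *
  clear hex hus hus' hws hws'
  have hk : 1 ≤ k := by
    rcases Nat.eq_zero_or_pos k with h0 | h0
    · subst h0; exact absurd h0s hks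
    · exact h0
  have P1 : ∀ i, 0 < i → i < k → (r (f i) s ↔ r (f i) s') := by
    intro i hi hik
    constructor
    · intro h1
      by_contra h2
      apply hmin (k - i) (by omega)
      refine ⟨s, s', _, _, hp.shift i hik.le, hs, hs', ?_⟩
      simp only [zero_add, show k - i + i = k by omega]
      exact ⟨h1, h2, hks', hks⟩
    · intro h1
      by_contra h2
      exact hmin i hik ⟨s, s', _, _, hp.trunc i hik.le, hs, hs', h0s, h0s', h1, h2⟩
  have hsh : ∀ p q b, p + 2 ≤ q → q ≤ k → ¬ r a b → r (f p) b → r (f q) b → False := by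
    intro p q b h1 h2 h3 h4 h5
    obtain ⟨f', g', hp', e0, ek⟩ := hp.short p q h1 h2 b h3 h4 h5
    apply hmin (k - (q - p - 1)) (by omega)
    refine ⟨s, s', f', g', hp', hs, hs', ?_⟩
    rw [e0, ek]
    exact ⟨h0s, h0s', hks', hks⟩
  have P2 : ∀ i ≤ k, ∀ j < k, r (f i) (g j) ↔ (i = j ∨ i = j + 1) := by
    intro i hi j hj
    obtain ⟨g1, g2, g3⟩ := hp.2 j hj
    constructor
    · intro hr
      by_contra hne
      rcases Nat.lt_or_ge i j with h1 | h1
      · exact hsh i (j + 1) (g j) (by omega) (by omega) g3 hr g2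
      · exact hsh j i (g j) (by omega) (by omega) g3 g1 hr
    · rintro (rfl | rfl) <;> assumption
  by_cases hi : ∃ i, 0 < i ∧ i < k ∧ r (f i) s
  · have hmin2 := fun m => @Nat.find_min _ _ hi m
    obtain ⟨hi0, hik, his⟩ := Nat.find_spec hi
    generalize Nat.find hi = i at *
    rcases Nat.lt_or_ge i 2 with h2 | h2
    · have : i = 1 := by omega
      subst this
      have n1 : ¬ r (f 0) (g 1) := by rw [P2 0 (by omega) 1 hik]; omega
      obtain ⟨g1, g2, g3⟩ := hp.2 0 (by omega)
      obtain ⟨g4, g5, g6⟩ := hp.2 1 (by omega)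
      exact h.ST s s' (g 0) (g 1) a ha (f 0) (hQ (hp.1 0 (by omega))) (f 1) (hQ (hp.1 1 (by omega)))
        hs hs' g3 g6 h0s h0s' g1 n1 his ((P1 1 hi0 hik).1 his) g2 g4
    · refine h.CY i f g s h2 (fun t ht => hQ (hp.1 t (by omega)))
        (fun t ht j hj => P2 t (by omega) j (by omega)) (fun t ht => ?_)
      constructor
      · intro hts
        by_contra hne
        exact hmin2 t (by omega) ⟨by omega, by omega, hts⟩
      · rintro (rfl | rfl) <;> assumption
  · push Not at hi
    refine h.CY (k + 1) (fun t => if t ≤ k then f t else a) (fun t => if t < k then g t else s') s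
      (by omega) ?_ ?_ ?_
    · intro t ht
      split_ifs with h1
      · exact hQ (hp.1 t h1)
      · exact ha
    · intro i hik j hj
      by_cases h1 : i ≤ k <;> by_cases h2 : j < k
      · rw [if_pos h1, if_pos h2]; exact P2 i h1 j h2
      · rw [if_pos h1, if_neg h2]
        constructor
        · intro hr
          rcases Nat.eq_zero_or_pos i with h3 | h3
          · subst h3; exact absurd hr h0s'
          · by_contra hne
            exact hi i h3 (by omega) ((P1 i h3 (by omega)).2 hr)
        · intro hh
          have : i = k := by omega
          subst this; exact hks'
      · rw [if_neg h1, if_pos h2]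
        constructor
        · intro hr; exact absurd hr (hp.2 j h2).2.2
        · intro hh; omega
      · rw [if_neg h1, if_neg h2]
        constructor
        · intro; omega
        · intro; exact hs'
    · intro i hik
      split_ifs with h1
      · constructor
        · intro hr
          by_contra hne
          rcases Nat.lt_or_ge i k with h3 | h3
          · exact hi i (by omega) h3 hr
          · have : i = k := by omega
            subst this; exact hks hr
        · intro hh
          have : i = 0 := by omega
          subst this; exact h0s
      · constructor
        · intro; omega
        · intro; exact hs

/-- Convex enumeration. -/
def Convex' {V : Type*} (r : V → V → Prop) (A : Finset V) (pos : V → ℕ) : Prop :=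
  ∀ b, ∀ a1 ∈ A, ∀ a2 ∈ A, ∀ a3 ∈ A, pos a1 ≤ pos a2 → pos a2 ≤ pos a3 →
    r a1 b → r a3 b → r a2 b

theorem Sys.greedy {V : Type*} [DecidableEq V] {r : V → V → Prop} {A : Finset V} (h : Sys r A) (n : ℕ) :
    ∀ (Q : Finset V) (a : V), Q.card = n → Q ⊆ A → a ∈ A → a ∉ Q → ConnOff r a Q →
      (Q.Nonempty → ∃ s, r a s ∧ ∃ q ∈ Q, r q s) →
      ∃ pos : V → ℕ, Convex' r (insert a Q) pos ∧ (∀ q ∈ Q, pos a < pos q) ∧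
        Set.InjOn pos (insert a Q : Finset V) := by
  classical
  induction n with
  | zero =>
    intro Q a hcard hQ ha haQ hc hS
    have : Q = ∅ := Finset.card_eq_zero.1 hcard
    subst this
    refine ⟨fun _ => 0, ?_, by simp, by simp⟩
    intro b a1 h1 a2 h2 a3 h3 _ _ hr _
    simp at h1 h2
    subst h1; subst h2; exact hr
  | succ n ih =>
    intro Q a hcard hQ ha haQ hc hS
    have hQne : Q.Nonempty := Finset.card_pos.1 (by omega)
    obtain ⟨s0, has0, q0, hq0, hqs0⟩ := hS hQne
    -- the smallest neighbourhood
    have hT : ∃ a' ∈ Q, ∀ s, r a s → (∃ q ∈ Q, r q s) → r a' s := by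
      have hex : ∃ k, ∃ s, r a s ∧ (∃ q ∈ Q, r q s) ∧ (Q.filter (fun q => r q s)).card = k :=
        ⟨_, s0, has0, ⟨q0, hq0, hqs0⟩, rfl⟩
      have hmin := fun m => @Nat.find_min _ _ hex m
      obtain ⟨s, has, ⟨q, hq, hqs⟩, hk⟩ := Nat.find_spec hex
      generalize Nat.find hex = k at *
      refine ⟨q, hq, fun s' has' hqs' => ?_⟩
      by_contra hno
      have hsub : Q.filter (fun q => r q s') ⊂ Q.filter (fun q => r q s) := by
        rw [Finset.ssubset_iff_of_subset]
        · exact ⟨q, Finset.mem_filter.2 ⟨hq, hqs⟩, fun hh => hno (Finset.mem_filter.1 hh).2⟩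
        · intro w hw
          rw [Finset.mem_filter] at hw ⊢
          refine ⟨hw.1, ?_⟩
          by_contra hws
          exact h.nested ha hQ hc has has' hq hw.1 hqs hno hw.2 hws
      have := Finset.card_lt_card hsub
      exact hmin _ (by omega) ⟨s', has', hqs', rfl⟩
    obtain ⟨a', ha'Q, ha'⟩ := hT
    have ha'A := hQ ha'Q
    have hne : a ≠ a' := fun hh => haQ (hh ▸ ha'Q)
    -- uniqueness
    have huniq : ∀ c ∈ Q, c ≠ a' → ∃ s, r a s ∧ (∃ q ∈ Q, r q s) ∧ ¬ r c s := by
      intro c hcQ hca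
      by_contra hcon
      push Not at hcon
      have hcA := hQ hcQ
      obtain ⟨t, ht1, ht2⟩ := h.anti a ha a' ha'A hne
      obtain ⟨f, hf1, hf2⟩ := h.anti a' ha'A c hcA hca.symm
      obtain ⟨b, hb1, hb2⟩ := h.anti c hcA a' ha'A hca
      exact h.TB s0 t f b a ha a' ha'A c hcA has0 (ha' s0 has0 ⟨q0, hq0, hqs0⟩)
        (hcon s0 has0 ⟨q0, hq0, hqs0⟩) ht1
        (fun hh => hf2 (hcon f hh ⟨a', ha'Q, hf1⟩)) (fun hh => hb2 (ha' b hh ⟨c, hcQ, hb1⟩))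
        ht2 hf1 hb2 (fun hh => ht2 (ha' t ht1 ⟨c, hcQ, hh⟩)) hf2 hb1
    have hd : ∀ c1 ∈ Q, c1 ≠ a' → ∀ c2 ∈ Q, c2 ≠ a' → ∃ d, r a d ∧ r a' d ∧ ¬ r c1 d ∧ ¬ r c2 d := by
      intro c1 h1 n1 c2 h2 n2
      obtain ⟨d1, x1, y1, z1⟩ := huniq c1 h1 n1
      obtain ⟨d2, x2, y2, z2⟩ := huniq c2 h2 n2
      by_cases e1 : r c2 d1
      · by_cases e2 : r c1 d2
        · exact (h.nested ha hQ hc x1 x2 h2 h1 e1 z2 e2 z1).elim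
        · exact ⟨d2, x2, ha' _ x2 y2, e2, z2⟩
      · exact ⟨d1, x1, ha' _ x1 y1, z1, e1⟩
    have hconn : ConnOff r a' (Q.erase a') := by
      intro C hC hCne hCne'
      by_contra hcross
      have hcr : ∀ b, ¬ r a' b → ∀ u ∈ C, ∀ w ∈ Q, w ≠ a' → w ∉ C → r u b → r w b → False := by
        intro b hb u hu w hw hwa hwC hub hwb
        exact hcross ⟨b, hb, ⟨u, hu, hub⟩, w, Finset.mem_erase.2 ⟨hwa, hw⟩, hwC, hwb⟩
      obtain ⟨w0, hw0, hw0C⟩ : ∃ w ∈ Q.erase a', w ∉ C := by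
        by_contra hh
        push Not at hh
        exact hCne' (Finset.Subset.antisymm hC hh)
      have hCQ : ∀ c ∈ C, c ∈ Q ∧ c ≠ a' := fun c hc =>
        ⟨Finset.mem_of_mem_erase (hC hc), Finset.ne_of_mem_erase (hC hc)⟩
      have ha'C : a' ∉ C := fun hh => (hCQ _ hh).2 rfl
      obtain ⟨e1, he1, c1, hc1, hc1e, hae1⟩ :
          ∃ e, ¬ r a e ∧ ∃ c ∈ C, r c e ∧ r a' e := by
        obtain ⟨b, hb, ⟨u, hu, hub⟩, w, hw, hwC, hwb⟩ := hc C (fun c hc => (hCQ c hc).1) hCne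
          (fun hh => ha'C (hh ▸ ha'Q))
        refine ⟨b, hb, u, hu, hub, ?_⟩
        by_contra hno
        by_cases hwa : w = a'
        · subst hwa; exact hno hwb
        · exact hcr b hno u hu w hw hwa hwC hub hwb
      obtain ⟨e2, he2, c2, hc2, hc2a, hc2C, hc2e, hae2⟩ :
          ∃ e, ¬ r a e ∧ ∃ c ∈ Q, c ≠ a' ∧ c ∉ C ∧ r c e ∧ r a' e := by
        obtain ⟨b, hb, ⟨u, hu, hub⟩, w, hw, hwC, hwb⟩ := hc (insert a' C)
          (by intro c hc
              rcases Finset.mem_insert.1 hc with rfl | hc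
              · exact ha'Q
              · exact (hCQ c hc).1) ⟨a', Finset.mem_insert_self _ _⟩
          (fun hh => by
            have : w0 ∈ insert a' C := hh ▸ Finset.mem_of_mem_erase hw0
            rcases Finset.mem_insert.1 this with h1 | h1
            · exact Finset.ne_of_mem_erase hw0 h1
            · exact hw0C h1)
        rw [Finset.mem_insert, not_or] at hwC
        refine ⟨b, hb, w, hw, hwC.1, hwC.2, hwb, ?_⟩
        by_contra hno
        rcases Finset.mem_insert.1 hu with h1 | h1
        · subst h1; exact hno hub
        · exact hcr b hno u h1 w hw hwC.1 hwC.2 hub hwb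
      by_cases hopt : ∃ e, ∃ c ∈ C, ∃ w ∈ Q, w ≠ a' ∧ w ∉ C ∧ r c e ∧ r w e
      · obtain ⟨e, c, hcC, w, hwQ, hwa, hwC, hce, hwe⟩ := hopt
        have hae : r a' e := by
          by_contra hno
          exact hcr e hno c hcC w hwQ hwa hwC hce hwe
        obtain ⟨d, _, hd2, hd3, hd4⟩ := hd c (hCQ c hcC).1 (hCQ c hcC).2 w hwQ hwa
        obtain ⟨b1, hb1, hb1'⟩ := h.anti c (hQ (hCQ c hcC).1) a' ha'A (hCQ c hcC).2
        obtain ⟨b2, hb2, hb2'⟩ := h.anti w (hQ hwQ) a' ha'A hwa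
        exact h.TB e d b1 b2 a' ha'A c (hQ (hCQ c hcC).1) w (hQ hwQ) hae hce hwe hd2 hb1' hb2'
          hd3 hb1 (fun hh => hcr b2 hb2' c hcC w hwQ hwa hwC hh hb2)
          hd4 (fun hh => hcr b1 hb1' c hcC w hwQ hwa hwC hb1 hh) hb2
      · have hopt' : ∀ e, ∀ c ∈ C, ∀ w ∈ Q, w ≠ a' → w ∉ C → r c e → r w e → False :=
          fun e c h1 w h2 h3 h4 h5 h6 => hopt ⟨e, c, h1, w, h2, h3, h4, h5, h6⟩
        obtain ⟨d, hd1, hd2, hd3, hd4⟩ := hd c1 (hCQ c1 hc1).1 (hCQ c1 hc1).2 c2 hc2 hc2a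
        exact h.TA e1 e2 d a' ha'A c1 (hQ (hCQ c1 hc1).1) c2 (hQ hc2) a ha hae1 hae2 hd2
          hc1e (fun hh => hopt' e2 c1 hc1 c2 hc2 hc2a hc2C hh hc2e) hd3
          (fun hh => hopt' e1 c1 hc1 c2 hc2 hc2a hc2C hc1e hh) hc2e hd4
          he1 he2 hd1
    have hnext : (Q.erase a').Nonempty → ∃ s, r a' s ∧ ∃ q ∈ Q.erase a', r q s := by
      rintro ⟨w0, hw0⟩
      obtain ⟨b, hb, ⟨u, hu, hub⟩, w, hw, hwC, hwb⟩ := hc {a'} (by simpa using ha'Q) (by simp)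
        (fun hh => by
          have := Finset.mem_of_mem_erase hw0
          rw [← hh, Finset.mem_singleton] at this
          exact Finset.ne_of_mem_erase hw0 this)
      rw [Finset.mem_singleton] at hu hwC
      subst hu
      exact ⟨b, hub, w, Finset.mem_erase.2 ⟨hwC, hw⟩, hwb⟩
    obtain ⟨pos, hcv, hfirst, hinj⟩ := ih (Q.erase a') a'
      (by rw [Finset.card_erase_of_mem ha'Q]; omega)
      ((Finset.erase_subset _ _).trans hQ) ha'A (Finset.notMem_erase _ _) hconn hnext
    rw [Finset.insert_erase ha'Q] at hcv hinj
    have hfirst' : ∀ q ∈ Q, pos a' ≤ pos q := by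
      intro q hq
      by_cases hqa : q = a'
      · rw [hqa]
      · exact (hfirst q (Finset.mem_erase.2 ⟨hqa, hq⟩)).le
    have hnea : ∀ q ∈ Q, q ≠ a := fun q hq hh => haQ (hh ▸ hq)
    refine ⟨fun x => if x = a then 0 else pos x + 1, ?_, ?_, ?_⟩
    · intro b a1 h1 a2 h2 a3 h3 h12 h23 hr1 hr3
      dsimp only at h12 h23
      rcases Finset.mem_insert.1 h2 with e2 | h2'
      · rcases Finset.mem_insert.1 h1 with e1 | h1'
        · rw [e2, ← e1]; exact hr1
        · rw [if_neg (hnea _ h1'), if_pos e2] at h12; omega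
      · rw [if_neg (hnea _ h2')] at h12 h23
        rcases Finset.mem_insert.1 h3 with e3 | h3'
        · rw [if_pos e3] at h23; omega
        · rw [if_neg (hnea _ h3')] at h23
          rcases Finset.mem_insert.1 h1 with e1 | h1'
          · rw [e1] at hr1
            exact hcv b a' ha'Q a2 h2' a3 h3' (hfirst' _ h2') (by omega)
              (ha' b hr1 ⟨a3, h3', hr3⟩) hr3
          · rw [if_neg (hnea _ h1')] at h12
            exact hcv b a1 h1' a2 h2' a3 h3' (by omega) (by omega) hr1 hr3
    · intro q hq
      simp [hnea q hq]
    · intro x hx y hy hxy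
      dsimp only at hxy
      rw [Finset.mem_coe, Finset.mem_insert] at hx hy
      rcases hx with rfl | hx <;> rcases hy with rfl | hy
      · rfl
      · rw [if_pos rfl, if_neg (hnea _ hy)] at hxy; omega
      · rw [if_pos rfl, if_neg (hnea _ hx)] at hxy; omega
      · rw [if_neg (hnea _ hx), if_neg (hnea _ hy)] at hxy
        exact hinj hx hy (by omega)

theorem Sys.endpoint {V : Type*} [DecidableEq V] {r : V → V → Prop} {A : Finset V} (h : Sys r A)
    (hA : 2 ≤ A.card)
    (hconn : ∀ S ⊆ A, S.Nonempty → S ≠ A → ∃ b, (∃ u ∈ S, r u b) ∧ ∃ w ∈ A, w ∉ S ∧ r w b) :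
    ∃ x ∈ A, ConnOff r x (A.erase x) := by
  classical
  obtain ⟨x0, hx0, y0, hy0, hxy0⟩ := Finset.one_lt_card.1 hA
  let F := (A ×ˢ A.powerset).filter
    (fun p => p.2.Nonempty ∧ p.1 ∉ p.2 ∧ ConnOff r p.1 p.2)
  have hF : F.Nonempty := by
    refine ⟨(x0, {y0}), ?_⟩
    simp only [F, Finset.mem_filter, Finset.mem_product, Finset.mem_powerset,
      Finset.singleton_subset_iff, Finset.singleton_nonempty, Finset.mem_singleton]
    refine ⟨⟨hx0, hy0⟩, trivial, hxy0, ?_⟩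
    intro S hS hne hne'
    rcases Finset.subset_singleton_iff.1 hS with rfl | rfl
    · simp at hne
    · exact absurd rfl hne'
  obtain ⟨⟨x, C⟩, hxC, hmax⟩ := Finset.exists_max_image F (fun p => p.2.card) hF
  simp only [F, Finset.mem_filter, Finset.mem_product, Finset.mem_powerset] at hxC hmax
  obtain ⟨⟨hx, hCA⟩, hCne, hxC, hC⟩ := hxC
  have hmax' : ∀ y ∈ A, ∀ D ⊆ A, D.Nonempty → y ∉ D → ConnOff r y D → D.card ≤ C.card :=
    fun y hy D hD h1 h2 h3 => hmax (y, D) ⟨⟨hy, hD⟩, h1, h2, h3⟩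
  clear hmax hF
  clear F
  -- adding an attached vertex
  have hadd : ∀ y w, ConnOff r y C → w ∉ C →
      (∃ b, ¬ r y b ∧ r w b ∧ ∃ c ∈ C, r c b) → ConnOff r y (insert w C) := by
    rintro y w hyC hw ⟨b, hyb, hwb, c, hc, hcb⟩ S hS hSne hSne'
    by_cases hwS : w ∈ S
    · by_cases hall : ∃ u ∈ C, u ∈ S
      · by_cases hCS : C ⊆ S
        · exact absurd (Finset.Subset.antisymm hS (Finset.insert_subset hwS hCS)) hSne'
        · obtain ⟨u, huC, huS⟩ := hall
          obtain ⟨b', hb', ⟨u', hu', hub'⟩, w', hw', hwS', hwb'⟩ := hyC (C ∩ S)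
            Finset.inter_subset_left ⟨u, Finset.mem_inter.2 ⟨huC, huS⟩⟩
            (fun hh => hCS (by rw [← hh]; exact Finset.inter_subset_right))
          exact ⟨b', hb', ⟨u', (Finset.mem_inter.1 hu').2, hub'⟩, w', Finset.mem_insert_of_mem hw',
            fun hh => hwS' (Finset.mem_inter.2 ⟨hw', hh⟩), hwb'⟩
      · exact ⟨b, hyb, ⟨w, hwS, hwb⟩, c, Finset.mem_insert_of_mem hc,
          fun hh => hall ⟨c, hc, hh⟩, hcb⟩
    · have hSC : S ⊆ C := by
        intro z hz
        rcases Finset.mem_insert.1 (hS hz) with rfl | h1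
        · exact absurd hz hwS
        · exact h1
      by_cases hSC' : S = C
      · subst hSC'
        exact ⟨b, hyb, ⟨c, hc, hcb⟩, w, Finset.mem_insert_self _ _, hwS, hwb⟩
      · obtain ⟨b', hb', hu', w', hw', hwS', hwb'⟩ := hyC S hSC hSne hSC'
        exact ⟨b', hb', hu', w', Finset.mem_insert_of_mem hw', hwS', hwb'⟩
  have hcr : ∀ w ∈ A, w ≠ x → w ∉ C → ∀ b, ¬ r x b → r w b → ∀ c ∈ C, r c b → False := by
    intro w hw hwx hwC b hxb hwb c hc hcb
    have := hmax' x hx (insert w C) (Finset.insert_subset hw hCA) ⟨w, Finset.mem_insert_self _ _⟩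
      (by simp [hxC, Ne.symm hwx]) (hadd x w hC hwC ⟨b, hxb, hwb, c, hc, hcb⟩)
    rw [Finset.card_insert_of_notMem hwC] at this
    omega
  refine ⟨x, hx, ?_⟩
  have hCeq : C = A.erase x := by
    apply Finset.Subset.antisymm
    · intro c hc
      exact Finset.mem_erase.2 ⟨fun hh => hxC (hh ▸ hc), hCA hc⟩
    intro w hw
    by_contra hwC
    obtain ⟨hwx, hwA⟩ := Finset.mem_erase.1 hw
    have hSw : ∀ s, r x s → (∃ c ∈ C, r c s) → r w s := by
      rintro s hxs ⟨c, hc, hcs⟩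
      by_contra hws
      have hCw : ConnOff r w C := by
        intro S hS h1 h2
        obtain ⟨b, hb, ⟨u, hu, hub⟩, hh⟩ := hC S hS h1 h2
        exact ⟨b, fun hwb => hcr w hwA hwx hwC b hb hwb u (hS hu) hub, ⟨u, hu, hub⟩, hh⟩
      have := hmax' w hwA (insert x C) (Finset.insert_subset hx hCA)
        ⟨x, Finset.mem_insert_self _ _⟩ (by simp [hwC, hwx])
        (hadd w x hCw hxC ⟨s, hws, hxs, c, hc, hcs⟩)
      rw [Finset.card_insert_of_notMem hxC] at this
      omega
    obtain ⟨d, ⟨c, hc, hcd⟩, w', hw', hwC', hwd'⟩ := hconn C hCA hCne (fun hh => hxC (hh ▸ hx))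
    have hxd : r x d := by
      by_contra hno
      by_cases hwx' : w' = x
      · subst hwx'; exact hno hwd'
      · exact hcr w' hw' hwx' hwC' d hno hwd' c hc hcd
    have hcx : c ≠ x := fun hh => hxC (hh ▸ hc)
    obtain ⟨t, ht, ht'⟩ := h.anti x hx w hwA (Ne.symm hwx)
    obtain ⟨b, hb, hb'⟩ := h.anti w hwA x hx hwx
    obtain ⟨e, he, he'⟩ := h.anti c (hCA hc) x hx hcx
    exact h.TB d t b e x hx w hwA c (hCA hc) hxd (hSw d hxd ⟨c, hc, hcd⟩) hcd
      ht hb' he' ht' hb (fun hh => hcr w hwA hwx hwC e he' hh c hc he)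
      (fun hh => ht' (hSw t ht ⟨c, hc, hh⟩)) (fun hh => hcr w hwA hwx hwC b hb' hb c hc hh) he
  rw [← hCeq]
  exact hC

theorem Sys.order {V : Type*} [DecidableEq V] {r : V → V → Prop} (n : ℕ) :
    ∀ A : Finset V, A.card = n → Sys r A →
    ∃ pos : V → ℕ, Convex' r A pos := by
  classical
  induction n using Nat.strong_induction_on with
  | _ n ih =>
  intro A hn h
  rcases Nat.lt_or_ge A.card 2 with hA | hA
  · refine ⟨fun _ => 0, ?_⟩
    intro b a1 h1 a2 h2 a3 h3 _ _ hr _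
    rw [← Finset.card_le_one.1 (by omega : A.card ≤ 1) a1 h1 a2 h2]
    exact hr
  by_cases hconn : ∀ S ⊆ A, S.Nonempty → S ≠ A →
      ∃ b, (∃ u ∈ S, r u b) ∧ ∃ w ∈ A, w ∉ S ∧ r w b
  · obtain ⟨x, hx, hc⟩ := h.endpoint hA hconn
    obtain ⟨pos, hcv, -, -⟩ := h.greedy _ (A.erase x) x rfl (Finset.erase_subset _ _) hx
      (Finset.notMem_erase _ _) hc (by
        intro hne
        obtain ⟨b, ⟨u, hu, hub⟩, w, hw, hwS, hwb⟩ := hconn {x} (by simpa using hx) (by simp)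
          (fun hh => by rw [← hh] at hA; simp at hA)
        rw [Finset.mem_singleton] at hu hwS
        subst hu
        exact ⟨b, hub, w, Finset.mem_erase.2 ⟨hwS, hw⟩, hwb⟩)
    rw [Finset.insert_erase hx] at hcv
    exact ⟨pos, hcv⟩
  · push Not at hconn
    obtain ⟨S, hSA, hSne, hSne', hno⟩ := hconn
    have hss : S ⊂ A := Finset.ssubset_iff_subset_ne.2 ⟨hSA, hSne'⟩
    have hlt := Finset.card_lt_card hss
    have hcs := Finset.card_sdiff_add_card_eq_card hSA
    have hSpos := Finset.card_pos.2 hSne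
    obtain ⟨p1, hp1⟩ := ih S.card (by omega) S rfl (h.mono hSA)
    obtain ⟨p2, hp2⟩ := ih (A \ S).card (by omega) (A \ S) rfl (h.mono Finset.sdiff_subset)
    set M := S.sup p1 with hM
    refine ⟨fun v => if v ∈ S then p1 v else M + 1 + p2 v, ?_⟩
    intro b a1 h1 a2 h2 a3 h3 h12 h23 hr1 hr3
    dsimp only at h12 h23
    have hle : ∀ v ∈ S, p1 v ≤ M := fun v hv => Finset.le_sup hv
    by_cases e1 : a1 ∈ S <;> by_cases e3 : a3 ∈ S
    · rw [if_pos e3] at h23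
      rw [if_pos e1] at h12
      have := hle a3 e3
      by_cases e2 : a2 ∈ S
      · rw [if_pos e2] at h12 h23
        exact hp1 b a1 e1 a2 e2 a3 e3 h12 h23 hr1 hr3
      · rw [if_neg e2] at h23; omega
    · exact absurd hr3 (hno b ⟨a1, e1, hr1⟩ a3 h3 e3)
    · exact absurd hr1 (hno b ⟨a3, e3, hr3⟩ a1 h1 e1)
    · rw [if_neg e3] at h23
      rw [if_neg e1] at h12
      by_cases e2 : a2 ∈ S
      · rw [if_pos e2] at h12
        have := hle a2 e2
        omega
      · rw [if_neg e2] at h12 h23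
        exact hp2 b a1 (Finset.mem_sdiff.2 ⟨h1, e1⟩) a2 (Finset.mem_sdiff.2 ⟨h2, e2⟩) a3
          (Finset.mem_sdiff.2 ⟨h3, e3⟩) (by omega) (by omega) hr1 hr3


theorem hasCopy {V : Type*} {G : SimpleGraph V} {H : SimpleGraph (Fin 7)} (f : Fin 7 → V)
    (h : ∀ i j, i < j → (G.Adj (f i) (f j) ↔ H.Adj i j))
    (htw : ∀ i j, (∀ k, H.Adj i k ↔ H.Adj j k) → i = j) : HasInducedCopy G H := by
  have h' : ∀ i j, G.Adj (f i) (f j) ↔ H.Adj i j := by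
    intro i j
    rcases lt_trichotomy i j with hij | hij | hij
    · exact h i j hij
    · subst hij; simp
    · rw [G.adj_comm, H.adj_comm]; exact h j i hij
  have hinj : Function.Injective f := by
    intro i j hij
    apply htw
    intro k
    rw [← h' i k, ← h' j k, hij]
  let e : H ↪g G := ⟨⟨f, hinj⟩, fun {a b} => h' a b⟩
  exact ⟨Set.range e, ⟨(SimpleGraph.Embedding.isoInduceRange e).symm⟩⟩

/-- Decidable adjacency. -/
instance : DecidableRel tripod.Adj := fun a b =>
  decidable_of_iff' _ (SimpleGraph.fromRel_adj _ a b)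

/-- Decidable adjacency. -/
instance : DecidableRel stirrer.Adj := fun a b =>
  decidable_of_iff' _ (SimpleGraph.fromRel_adj _ a b)

/-- Decidable adjacency. -/
instance : DecidableRel armchair.Adj := fun a b =>
  decidable_of_iff' _ (SimpleGraph.fromRel_adj _ a b)

/-- Two-colouring condition. -/
def TwoCol {V : Type*} (G : SimpleGraph V) (A : Set V) : Prop :=
  ∀ u v, G.Adj u v → (u ∈ A ↔ v ∉ A)

theorem TwoCol.compl {V : Type*} {G : SimpleGraph V} {A : Set V} (h : TwoCol G A) :
    TwoCol G Aᶜ := by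
  intro u v huv
  have := h u v huv
  simp only [Set.mem_compl_iff]
  tauto

theorem TwoCol.nadj {V : Type*} {G : SimpleGraph V} {A : Set V} (h : TwoCol G A) {u v : V}
    (huv : u ∈ A ↔ v ∈ A) : ¬ G.Adj u v := by
  intro hh
  have := h u v hh
  tauto

set_option maxRecDepth 10000 in
set_option maxHeartbeats 1000000 in
theorem noTripod {V : Type*} {G : SimpleGraph V} {A : Set V} (hA : TwoCol G A) (hf : Fast G)
    {c m1 m2 m3 l1 l2 l3 : V} (c1 : G.Adj c m1) (c2 : G.Adj c m2) (c3 : G.Adj c m3)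
    (h1 : G.Adj l1 m1) (h2 : G.Adj l2 m2) (h3 : G.Adj l3 m3)
    (n12 : ¬ G.Adj l1 m2) (n13 : ¬ G.Adj l1 m3) (n21 : ¬ G.Adj l2 m1) (n23 : ¬ G.Adj l2 m3)
    (n31 : ¬ G.Adj l3 m1) (n32 : ¬ G.Adj l3 m2) : False := by
  apply hf.2.2
  have k1 := hA _ _ c1
  have k2 := hA _ _ c2
  have k3 := hA _ _ c3
  have k4 := hA _ _ h1
  have k5 := hA _ _ h2
  have k6 := hA _ _ h3
  have a1 : ¬ G.Adj c l1 := hA.nadj (by grind only)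
  have a2 : ¬ G.Adj c l2 := hA.nadj (by grind only)
  have a3 : ¬ G.Adj c l3 := hA.nadj (by grind only)
  have a4 : ¬ G.Adj m1 m2 := hA.nadj (by grind only)
  have a5 : ¬ G.Adj m1 m3 := hA.nadj (by grind only)
  have a6 : ¬ G.Adj m2 m3 := hA.nadj (by grind only)
  have a7 : ¬ G.Adj l1 l2 := hA.nadj (by grind only)
  have a8 : ¬ G.Adj l1 l3 := hA.nadj (by grind only)
  have a9 : ¬ G.Adj l2 l3 := hA.nadj (by grind only)
  rw [G.adj_comm] at h1 h2 h3 n21 n31 n32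
  clear k1 k2 k3 k4 k5 k6 hA hf
  refine hasCopy ![c, m1, l1, m2, l2, m3, l3] ?_ ?_
  · intro i j hij
    fin_cases i <;> fin_cases j <;> first | (exact absurd hij (by decide)) | 
      (exact iff_of_true (by assumption) (by decide)) |
      (exact iff_of_false (by assumption) (by decide))
  · decide

set_option maxRecDepth 10000 in
set_option maxHeartbeats 1000000 in
theorem noStirrer {V : Type*} {G : SimpleGraph V} {A : Set V} (hA : TwoCol G A) (hf : Fast G)
    {x0 x1 x2 x3 x4 x5 x6 : V} (e01 : G.Adj x0 x1) (e12 : G.Adj x1 x2) (e23 : G.Adj x2 x3)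
    (e03 : G.Adj x0 x3) (e14 : G.Adj x1 x4) (e45 : G.Adj x4 x5) (e05 : G.Adj x0 x5)
    (e06 : G.Adj x0 x6) (n25 : ¬ G.Adj x2 x5) (n26 : ¬ G.Adj x2 x6) (n34 : ¬ G.Adj x3 x4)
    (n46 : ¬ G.Adj x4 x6) : False := by
  apply hf.2.1
  have k1 := hA _ _ e01
  have k2 := hA _ _ e12
  have k3 := hA _ _ e03
  have k4 := hA _ _ e14
  have k5 := hA _ _ e05
  have k6 := hA _ _ e06
  have a1 : ¬ G.Adj x0 x2 := hA.nadj (by grind only)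
  have a2 : ¬ G.Adj x0 x4 := hA.nadj (by grind only)
  have a3 : ¬ G.Adj x2 x4 := hA.nadj (by grind only)
  have a4 : ¬ G.Adj x1 x3 := hA.nadj (by grind only)
  have a5 : ¬ G.Adj x1 x5 := hA.nadj (by grind only)
  have a6 : ¬ G.Adj x1 x6 := hA.nadj (by grind only)
  have a7 : ¬ G.Adj x3 x5 := hA.nadj (by grind only)
  have a8 : ¬ G.Adj x3 x6 := hA.nadj (by grind only)
  have a9 : ¬ G.Adj x5 x6 := hA.nadj (by grind only)
  clear k1 k2 k3 k4 k5 k6 hA hf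
  refine hasCopy ![x0, x1, x2, x3, x4, x5, x6] ?_ ?_
  · intro i j hij
    fin_cases i <;> fin_cases j <;> first | (exact absurd hij (by decide)) | 
      (exact iff_of_true (by assumption) (by decide)) |
      (exact iff_of_false (by assumption) (by decide))
  · decide

set_option maxRecDepth 10000 in
set_option maxHeartbeats 1000000 in
theorem noArmchair {V : Type*} {G : SimpleGraph V} {A : Set V} (hA : TwoCol G A) (hf : Fast G)
    {x0 x1 x2 x3 x4 x5 x6 : V} (e01 : G.Adj x0 x1) (e12 : G.Adj x1 x2) (e23 : G.Adj x2 x3)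
    (e03 : G.Adj x0 x3) (e04 : G.Adj x0 x4) (e15 : G.Adj x1 x5) (e26 : G.Adj x2 x6)
    (n06 : ¬ G.Adj x0 x6) (n24 : ¬ G.Adj x2 x4) (n35 : ¬ G.Adj x3 x5) (n45 : ¬ G.Adj x4 x5)
    (n56 : ¬ G.Adj x5 x6) : False := by
  apply hf.1
  have k1 := hA _ _ e01
  have k2 := hA _ _ e12
  have k3 := hA _ _ e03
  have k4 := hA _ _ e04
  have k5 := hA _ _ e15
  have k6 := hA _ _ e26
  have a1 : ¬ G.Adj x0 x2 := hA.nadj (by grind only)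
  have a2 : ¬ G.Adj x0 x5 := hA.nadj (by grind only)
  have a3 : ¬ G.Adj x2 x5 := hA.nadj (by grind only)
  have a4 : ¬ G.Adj x1 x3 := hA.nadj (by grind only)
  have a5 : ¬ G.Adj x1 x4 := hA.nadj (by grind only)
  have a6 : ¬ G.Adj x1 x6 := hA.nadj (by grind only)
  have a7 : ¬ G.Adj x3 x4 := hA.nadj (by grind only)
  have a8 : ¬ G.Adj x3 x6 := hA.nadj (by grind only)
  have a9 : ¬ G.Adj x4 x6 := hA.nadj (by grind only)
  clear k1 k2 k3 k4 k5 k6 hA hf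
  refine hasCopy ![x0, x1, x2, x3, x4, x5, x6] ?_ ?_
  · intro i j hij
    fin_cases i <;> fin_cases j <;> first | (exact absurd hij (by decide)) | 
      (exact iff_of_true (by assumption) (by decide)) |
      (exact iff_of_false (by assumption) (by decide))
  · decide

/-- Local description of (a disjoint union of) long induced cycles. -/
structure IsHole {V : Type*} (G : SimpleGraph V) (X : Set V) : Prop where
  two : ∀ c ∈ X, ∃ p ∈ X, ∃ q ∈ X, p ≠ q ∧ G.Adj c p ∧ G.Adj c q ∧
    ∀ z ∈ X, G.Adj c z → z = p ∨ z = q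
  noC4 : ∀ c ∈ X, ∀ c' ∈ X, ∀ p ∈ X, ∀ q ∈ X, c ≠ c' → p ≠ q → G.Adj c p → G.Adj c q →
    G.Adj c' p → G.Adj c' q → False

theorem IsHole.other {V : Type*} {G : SimpleGraph V} {X : Set V} (h : IsHole G X) {c p : V}
    (hc : c ∈ X) : ∃ q ∈ X, q ≠ p ∧ G.Adj c q := by
  obtain ⟨x, hx, y, hy, hxy, h1, h2, -⟩ := h.two c hc
  by_cases hp : x = p
  · subst hp; exact ⟨y, hy, hxy.symm, h2⟩
  · exact ⟨x, hx, hp, h1⟩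

theorem IsHole.closed {V : Type*} {G : SimpleGraph V} {A : Set V} (hA : TwoCol G A) (hf : Fast G)
    {X : Set V} (h : IsHole G X) {u w : V} (hu : u ∈ X ∨ ∃ c ∈ X, G.Adj u c) (huw : G.Adj u w) :
    w ∈ X ∨ ∃ c ∈ X, G.Adj w c := by
  by_contra hcon
  push Not at hcon
  obtain ⟨hwX, hw⟩ := hcon
  rcases hu with hu | ⟨c, hc, huc⟩
  · exact hw u hu huw.symm
  -- the armchair situation
  have key : ∀ c ∈ X, ∀ p ∈ X, ∀ q ∈ X, ∀ p2 ∈ X, p ≠ q → p2 ≠ c → G.Adj u c → G.Adj c p →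
      G.Adj c q → G.Adj p p2 → G.Adj u p2 → False := by
    intro c hc p hp q hq p2 hp2 hpq hp2c huc hcp hcq hpp2 hup2
    obtain ⟨z, hz, hzp, hp2z⟩ := h.other (p := p) hp2
    refine noArmchair hA hf (x0 := c) (x1 := u) (x2 := p2) (x3 := p) (x4 := q) (x5 := w) (x6 := z)
      huc.symm hup2 hpp2.symm hcp hcq huw hp2z ?_ ?_ ?_ ?_ ?_
    · intro hh
      exact h.noC4 c hc p2 hp2 p hp z hz hp2c.symm hzp.symm hcp hh hpp2.symm hp2z
    · intro hh
      exact h.noC4 c hc p2 hp2 p hp q hq hp2c.symm hpq hcp hcq hpp2.symm hh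
    · exact fun hh => hw p hp hh.symm
    · exact fun hh => hw q hq hh.symm
    · exact hw z hz
  obtain ⟨p, hp, q, hq, hpq, hcp, hcq, -⟩ := h.two c hc
  obtain ⟨p2, hp2, hp2c, hpp2⟩ := h.other (p := c) hp
  obtain ⟨q2, hq2, hq2c, hqq2⟩ := h.other (p := c) hq
  by_cases h1 : G.Adj u p2
  · exact key c hc p hp q hq p2 hp2 hpq hp2c huc hcp hcq hpp2 h1
  by_cases h2 : G.Adj u q2
  · exact key c hc q hq p hp q2 hq2 hpq.symm hq2c huc hcq hcp hqq2 h2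
  refine noTripod hA hf (c := c) (m1 := u) (m2 := p) (m3 := q) (l1 := w) (l2 := p2) (l3 := q2)
    huc.symm hcp hcq huw.symm hpp2.symm hqq2.symm (hw p hp) (hw q hq) (fun hh => h1 hh.symm)
    ?_ (fun hh => h2 hh.symm) ?_
  · intro hh
    exact h.noC4 c hc p2 hp2 p hp q hq hp2c.symm hpq hcp hcq hpp2.symm hh
  · intro hh
    exact h.noC4 c hc q2 hq2 p hp q hq hq2c.symm hpq hcp hcq hh hqq2.symm

theorem IsHole.reach {V : Type*} {G : SimpleGraph V} {A : Set V} (hA : TwoCol G A) (hf : Fast G)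
    {X : Set V} (h : IsHole G X) {x v : V} (hx : x ∈ X) (hr : G.Reachable x v) :
    v ∈ X ∨ ∃ c ∈ X, G.Adj v c := by
  obtain ⟨w⟩ := hr
  have : ∀ (a b : V) (_ : G.Walk a b), (a ∈ X ∨ ∃ c ∈ X, G.Adj a c) →
      (b ∈ X ∨ ∃ c ∈ X, G.Adj b c) := by
    intro a b w
    induction w with
    | nil => exact id
    | cons hab _ ih => exact fun ha => ih (h.closed hA hf ha hab)
  exact this x v w (Or.inl hx)

theorem isHole_of_cycle {V : Type*} {G : SimpleGraph V} {A : Set V} (hA : TwoCol G A)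
    {m : ℕ} (hm : 2 ≤ m) (u b : ℕ → V) (hu : ∀ i ≤ m, u i ∈ A) (hb : ∀ i ≤ m, b i ∉ A)
    (hadj : ∀ i ≤ m, ∀ j ≤ m, G.Adj (u i) (b j) ↔ (i = j ∨ i = j + 1 ∨ (i = 0 ∧ j = m))) :
    IsHole G {z | (∃ i ≤ m, z = u i) ∨ ∃ j ≤ m, z = b j} := by
  have hui : ∀ i ≤ m, ∀ i' ≤ m, u i = u i' → i = i' := by
    intro i hi i' hi' he
    have key : ∀ j ≤ m, (i = j ∨ i = j + 1 ∨ (i = 0 ∧ j = m)) ↔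
        (i' = j ∨ i' = j + 1 ∨ (i' = 0 ∧ j = m)) := fun j hj => by
      rw [← hadj i hi j hj, ← hadj i' hi' j hj, he]
    have k1 := key i hi
    have k2 := key i' hi'
    have k3 := key (i - 1) (by omega)
    have k4 := key (i' - 1) (by omega)
    have k5 := key m le_rfl
    omega
  have hbi : ∀ i ≤ m, ∀ i' ≤ m, b i = b i' → i = i' := by
    intro i hi i' hi' he
    have key : ∀ j ≤ m, (j = i ∨ j = i + 1 ∨ (j = 0 ∧ i = m)) ↔
        (j = i' ∨ j = i' + 1 ∨ (j = 0 ∧ i' = m)) := fun j hj => by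
      rw [← hadj j hj i hi, ← hadj j hj i' hi', he]
    have k1 := key i hi
    have k2 := key i' hi'
    have k5 := key 0 (by omega)
    by_cases h1 : i + 1 ≤ m
    · have k3 := key (i + 1) h1
      by_cases h2 : i' + 1 ≤ m
      · have k4 := key (i' + 1) h2
        omega
      · omega
    · by_cases h2 : i' + 1 ≤ m
      · have k4 := key (i' + 1) h2
        omega
      · omega
  have nuu : ∀ i ≤ m, ∀ j ≤ m, ¬ G.Adj (u i) (u j) := fun i hi j hj =>
    hA.nadj (by simp [hu i hi, hu j hj])
  have nbb : ∀ i ≤ m, ∀ j ≤ m, ¬ G.Adj (b i) (b j) := fun i hi j hj =>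
    hA.nadj (by simp [hb i hi, hb j hj])
  have c4 : ∀ i ≤ m, ∀ i' ≤ m, ∀ j ≤ m, ∀ j' ≤ m, u i ≠ u i' → b j ≠ b j' → G.Adj (u i) (b j) →
      G.Adj (u i) (b j') → G.Adj (u i') (b j) → G.Adj (u i') (b j') → False := by
    intro i hi i' hi' j hj j' hj' hne hne' h1 h2 h3 h4
    rw [hadj _ hi _ hj] at h1
    rw [hadj _ hi _ hj'] at h2
    rw [hadj _ hi' _ hj] at h3
    rw [hadj _ hi' _ hj'] at h4
    have : i ≠ i' := fun hh => hne (by rw [hh])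
    have : j ≠ j' := fun hh => hne' (by rw [hh])
    omega
  constructor
  · rintro c (⟨i, hi, rfl⟩ | ⟨j, hj, rfl⟩)
    · have hi' : (if i = 0 then m else i - 1) ≤ m := by split_ifs <;> omega
      refine ⟨b i, Or.inr ⟨i, hi, rfl⟩, b (if i = 0 then m else i - 1), Or.inr ⟨_, hi', rfl⟩,
        ?_, ?_, ?_, ?_⟩
      · intro hh
        have := hbi _ hi _ hi' hh
        split_ifs at this <;> omega
      · rw [hadj i hi i hi]; omega
      · rw [hadj i hi _ hi']; split_ifs <;> omega
      · rintro z (⟨i', hi'', rfl⟩ | ⟨j, hj, rfl⟩) hz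
        · exact absurd hz (nuu i hi i' hi'')
        · rw [hadj i hi j hj] at hz
          have : j = i ∨ j = (if i = 0 then m else i - 1) := by split_ifs <;> omega
          rcases this with h | h
          · left; rw [h]
          · right; rw [← h]
    · have hj' : (if j = m then 0 else j + 1) ≤ m := by split_ifs <;> omega
      refine ⟨u j, Or.inl ⟨j, hj, rfl⟩, u (if j = m then 0 else j + 1), Or.inl ⟨_, hj', rfl⟩,
        ?_, ?_, ?_, ?_⟩
      · intro hh
        have := hui _ hj _ hj' hh
        split_ifs at this <;> omega
      · rw [G.adj_comm, hadj j hj j hj]; omega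
      · rw [G.adj_comm, hadj _ hj' j hj]; split_ifs <;> omega
      · rintro z (⟨i, hi, rfl⟩ | ⟨j', hj'', rfl⟩) hz
        · rw [G.adj_comm, hadj i hi j hj] at hz
          have : i = j ∨ i = (if j = m then 0 else j + 1) := by split_ifs <;> omega
          rcases this with h | h
          · left; rw [h]
          · right; rw [← h]
        · exact absurd hz (nbb j hj j' hj'')
  · rintro c (⟨i, hi, rfl⟩ | ⟨i, hi, rfl⟩) c' (⟨i', hi', rfl⟩ | ⟨i', hi', rfl⟩)
      p (⟨j, hj, rfl⟩ | ⟨j, hj, rfl⟩) q (⟨j', hj', rfl⟩ | ⟨j', hj', rfl⟩) hne hne' h1 h2 h3 h4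
    all_goals first
      | exact nuu _ hi _ hj h1
      | exact nuu _ hi _ hj' h2
      | exact nuu _ hi' _ hj h3
      | exact nuu _ hi' _ hj' h4
      | exact nbb _ hi _ hj h1
      | exact nbb _ hi _ hj' h2
      | exact nbb _ hi' _ hj h3
      | exact nbb _ hi' _ hj' h4
      | exact c4 i hi i' hi' j hj j' hj' hne hne' h1 h2 h3 h4
      | exact c4 j hj j' hj' i hi i' hi' hne' hne h1.symm h3.symm h2.symm h4.symm

/-- The relation used for the component of `v`. -/
def cRel {V : Type*} (G : SimpleGraph V) (A : Set V) (v a b : V) : Prop :=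
  G.Adj a b ∧ b ∉ A ∧ ¬ G.Adj v b

theorem sys_of_fast {V : Type*} {G : SimpleGraph V} {A : Set V} (hA : TwoCol G A) (hf : Fast G)
    (v : V) (hv : v ∈ A) (A0 : Finset V) (hA0 : ∀ a ∈ A0, a ∈ A ∧ G.Reachable v a)
    (anti : ∀ a ∈ A0, ∀ a' ∈ A0, a ≠ a' → ∃ b, cRel G A v a b ∧ ¬ cRel G A v a' b) :
    Sys (cRel G A v) A0 where
  anti := anti
  TB := by
    intro d b1 b2 b3 a1 _ a2 _ a3 _ h1 h2 h3 p1 q12 q13 q21 p2 q23 q31 q32 p3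
    have hn : ∀ a b a', cRel G A v a b → ¬ cRel G A v a' b → ¬ G.Adj b a' := fun a b a' h1 h2 h3 =>
      h2 ⟨h3.symm, h1.2⟩
    exact noTripod hA hf h1.1.symm h2.1.symm h3.1.symm p1.1.symm p2.1.symm p3.1.symm
      (hn _ _ _ p1 q21) (hn _ _ _ p1 q31) (hn _ _ _ p2 q12) (hn _ _ _ p2 q32)
      (hn _ _ _ p3 q13) (hn _ _ _ p3 q23)
  TA := by
    intro d1 d2 d3 a _ a1 _ a2 _ a3 _ h1 h2 h3 p1 q12 q13 q21 p2 q23 q31 q32 p3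
    have hn : ∀ a b a', cRel G A v a b → ¬ cRel G A v a' b → ¬ G.Adj a' b := fun a b a' h1 h2 h3 =>
      h2 ⟨h3, h1.2⟩
    exact noTripod hA hf h1.1 h2.1 h3.1 p1.1 p2.1 p3.1
      (hn _ _ _ p2 q12) (hn _ _ _ p3 q13) (hn _ _ _ p1 q21) (hn _ _ _ p3 q23)
      (hn _ _ _ p1 q31) (hn _ _ _ p2 q32)
  ST := by
    intro s s' b1 b2 a _ u0 _ u1 _ as as' nab1 nab2 u0s nu0s' u0b1 nu0b2 u1s u1s' u1b1 u1b2
    have hn : ∀ a b a', cRel G A v a b → ¬ cRel G A v a' b → ¬ G.Adj a' b := fun a b a' h1 h2 h3 =>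
      h2 ⟨h3, h1.2⟩
    exact noStirrer hA hf (x0 := u1) (x1 := s) (x2 := a) (x3 := s') (x4 := u0) (x5 := b1) (x6 := b2)
      u1s.1 as.1.symm as'.1 u1s'.1 u0s.1.symm u0b1.1 u1b1.1 u1b2.1
      (hn _ _ _ u0b1 nab1) (hn _ _ _ u1b2 nab2) (fun hh => hn _ _ _ as' nu0s' hh.symm)
      (hn _ _ _ u1b2 nu0b2)
  CY := by
    intro m u b s hm hu hub hus
    let b' : ℕ → V := fun j => if j < m then b j else s
    have hr : ∀ i ≤ m, ∀ j ≤ m,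
        cRel G A v (u i) (b' j) ↔ (i = j ∨ i = j + 1 ∨ (i = 0 ∧ j = m)) := by
      intro i hi j hj
      by_cases hjm : j < m
      · simp only [b', if_pos hjm]
        rw [hub i hi j hjm]
        omega
      · simp only [b', if_neg hjm]
        rw [hus i hi]
        omega
    have hb' : ∀ j ≤ m, b' j ∉ A ∧ ¬ G.Adj v (b' j) := by
      intro j hj
      exact ((hr j hj j hj).2 (Or.inl rfl)).2
    have hX := isHole_of_cycle hA hm u b' (fun i hi => (hA0 _ (hu i hi)).1) (fun j hj => (hb' j hj).1)
      (fun i hi j hj => by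
        rw [← hr i hi j hj]
        exact ⟨fun h => ⟨h, hb' j hj⟩, fun h => h.1⟩)
    rcases hX.reach hA hf (Or.inl ⟨0, by omega, rfl⟩) (hA0 _ (hu 0 (by omega))).2.symm with h | h
    · rcases h with ⟨i, hi, rfl⟩ | ⟨j, hj, rfl⟩
      · exact (hb' i hi).2 ((hr i hi i hi).2 (Or.inl rfl)).1
      · exact (hb' j hj).1 hv
    · obtain ⟨c, ⟨i, hi, rfl⟩ | ⟨j, hj, rfl⟩, hvc⟩ := h
      · exact hA.nadj (by simp [hv, (hA0 _ (hu i hi)).1]) hvc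
      · exact (hb' j hj).2 hvc


/-- `G` restricted to `K` has a path decomposition with bags of size at most `k`. -/
def PDOn {V : Type*} (G : SimpleGraph V) (K : Set V) (k : ℕ) : Prop :=
  ∃ M : ℕ, ∃ bags : ℕ → Finset V, (∀ t, ∀ x ∈ bags t, x ∈ K) ∧
    (∀ x ∈ K, ∃ t, t < M ∧ x ∈ bags t) ∧
    (∀ x ∈ K, ∀ y ∈ K, G.Adj x y → ∃ t, t < M ∧ x ∈ bags t ∧ y ∈ bags t) ∧
    (∀ x t1 t2 t3, t1 ≤ t2 → t2 ≤ t3 → t3 < M → x ∈ bags t1 → x ∈ bags t3 → x ∈ bags t2) ∧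
    ∀ t, t < M → (bags t).card ≤ k

theorem PDOn.union {V : Type*} {G : SimpleGraph V} {K L : Set V} {k : ℕ}
    (hd : ∀ x ∈ K, x ∉ L) (he : ∀ x ∈ K, ∀ y ∈ L, ¬ G.Adj x y)
    (hK : PDOn G K k) (hL : PDOn G L k) : PDOn G (K ∪ L) k := by
  obtain ⟨M, B, b1, b2, b3, b4, b5⟩ := hK
  obtain ⟨N, C, c1, c2, c3, c4, c5⟩ := hL
  have eB : ∀ t, t < M → (if t < M then B t else C (t - M)) = B t := fun t ht => if_pos ht
  have eC : ∀ t, (if t + M < M then B (t + M) else C (t + M - M)) = C t := fun t => by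
    rw [if_neg (by omega), Nat.add_sub_cancel]
  refine ⟨M + N, fun t => if t < M then B t else C (t - M), ?_, ?_, ?_, ?_, ?_⟩
  · intro t x hx
    dsimp only at hx
    split_ifs at hx
    · exact Or.inl (b1 _ _ hx)
    · exact Or.inr (c1 _ _ hx)
  · rintro x (hx | hx)
    · obtain ⟨t, ht, h⟩ := b2 x hx
      exact ⟨t, by omega, by dsimp only; rwa [eB t ht]⟩
    · obtain ⟨t, ht, h⟩ := c2 x hx
      exact ⟨t + M, by omega, by dsimp only; rwa [eC t]⟩
  · rintro x (hx | hx) y (hy | hy) hxy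
    · obtain ⟨t, ht, h⟩ := b3 x hx y hy hxy
      exact ⟨t, by omega, by dsimp only; rwa [eB t ht]⟩
    · exact absurd hxy (he x hx y hy)
    · exact absurd hxy.symm (he y hy x hx)
    · obtain ⟨t, ht, h⟩ := c3 x hx y hy hxy
      exact ⟨t + M, by omega, by dsimp only; rwa [eC t]⟩
  · intro x t1 t2 t3 h12 h23 h3 hx1 hx3
    dsimp only at hx1 hx3 ⊢
    by_cases q1 : t1 < M <;> by_cases q3 : t3 < M
    · rw [if_pos q1] at hx1
      rw [if_pos q3] at hx3
      rw [if_pos (by omega)]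
      exact b4 x t1 t2 t3 h12 h23 q3 hx1 hx3
    · rw [if_pos q1] at hx1
      rw [if_neg q3] at hx3
      exact absurd (c1 _ _ hx3) (hd _ (b1 _ _ hx1))
    · omega
    · rw [if_neg q1] at hx1
      rw [if_neg q3] at hx3
      rw [if_neg (by omega)]
      exact c4 x (t1 - M) (t2 - M) (t3 - M) (by omega) (by omega) (by omega) hx1 hx3
  · intro t ht
    dsimp only
    split_ifs with h
    · exact b5 t h
    · exact c5 _ (by omega)

theorem exists_dom {V : Type*} [DecidableEq V] (r : V → V → Prop) (n : ℕ) :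
    ∀ S : Finset V, S.card = n → ∃ A0 ⊆ S, (∀ a ∈ S, ∃ a0 ∈ A0, ∀ b, r a b → r a0 b) ∧
      ∀ a ∈ A0, ∀ a' ∈ A0, a ≠ a' → ∃ b, r a b ∧ ¬ r a' b := by
  induction n using Nat.strong_induction_on with
  | _ n ih =>
    intro S hS
    by_cases h : ∀ a ∈ S, ∀ a' ∈ S, a ≠ a' → ∃ b, r a b ∧ ¬ r a' b
    · exact ⟨S, Finset.Subset.refl _, fun a ha => ⟨a, ha, fun _ h => h⟩, h⟩
    · push Not at h
      obtain ⟨a, ha, a', ha', hne, hr⟩ := h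
      have hc : (S.erase a).card < n := by rw [← hS]; exact Finset.card_erase_lt_of_mem ha
      obtain ⟨A0, h0, h1, h2⟩ := ih _ hc (S.erase a) rfl
      refine ⟨A0, h0.trans (Finset.erase_subset _ _), ?_, h2⟩
      intro x hx
      by_cases hxa : x = a
      · subst hxa
        obtain ⟨a0, k1, k2⟩ := h1 a' (Finset.mem_erase.2 ⟨hne.symm, ha'⟩)
        exact ⟨a0, k1, fun b hb => k2 b (hr b hb)⟩
      · exact h1 x (Finset.mem_erase.2 ⟨hxa, hx⟩)

theorem exists_adj_of_reachable {V : Type*} {G : SimpleGraph V} {v x : V}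
    (h : G.Reachable v x) (hne : v ≠ x) : ∃ a, G.Adj a x := by
  obtain ⟨p⟩ := h.symm
  cases p with
  | nil => exact absurd rfl hne
  | cons h _ => exact ⟨_, h.symm⟩

open Classical in
theorem PDOn.comp {V : Type*} [Fintype V] {G : SimpleGraph V} [DecidableRel G.Adj] {A : Set V}
    (hA : TwoCol G A) (hf : Fast G) (v : V) (hv : v ∈ A) :
    PDOn G {w | G.Reachable v w} (2 * G.maxDegree + 1) := by
  set S : Finset V := Finset.univ.filter (fun x => x ∈ A ∧ G.Reachable v x) with hS
  obtain ⟨A0, hsub, hdom, anti⟩ := exists_dom (cRel G A v) _ S rfl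
  have hA0 : ∀ a ∈ A0, a ∈ A ∧ G.Reachable v a := fun a ha => by
    have := hsub ha
    simpa [hS] using this
  obtain ⟨pos, hpos⟩ := Sys.order _ A0 rfl (sys_of_fast hA hf v hv A0 hA0 anti)
  have hdom' : ∀ a, ∃ a0, a ∈ S → a0 ∈ A0 ∧ ∀ b, cRel G A v a b → cRel G A v a0 b := by
    intro a
    by_cases ha : a ∈ S
    · obtain ⟨a0, h1, h2⟩ := hdom a ha
      exact ⟨a0, fun _ => ⟨h1, h2⟩⟩
    · exact ⟨a, fun h => absurd h ha⟩
  choose dom hdm using hdom'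
  set N := Fintype.card V with hN
  set idx : V → ℕ := fun a => (Fintype.equivFin V a).val with hidx
  have idxlt : ∀ a, idx a < N := fun a => (Fintype.equivFin V a).isLt
  have idxinj : ∀ a b, idx a = idx b → a = b := fun a b h =>
    (Fintype.equivFin V).injective (Fin.ext h)
  have hN0 : 0 < N := lt_of_le_of_lt (Nat.zero_le _) (idxlt v)
  set p : V → ℕ := fun a => pos (dom a) * N + idx a with hp
  have pdiv : ∀ a, p a / N = pos (dom a) := fun a => by
    simp only [hp]
    rw [mul_comm, Nat.mul_add_div hN0, Nat.div_eq_of_lt (idxlt a), add_zero]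
  have pmod : ∀ a, p a % N = idx a := fun a => by
    simp only [hp]
    rw [mul_comm, Nat.mul_add_mod, Nat.mod_eq_of_lt (idxlt a)]
  have pinj : ∀ a b, p a = p b → a = b := fun a b h =>
    idxinj a b (by rw [← pmod, ← pmod, h])
  have plt : ∀ a, p a < Finset.univ.sup p + 1 := fun a =>
    Nat.lt_succ_of_le (Finset.le_sup (f := p) (Finset.mem_univ a))
  have memS : ∀ a, a ∈ S ↔ a ∈ A ∧ G.Reachable v a := fun a => by simp [hS]
  let P1 : ℕ → V → Prop := fun t x => x ∈ A ∧ G.Reachable v x ∧ p x = t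
  let P2 : ℕ → V → Prop := fun t x => x ∉ A ∧ ¬ G.Adj v x ∧ G.Reachable v x ∧
    ∃ a1 a3, G.Adj a1 x ∧ G.Adj a3 x ∧ p a1 ≤ t ∧ t ≤ p a3
  have key : ∀ x a, x ∉ A → G.Reachable v x → G.Adj a x →
      P2 (p a) x ∨ G.Adj v x := by
    intro x a hx hr ha
    by_cases h : G.Adj v x
    · exact Or.inr h
    · exact Or.inl ⟨hx, h, hr, a, a, ha, ha, le_rfl, le_rfl⟩
  refine ⟨Finset.univ.sup p + 1, fun t => Finset.univ.filter (P1 t) ∪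
    (Finset.univ.filter (P2 t) ∪ G.neighborFinset v), ?_, ?_, ?_, ?_, ?_⟩
  · intro t x hx
    simp only [Finset.mem_union, Finset.mem_filter, Finset.mem_univ, true_and,
      SimpleGraph.mem_neighborFinset] at hx
    rcases hx with hx | hx | hx
    · exact hx.2.1
    · exact hx.2.2.1
    · exact hx.reachable
  · intro x hx
    have hx : G.Reachable v x := hx
    simp only [Finset.mem_union, Finset.mem_filter, Finset.mem_univ, true_and,
      SimpleGraph.mem_neighborFinset]
    by_cases hxA : x ∈ A
    · exact ⟨p x, plt x, Or.inl ⟨hxA, hx, rfl⟩⟩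
    · obtain ⟨a, ha⟩ := exists_adj_of_reachable hx (by rintro rfl; exact hxA hv)
      exact ⟨p a, plt a, Or.inr (key x a hxA hx ha)⟩
  · have main : ∀ x y, x ∈ A → G.Reachable v x → G.Adj x y → ∃ t, t < Finset.univ.sup p + 1 ∧
        (P1 t x ∧ (P2 t y ∨ G.Adj v y)) := by
      intro x y hxA hx hxy
      refine ⟨p x, plt x, ⟨hxA, hx, rfl⟩, key y x ?_ (hx.trans hxy.reachable) hxy⟩
      exact (hA x y hxy).1 hxA
    intro x hx y hy hxy
    have hx : G.Reachable v x := hx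
    have hy : G.Reachable v y := hy
    simp only [Finset.mem_union, Finset.mem_filter, Finset.mem_univ, true_and,
      SimpleGraph.mem_neighborFinset]
    by_cases hxA : x ∈ A
    · obtain ⟨t, h1, h2, h3⟩ := main x y hxA hx hxy
      exact ⟨t, h1, Or.inl h2, Or.inr h3⟩
    · have hyA : y ∈ A := by
        have := hA x y hxy
        tauto
      obtain ⟨t, h1, h2, h3⟩ := main y x hyA hy hxy.symm
      exact ⟨t, h1, Or.inr h3, Or.inl h2⟩
  · intro x t1 t2 t3 h12 h23 _ hx1 hx3
    simp only [Finset.mem_union, Finset.mem_filter, Finset.mem_univ, true_and,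
      SimpleGraph.mem_neighborFinset] at hx1 hx3 ⊢
    rcases hx1 with hx1 | hx1 | hx1
    · rcases hx3 with hx3 | hx3 | hx3
      · have e1 := hx1.2.2
        have e3 := hx3.2.2
        exact Or.inl ⟨hx1.1, hx1.2.1, by omega⟩
      · exact absurd hx1.1 hx3.1
      · exact Or.inr (Or.inr hx3)
    · rcases hx3 with hx3 | hx3 | hx3
      · exact absurd hx3.1 hx1.1
      · obtain ⟨k1, k2, k3, a1, -, k4, -, k5, -⟩ := hx1
        obtain ⟨-, -, -, -, a3, -, k6, -, k7⟩ := hx3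
        exact Or.inr (Or.inl ⟨k1, k2, k3, a1, a3, k4, k6, k5.trans h12, h23.trans k7⟩)
      · exact Or.inr (Or.inr hx3)
    · exact Or.inr (Or.inr hx1)
  · intro t _
    have c1 : (Finset.univ.filter (P1 t)).card ≤ 1 := by
      rw [Finset.card_le_one]
      intro a ha b hb
      simp only [Finset.mem_filter, Finset.mem_univ, true_and] at ha hb
      exact pinj a b (ha.2.2.trans hb.2.2.symm)
    have c3 : (G.neighborFinset v).card ≤ G.maxDegree := G.degree_le_maxDegree v
    have c2 : (Finset.univ.filter (P2 t)).card ≤ G.maxDegree := by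
      have inA : ∀ x a, P2 t x → G.Adj a x →
          dom a ∈ A0 ∧ cRel G A v (dom a) x := by
        intro x a hx ha
        have haS : a ∈ S := by
          rw [memS]
          refine ⟨?_, hx.2.2.1.trans ha.symm.reachable⟩
          exact (hA a x ha).2 hx.1
        exact ⟨(hdm a haS).1, (hdm a haS).2 x ⟨ha, hx.1, hx.2.1⟩⟩
      rcases (A0.filter (fun a => pos a ≤ t / N)).eq_empty_or_nonempty with he | hne
      · have : Finset.univ.filter (P2 t) = ∅ := by
          rw [Finset.filter_eq_empty_iff]
          intro x _ hx
          obtain ⟨a1, a3, h1, h3, l1, l3⟩ := hx.2.2.2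
          have : dom a1 ∈ A0.filter (fun a => pos a ≤ t / N) := by
            rw [Finset.mem_filter]
            refine ⟨(inA x a1 hx h1).1, ?_⟩
            rw [← pdiv]
            exact Nat.div_le_div_right l1
          rw [he] at this
          simp at this
        rw [this]; simp
      · obtain ⟨a0, ha0, hmax⟩ := Finset.exists_max_image _ pos hne
        rw [Finset.mem_filter] at ha0
        refine le_trans (Finset.card_le_card ?_) (G.degree_le_maxDegree a0)
        intro x hx
        simp only [Finset.mem_filter, Finset.mem_univ, true_and] at hx
        rw [SimpleGraph.mem_neighborFinset]
        obtain ⟨a1, a3, h1, h3, l1, l3⟩ := hx.2.2.2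
        have i1 := inA x a1 hx h1
        have i3 := inA x a3 hx h3
        have q1 : pos (dom a1) ≤ t / N := by
          rw [← pdiv]
          exact Nat.div_le_div_right l1
        have q3 : t / N ≤ pos (dom a3) := by
          rw [← pdiv]
          exact Nat.div_le_div_right l3
        have q2 := hmax (dom a1) (Finset.mem_filter.2 ⟨i1.1, q1⟩)
        exact (hpos x (dom a1) i1.1 a0 ha0.1 (dom a3) i3.1 q2 (ha0.2.trans q3) i1.2 i3.2).1
    have u1 := Finset.card_union_le (Finset.univ.filter (P1 t))
      (Finset.univ.filter (P2 t) ∪ G.neighborFinset v)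
    have u2 := Finset.card_union_le (Finset.univ.filter (P2 t)) (G.neighborFinset v)
    dsimp only
    omega

open Classical in
theorem PDOn.closed {V : Type*} [Fintype V] {G : SimpleGraph V} [DecidableRel G.Adj] {A : Set V}
    (hA : TwoCol G A) (hf : Fast G) (n : ℕ) :
    ∀ U : Finset V, U.card = n → (∀ x ∈ U, ∀ y, G.Adj x y → y ∈ U) →
      PDOn G (↑U : Set V) (2 * G.maxDegree + 1) := by
  induction n using Nat.strong_induction_on with
  | _ n ih =>
    intro U hU hcl
    rcases U.eq_empty_or_nonempty with rfl | ⟨v, hv⟩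
    · exact ⟨0, fun _ => ∅, by simp, by simp, by simp, by simp, by simp⟩
    · have hr : ∀ w, G.Reachable v w → w ∈ U := by
        rintro w ⟨p⟩
        induction p with
        | nil => exact hv
        | cons h _ ihp => exact ihp (hcl _ hv _ h)
      have hK : PDOn G {w | G.Reachable v w} (2 * G.maxDegree + 1) := by
        by_cases hvA : v ∈ A
        · exact PDOn.comp hA hf v hvA
        · exact PDOn.comp hA.compl hf v hvA
      have hlt : (U.filter (fun w => ¬ G.Reachable v w)).card < n := by
        rw [← hU]
        apply Finset.card_lt_card
        rw [Finset.filter_ssubset]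
        exact ⟨v, hv, fun h => h (SimpleGraph.Reachable.refl v)⟩
      have hL := ih _ hlt (U.filter (fun w => ¬ G.Reachable v w)) rfl (by
        intro x hx y hxy
        rw [Finset.mem_filter] at hx ⊢
        exact ⟨hcl x hx.1 y hxy, fun h => hx.2 (h.trans hxy.symm.reachable)⟩)
      have hun := PDOn.union (K := {w | G.Reachable v w}) (by
        intro x hx hx'
        rw [Finset.mem_coe, Finset.mem_filter] at hx'
        exact hx'.2 hx) (by
        intro x hx y hy hxy
        rw [Finset.mem_coe, Finset.mem_filter] at hy
        exact hy.2 (SimpleGraph.Reachable.trans hx hxy.reachable)) hK hL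
      have heq : {w | G.Reachable v w} ∪ (↑(U.filter (fun w => ¬ G.Reachable v w)) : Set V) =
          (↑U : Set V) := by
        ext x
        simp only [Set.mem_union, Set.mem_ofPred_eq, Finset.coe_filter, Finset.mem_coe]
        have := hr x
        tauto
      rw [heq] at hun
      exact hun

/-- Every bipartite fast finite simple graph `G` (on a nonempty vertex set)
satisfies `pw(G) ≤ 2·Δ(G)`. -/
theorem fast_pathwidth_le_two_maxDegree {V : Type*} [Fintype V] [Nonempty V]
    (G : SimpleGraph V) [DecidableRel G.Adj]
    (hbip : IsBipartiteGraph G) (hfast : Fast G) :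
    pathwidth G ≤ 2 * G.maxDegree := by
  obtain ⟨A, B, hAB, hdis, hiA, hiB⟩ := hbip
  have hA : TwoCol G A := by
    intro u v huv
    have cov : ∀ x, x ∉ A → x ∈ B := fun x hx => by
      have : x ∈ A ∪ B := by rw [hAB]; trivial
      exact this.resolve_left hx
    constructor
    · intro hu hv
      exact hiA hu hv huv
    · intro hv
      by_contra hu
      exact hiB (cov u hu) (cov v hv) huv
  obtain ⟨M, bags, -, b2, b3, b4, b5⟩ :=
    PDOn.closed hA hfast _ Finset.univ rfl (fun _ _ y _ => Finset.mem_univ y)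
  have hM : 0 < M := by
    obtain ⟨v⟩ := ‹Nonempty V›
    obtain ⟨t, ht, -⟩ := b2 v (by simp)
    omega
  let D : PathDecomp G :=
    { len := M
      len_pos := hM
      bags := fun i => bags i
      mem_bag := fun v => by
        obtain ⟨t, ht, h⟩ := b2 v (by simp)
        exact ⟨⟨t, ht⟩, h⟩
      edge_bag := fun u v huv => by
        obtain ⟨t, ht, h⟩ := b3 u (by simp) v (by simp) huv
        exact ⟨⟨t, ht⟩, h⟩
      interval := fun v i j k hij hjk hi hk => b4 v i j k hij hjk k.isLt hi hk }
  have hD : D.width ≤ 2 * G.maxDegree := by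
    unfold PathDecomp.width
    have : (Finset.univ.sup fun i => (D.bags i).card) ≤ 2 * G.maxDegree + 1 :=
      Finset.sup_le fun i _ => b5 i i.isLt
    omega
  exact le_trans (Nat.sInf_le ⟨D, rfl⟩) hD
end

section
/- Let d be a positive integer. Every bipartite finite simple graph that contains no induced subgraph isomorphic to the tripod, the armchair, the stirrer, or the star K_{1,d+1} has pathwidth at most 2d. -/
open SimpleGraph

/-! ### Tuple versions of the hypotheses -/

/-- The hereditary hypotheses, in a form convenient for use. -/
structure Nice {V : Type*} (G : SimpleGraph V) (d : ℕ) : Prop where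
  bip : ∃ χ : V → Bool, ∀ u v, G.Adj u v → χ u ≠ χ v
  deg : ∀ (v : V) (T : Finset V), (∀ x ∈ T, G.Adj v x) → T.card ≤ d
  tri : ∀ o x1 x2 x3 y1 y2 y3 : V, G.Adj o x1 → G.Adj o x2 → G.Adj o x3 →
    G.Adj x1 y1 → G.Adj x2 y2 → G.Adj x3 y3 →
    ¬ G.Adj x1 y2 → ¬ G.Adj x1 y3 → ¬ G.Adj x2 y1 → ¬ G.Adj x2 y3 →
    ¬ G.Adj x3 y1 → ¬ G.Adj x3 y2 → False
  arm : ∀ c0 c1 c2 c3 p0 p1 p2 : V, G.Adj c0 c1 → G.Adj c1 c2 → G.Adj c2 c3 → G.Adj c3 c0 →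
    G.Adj c0 p0 → G.Adj c1 p1 → G.Adj c2 p2 →
    ¬ G.Adj c0 p2 → ¬ G.Adj c2 p0 → ¬ G.Adj p1 c3 → ¬ G.Adj p1 p0 → ¬ G.Adj p1 p2 → False
  stir : ∀ a0 a1 a2 a3 a4 a5 a6 : V, G.Adj a0 a1 → G.Adj a1 a2 → G.Adj a2 a3 → G.Adj a3 a0 →
    G.Adj a1 a4 → G.Adj a4 a5 → G.Adj a5 a0 → G.Adj a0 a6 →
    ¬ G.Adj a2 a5 → ¬ G.Adj a2 a6 → ¬ G.Adj a4 a3 → ¬ G.Adj a4 a6 → False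

lemma hasInducedCopy_of_inj {V W : Type*} {G : SimpleGraph V} {H : SimpleGraph W} (f : W → V)
    (hf : Function.Injective f) (h : ∀ i j, G.Adj (f i) (f j) ↔ H.Adj i j) :
    HasInducedCopy G H := by
  refine ⟨Set.range f, ⟨RelIso.symm ⟨Equiv.ofInjective f hf, ?_⟩⟩⟩
  intro a b
  simpa using h a b

lemma inj_of_adj {V W : Type*} {G : SimpleGraph V} {H : SimpleGraph W} (f : W → V)
    (hH : ∀ i j, (∀ k, H.Adj i k ↔ H.Adj j k) → i = j)
    (h : ∀ i j, G.Adj (f i) (f j) ↔ H.Adj i j) : Function.Injective f := by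
  intro i j hij
  apply hH
  intro k
  rw [← h, ← h, hij]

instance inst_s16 : DecidableRel tripod.Adj := fun a b => by unfold tripod; infer_instance
instance inst_s16_2 : DecidableRel armchair.Adj := fun a b => by unfold armchair; infer_instance
instance inst_s16_3 : DecidableRel stirrer.Adj := fun a b => by unfold stirrer; infer_instance

lemma tuple_copy {V : Type*} {G : SimpleGraph V} {H : SimpleGraph (Fin 7)} (f : Fin 7 → V)
    (hH : ∀ i j, (∀ k, H.Adj i k ↔ H.Adj j k) → i = j)
    (h : ∀ i j, i < j → (G.Adj (f i) (f j) ↔ H.Adj i j)) : HasInducedCopy G H := by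
  have h' : ∀ i j, G.Adj (f i) (f j) ↔ H.Adj i j := by
    intro i j
    rcases lt_trichotomy i j with hij | hij | hij
    · exact h i j hij
    · subst hij; simp
    · rw [G.adj_comm, H.adj_comm]; exact h j i hij
  exact hasInducedCopy_of_inj f (inj_of_adj f hH h') h'

lemma same_color {V : Type*} {G : SimpleGraph V} {χ : V → Bool}
    (hχ : ∀ u v, G.Adj u v → χ u ≠ χ v) {o x y : V} (h1 : G.Adj o x) (h2 : G.Adj o y) :
    ¬ G.Adj x y := by
  intro h
  have := hχ _ _ h1; have := hχ _ _ h2; have := hχ _ _ h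
  revert this; cases hx : χ x <;> cases hy : χ y <;> cases ho : χ o <;> simp_all

lemma color_eq {V : Type*} {G : SimpleGraph V} {χ : V → Bool}
    (hχ : ∀ u v, G.Adj u v → χ u ≠ χ v) {x y : V} (h : χ x = χ y) : ¬ G.Adj x y :=
  fun h' => hχ _ _ h' h

lemma color_not {V : Type*} {G : SimpleGraph V} {χ : V → Bool}
    (hχ : ∀ u v, G.Adj u v → χ u ≠ χ v) {x y : V} (h : G.Adj x y) : χ y = !χ x := by
  have := hχ _ _ h
  cases hx : χ x <;> cases hy : χ y <;> simp_all

theorem nice_of {V : Type*} [Fintype V] (d : ℕ)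
    (G : SimpleGraph V) (hbip : IsBipartiteGraph G)
    (htripod : ¬ HasInducedCopy G tripod)
    (harmchair : ¬ HasInducedCopy G armchair)
    (hstirrer : ¬ HasInducedCopy G stirrer)
    (hstar : ¬ HasInducedCopy G (completeBipartiteGraph (Fin 1) (Fin (d + 1)))) :
    Nice G d := by
  classical
  obtain ⟨χ, hχ⟩ : ∃ χ : V → Bool, ∀ u v, G.Adj u v → χ u ≠ χ v := by
    obtain ⟨A, B, hAB, hdis, hA, hB⟩ := hbip
    refine ⟨fun v => decide (v ∈ A), fun u v huv h => ?_⟩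
    have hu : u ∈ A ∪ B := by rw [hAB]; trivial
    have hv : v ∈ A ∪ B := by rw [hAB]; trivial
    have h : (u ∈ A) ↔ (v ∈ A) := by simpa using h
    by_cases hu' : u ∈ A
    · exact hA hu' (h.1 hu') huv
    · exact hB (hu.resolve_left hu') (hv.resolve_left (fun h' => hu' (h.2 h'))) huv
  refine ⟨⟨χ, hχ⟩, ?_, ?_, ?_, ?_⟩
  · intro v T hT
    by_contra hcard
    push Not at hcard
    obtain ⟨T', hT', hc⟩ := Finset.exists_subset_card_eq (Nat.succ_le_of_lt hcard)
    apply hstar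
    let e := (T'.equivFinOfCardEq hc).symm
    have he : ∀ i, G.Adj v (e i) := fun i => hT _ (hT' (e i).2)
    refine hasInducedCopy_of_inj (Sum.elim (fun _ => v) (fun i => (e i : V))) ?_ ?_
    · rintro (i | i) (j | j) hij
      · simp [Subsingleton.elim i j]
      · simp at hij; exact absurd hij (he j).ne
      · simp at hij; exact absurd hij.symm (he i).ne
      · simp only [Sum.elim_inr] at hij
        rw [e.injective (Subtype.ext hij)]
    · rintro (i | i) (j | j)
      · simp
      · simpa using he j
      · simpa using (he i).symm
      · simpa using same_color hχ (he i) (he j)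
  · intro o x1 x2 x3 y1 y2 y3 h1 h2 h3 h4 h5 h6 n1 n2 n3 n4 n5 n6
    refine htripod (tuple_copy ![o, x1, y1, x2, y2, x3, y3] (by decide) ?_)
    have c1 := color_not hχ h1; have c2 := color_not hχ h2; have c3 := color_not hχ h3
    have c4 := color_not hχ h4; have c5 := color_not hχ h5; have c6 := color_not hχ h6
    have E := fun x y => @color_eq V G χ hχ x y
    have n1' := fun h : G.Adj _ _ => n1 h.symm; have n2' := fun h : G.Adj _ _ => n2 h.symm
    have n3' := fun h : G.Adj _ _ => n3 h.symm; have n4' := fun h : G.Adj _ _ => n4 h.symm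
    have n5' := fun h : G.Adj _ _ => n5 h.symm; have n6' := fun h : G.Adj _ _ => n6 h.symm
    intro i j hij
    fin_cases i <;> fin_cases j <;> first | (exfalso; revert hij; decide) | 
      (first | (refine iff_of_true ?_ (by decide); assumption) | 
       (refine iff_of_false ?_ (by decide); first | assumption | (apply E; simp_all)))
  · intro c0 c1 c2 c3 p0 p1 p2 h1 h2 h3 h4 h5 h6 h7 n1 n2 n3 n4 n5
    refine harmchair (tuple_copy ![c0, c1, c2, c3, p0, p1, p2] (by decide) ?_)
    have k1 := color_not hχ h1; have k2 := color_not hχ h2; have k3 := color_not hχ h3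
    have k5 := color_not hχ h5; have k6 := color_not hχ h6
    have k7 := color_not hχ h7
    have E := fun x y => @color_eq V G χ hχ x y
    have n1' := fun h : G.Adj _ _ => n1 h.symm; have n2' := fun h : G.Adj _ _ => n2 h.symm
    have n3' := fun h : G.Adj _ _ => n3 h.symm; have n4' := fun h : G.Adj _ _ => n4 h.symm
    have n5' := fun h : G.Adj _ _ => n5 h.symm
    have h4' := h4.symm
    intro i j hij
    fin_cases i <;> fin_cases j <;> first | (exfalso; revert hij; decide) | 
      (first | (refine iff_of_true ?_ (by decide); assumption) | 
       (refine iff_of_false ?_ (by decide); first | assumption | (apply E; simp_all)))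
  · intro a0 a1 a2 a3 a4 a5 a6 h1 h2 h3 h4 h5 h6 h7 h8 n1 n2 n3 n4
    refine hstirrer (tuple_copy ![a0, a1, a2, a3, a4, a5, a6] (by decide) ?_)
    have k1 := color_not hχ h1; have k2 := color_not hχ h2; have k3 := color_not hχ h3
    have k5 := color_not hχ h5; have k6 := color_not hχ h6
    have k8 := color_not hχ h8
    have E := fun x y => @color_eq V G χ hχ x y
    have n1' := fun h : G.Adj _ _ => n1 h.symm; have n2' := fun h : G.Adj _ _ => n2 h.symm
    have n3' := fun h : G.Adj _ _ => n3 h.symm; have n4' := fun h : G.Adj _ _ => n4 h.symm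
    have h4' := h4.symm
    have h7' := h7.symm
    intro i j hij
    fin_cases i <;> fin_cases j <;> first | (exfalso; revert hij; decide) | 
      (first | (refine iff_of_true ?_ (by decide); assumption) | 
       (refine iff_of_false ?_ (by decide); first | assumption | (apply E; simp_all)))

lemma Nice.induce {V : Type*} {G : SimpleGraph V} {d : ℕ} (h : Nice G d) (K : Set V) :
    Nice (G.induce K) d := by
  classical
  obtain ⟨χ, hχ⟩ := h.bip
  refine ⟨⟨fun v => χ v, fun u v huv => hχ _ _ huv⟩, ?_, ?_, ?_, ?_⟩
  · intro v T hT
    have := h.deg v (T.map (Function.Embedding.subtype _)) (by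
      intro x hx
      obtain ⟨y, hy, rfl⟩ := Finset.mem_map.1 hx
      exact hT y hy)
    simpa using this
  · intro o x1 x2 x3 y1 y2 y3
    exact h.tri o x1 x2 x3 y1 y2 y3
  · intro c0 c1 c2 c3 p0 p1 p2
    exact h.arm c0 c1 c2 c3 p0 p1 p2
  · intro a0 a1 a2 a3 a4 a5 a6
    exact h.stir a0 a1 a2 a3 a4 a5 a6

/-! ### Connection inside a set, holes -/

/-- Being joined by a walk inside `K`. -/
def Conn {V : Type*} (G : SimpleGraph V) (K : Set V) : V → V → Prop :=
  Relation.ReflTransGen (fun a b => G.Adj a b ∧ a ∈ K ∧ b ∈ K)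

lemma Conn.symm {V : Type*} {G : SimpleGraph V} {K : Set V} {a b : V} (h : Conn G K a b) :
    Conn G K b a := by
  induction h with
  | refl => exact Relation.ReflTransGen.refl
  | tail _ h2 ih => exact Relation.ReflTransGen.head ⟨h2.1.symm, h2.2.2, h2.2.1⟩ ih

lemma Conn.mono {V : Type*} {G : SimpleGraph V} {K L : Set V} (hKL : K ⊆ L) {a b : V}
    (h : Conn G K a b) : Conn G L a b := by
  induction h with
  | refl => exact Relation.ReflTransGen.refl
  | tail _ h2 ih => exact Relation.ReflTransGen.tail ih ⟨h2.1, hKL h2.2.1, hKL h2.2.2⟩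

/-- A bi-infinite walk without chords of length three (such as the unrolling of a hole). -/
def HoleWalk {V : Type*} (G : SimpleGraph V) (c : ℤ → V) : Prop :=
  (∀ i, G.Adj (c i) (c (i + 1))) ∧ ∀ i, ¬ G.Adj (c i) (c (i + 3))

lemma holeWalk_closed {V : Type*} {G : SimpleGraph V} {d : ℕ} (h : Nice G d) {c : ℤ → V}
    (hc : HoleWalk G c) {u v : V} (huv : G.Adj u v) (i : ℤ) (hu : G.Adj (c i) u) :
    ∃ j, v = c j ∨ G.Adj (c j) v := by
  by_contra hv
  push Not at hv
  obtain ⟨χ, hχ⟩ := h.bip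
  have a0 : G.Adj (c i) (c (i+1)) := hc.1 i
  have a1 : G.Adj (c (i+1)) (c (i+2)) := by have := hc.1 (i+1); rwa [show i+1+1 = i+2 by ring] at this
  have a2 : G.Adj (c (i+2)) (c (i+3)) := by have := hc.1 (i+2); rwa [show i+2+1 = i+3 by ring] at this
  have b0 : G.Adj (c (i-1)) (c i) := by have := hc.1 (i-1); rwa [show i-1+1 = i by ring] at this
  have b1 : G.Adj (c (i-2)) (c (i-1)) := by have := hc.1 (i-2); rwa [show i-2+1 = i-1 by ring] at this
  have b2 : G.Adj (c (i-3)) (c (i-2)) := by have := hc.1 (i-3); rwa [show i-3+1 = i-2 by ring] at this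
  have n0 : ¬ G.Adj (c i) (c (i+3)) := hc.2 i
  have n1 : ¬ G.Adj (c (i-1)) (c (i+2)) := by have := hc.2 (i-1); rwa [show i-1+3 = i+2 by ring] at this
  have n2 : ¬ G.Adj (c (i-2)) (c (i+1)) := by have := hc.2 (i-2); rwa [show i-2+3 = i+1 by ring] at this
  have n3 : ¬ G.Adj (c (i-3)) (c i) := by have := hc.2 (i-3); rwa [show i-3+3 = i by ring] at this
  have nv : ∀ j, ¬ G.Adj (c j) v := fun j => (hv j).2
  have nv' : ∀ j, ¬ G.Adj v (c j) := fun j hj => (hv j).2 hj.symm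
  by_cases hp : G.Adj u (c (i+2))
  · exact h.arm (c i) u (c (i+2)) (c (i+1)) (c (i-1)) v (c (i+3)) hu hp a1.symm a0.symm b0.symm huv
      a2 n0 (fun h' => n1 h'.symm) (nv' _) (nv' _) (nv' _)
  by_cases hm : G.Adj u (c (i-2))
  · exact h.arm (c i) u (c (i-2)) (c (i-1)) (c (i+1)) v (c (i-3)) hu hm b1 b0 a0 huv
      b2.symm (fun h' => n3 h'.symm) n2 (nv' _) (nv' _) (nv' _)
  exact h.tri (c i) (c (i+1)) (c (i-1)) u (c (i+2)) (c (i-2)) v a0 b0.symm hu a1 b1.symm huv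
    (fun h' => n2 h'.symm) (nv _) n1 (nv _) hp hm

lemma holeWalk_dominates {V : Type*} {G : SimpleGraph V} {d : ℕ} (h : Nice G d) {c : ℤ → V}
    (hc : HoleWalk G c) {K : Set V} {b : V} (hb : Conn G K (c 0) b) :
    ∃ j, b = c j ∨ G.Adj (c j) b := by
  induction hb with
  | refl => exact ⟨0, Or.inl rfl⟩
  | tail _ h2 ih =>
    obtain ⟨j, rfl | hj⟩ := ih
    · exact ⟨j, Or.inr h2.1⟩
    · exact holeWalk_closed h hc h2.1 j hj

/-- The graph `G` with only the edges inside `Y`. -/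
def restr {V : Type*} (G : SimpleGraph V) (Y : Set V) : SimpleGraph V where
  Adj a b := G.Adj a b ∧ a ∈ Y ∧ b ∈ Y
  symm := ⟨fun _ _ h => ⟨h.1.symm, h.2.2, h.2.1⟩⟩
  loopless := ⟨fun _ h => h.1.ne rfl⟩

lemma conn_reachable {V : Type*} {G : SimpleGraph V} {K : Set V} {a b : V} (h : Conn G K a b) :
    (restr G K).Reachable a b := by
  induction h with
  | refl => exact SimpleGraph.Reachable.refl _
  | tail _ h2 ih => exact ih.trans (SimpleGraph.Adj.reachable (G := restr G K) h2)

theorem holeStar {V : Type*} {G : SimpleGraph V} {d : ℕ} (h : Nice G d)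
    (hno : ∀ c, ¬ HoleWalk G c) {p u w y y' : V} {X : Set V} (hu : G.Adj p u) (hw : G.Adj p w)
    (hX : ∀ x ∈ X, x ≠ p ∧ ¬ G.Adj p x) (hy : y ∈ X) (hy' : y' ∈ X) (huy : G.Adj u y)
    (hwy : G.Adj w y') (hc : Conn G X y y') : ∃ z ∈ X, G.Adj u z ∧ G.Adj w z := by
  by_cases huw : u = w
  · subst huw; exact ⟨y, hy, huy, huy⟩
  obtain ⟨χ, hχ⟩ := h.bip
  set Y : Set V := X ∪ {u, w} with hY
  have hXY : X ⊆ Y := Set.subset_union_left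
  have huY : u ∈ Y := by simp [hY]
  have hwY : w ∈ Y := by simp [hY]
  have hr : (restr G Y).Reachable u w := by
    have h1 := conn_reachable (hc.mono hXY)
    have h2 : (restr G Y).Adj u y := ⟨huy, huY, hXY hy⟩
    have h3 : (restr G Y).Adj y' w := ⟨hwy.symm, hXY hy', hwY⟩
    exact h2.reachable.trans (h1.trans h3.reachable)
  obtain ⟨q, hq⟩ := hr.exists_walk_length_eq_dist
  set m := q.length with hm
  set f : ℕ → V := fun i => q.getVert i with hf
  have f0 : f 0 = u := by simp [hf]
  have fm : f m = w := by simp [hf, hm]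
  have fadj : ∀ i, i < m → (restr G Y).Adj (f i) (f (i+1)) := fun i hi => q.adj_getVert_succ hi
  have fdist : ∀ i, i ≤ m → (restr G Y).dist u (f i) = i := by
    intro i hi
    have h1 : (restr G Y).dist u (f i) ≤ i := by
      have := SimpleGraph.dist_le (q.take i)
      rw [SimpleGraph.Walk.take_length] at this
      exact this.trans (min_le_left _ _)
    have h2 : (restr G Y).dist (f i) w ≤ m - i := by
      have := SimpleGraph.dist_le (q.drop i)
      rwa [SimpleGraph.Walk.drop_length] at this
    have h3 := (q.take i).reachable.dist_triangle_left w
    change (restr G Y).dist u w ≤ (restr G Y).dist u (f i) + (restr G Y).dist (f i) w at h3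
    omega
  have fY : ∀ i, i ≤ m → f i ∈ Y := by
    intro i hi
    rcases Nat.lt_or_ge i m with hi' | hi'
    · exact (fadj i hi').2.1
    · rw [show i = m by omega, fm]; exact hwY
  have chord : ∀ i j, i + 1 < j → j ≤ m → ¬ G.Adj (f i) (f j) := by
    intro i j hij hj hadj
    have h1 : (restr G Y).Adj (f i) (f j) := ⟨hadj, fY i (by omega), fY j hj⟩
    have h2 := fdist i (by omega)
    have h3 := fdist j hj
    have h4 := h1.diff_dist_adj (u := u)
    omega
  have fX : ∀ i, 0 < i → i < m → f i ∈ X := by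
    intro i h0 hi
    rcases fY i hi.le with hx | hx | hx
    · exact hx
    · have := fdist i hi.le
      rw [hx] at this; simp at this; omega
    · have h1 := fdist i hi.le
      have h2 := fdist m le_rfl
      rw [hx, ← fm] at h1; omega
  have cu : χ u = !χ p := color_not hχ hu
  have cw : χ w = !χ p := color_not hχ hw
  have hm0 : m ≠ 0 := by rintro h0; rw [h0] at fm; exact huw (f0.symm.trans fm)
  have hm1 : m ≠ 1 := by
    intro h0
    have := (fadj 0 (by omega)).1
    rw [h0] at fm; rw [f0, fm] at this
    exact same_color hχ hu hw this
  have hm3 : m ≠ 3 := by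
    intro h0
    have e1 := color_not hχ (fadj 0 (by omega)).1
    have e2 := color_not hχ (fadj 1 (by omega)).1
    have e3 := color_not hχ (fadj 2 (by omega)).1
    rw [h0] at fm
    simp only [zero_add] at e1 e2 e3
    norm_num at e2 e3
    rw [fm] at e3; rw [f0] at e1
    rw [e2, e1, cu] at e3
    rw [cw] at e3; revert e3; cases χ p <;> simp
  by_cases hm2 : m = 2
  · refine ⟨f 1, fX 1 (by omega) (by omega), ?_, ?_⟩
    · have := (fadj 0 (by omega)).1; rwa [f0] at this
    · have := (fadj 1 (by omega)).1
      rw [show (1+1) = m by omega, fm] at this; exact this.symm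
  exfalso
  have hm4 : 4 ≤ m := by omega
  let g : ℤ → V := fun r => if r ≤ m then f r.toNat else p
  have gp : g (m+1) = p := by simp [g]
  have gf : ∀ r : ℤ, r ≤ m → g r = f r.toNat := fun r hr => by simp [g, hr]
  let n : ℤ := m + 2
  have hn : 0 < n := by positivity
  refine hno (fun i => g (i % n)) ⟨fun i => ?_, fun i => ?_⟩
  · have l0 := Int.emod_nonneg i hn.ne'
    have l1 := Int.emod_lt_of_pos i hn
    have e : (i+1) % n = if i % n = m + 1 then 0 else i % n + 1 := by
      rw [← Int.emod_add_mul_ediv i n]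
      generalize i % n = r at *
      rw [show r + n * (i / n) + 1 = (r + 1) + n * (i/n) by ring]
      simp only [Int.add_mul_emod_self_left]
      have l2 : r % n = r := Int.emod_eq_of_lt l0 l1
      rw [l2]
      split_ifs with hh
      · subst hh; rw [show (m:ℤ)+1+1 = n by simp [n]; ring]; simp
      · rw [Int.emod_eq_of_lt] <;> omega
    simp only [e]
    generalize i % n = r at *
    split_ifs with hh
    · subst hh; rw [gp, gf 0 (by omega)]; simpa [f0] using hu
    · by_cases h2 : r = m
      · subst h2; rw [gp, gf _ le_rfl]; simpa [fm] using hw.symm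
      · rw [gf _ (by omega), gf _ (by omega)]
        have := (fadj r.toNat (by omega)).1
        rwa [show r.toNat + 1 = (r+1).toNat by omega] at this
  · have l0 := Int.emod_nonneg i hn.ne'
    have l1 := Int.emod_lt_of_pos i hn
    have e : (i+3) % n = if i % n + 3 < n then i % n + 3 else i % n + 3 - n := by
      rw [← Int.emod_add_mul_ediv i n]
      generalize i % n = r at *
      rw [show r + n * (i / n) + 3 = (r + 3) + n * (i/n) by ring]
      simp only [Int.add_mul_emod_self_left]
      have l2 : r % n = r := Int.emod_eq_of_lt l0 l1
      rw [l2]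
      split_ifs with hh
      · rw [Int.emod_eq_of_lt] <;> omega
      · rw [← Int.sub_emod_right, Int.emod_eq_of_lt] <;> omega
    simp only [e]
    generalize i % n = r at *
    split_ifs with hh
    · by_cases h2 : r + 3 = m + 1
      · rw [h2, gp, gf _ (by omega)]
        intro h'
        exact (hX _ (fX r.toNat (by omega) (by omega))).2 h'.symm
      · rw [gf _ (by omega), gf _ (by omega)]
        exact chord _ _ (by omega) (by omega)
    · by_cases h2 : r = m + 1
      · subst h2
        rw [gp, gf _ (by omega)]
        exact (hX _ (fX _ (by omega) (by omega))).2
      · rw [gf _ (by omega), gf _ (by omega)]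
        intro hadj
        exact chord _ _ (by omega) (by omega) hadj.symm

/-! ### Links and end vertices -/

lemma link {V : Type*} {G : SimpleGraph V} {d : ℕ} (h : Nice G d)
    (hno : ∀ c, ¬ HoleWalk G c) {p s u w : V} {K : Set V} (hps : G.Adj p s)
    (hs : ∀ x ∈ K, ¬ G.Adj s x) (hpK : p ∉ K) (hK : ∀ a ∈ K, ∀ b ∈ K, Conn G K a b)
    (hu : G.Adj p u) (hw : G.Adj p w) (huK : u ∈ K) (hwK : w ∈ K) (huw : u ≠ w) :
    ∃ z ∈ K, G.Adj u z ∧ G.Adj w z := by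
  obtain ⟨χ, hχ⟩ := h.bip
  let Link : V → V → Prop := fun a b => a = b ∨ ∃ z ∈ K, G.Adj a z ∧ G.Adj b z
  have ltrans : ∀ a b c, G.Adj p a → G.Adj p b → G.Adj p c → Link a b → Link b c → Link a c := by
    intro a b c ha hb hc hab hbc
    rcases hab with rfl | ⟨x1, hx1, h1, h2⟩
    · exact hbc
    rcases hbc with rfl | ⟨x2, hx2, h3, h4⟩
    · exact Or.inr ⟨x1, hx1, h1, h2⟩
    by_contra hcon
    refine h.stir p b x1 a x2 c s hb h2 h1.symm ha.symm h3 h4.symm hc.symm hps ?_ ?_ ?_ ?_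
    · exact fun h' => hcon (Or.inr ⟨x1, hx1, h1, h'.symm⟩)
    · exact fun h' => hs _ hx1 h'.symm
    · exact fun h' => hcon (Or.inr ⟨x2, hx2, h'.symm, h4⟩)
    · exact fun h' => hs _ hx2 h'.symm
  have key : ∀ v, Conn G K u v → (G.Adj p v → Link u v) ∧ (¬ G.Adj p v →
      ∃ v' ∈ K, G.Adj p v' ∧ Link u v' ∧ ∃ y, G.Adj v' y ∧ y ∈ K ∧ ¬ G.Adj p y ∧
        v ∈ K ∧ Conn G {x | x ∈ K ∧ ¬ G.Adj p x} y v) := by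
    intro v hv
    induction hv with
    | refl => exact ⟨fun _ => Or.inl rfl, fun h' => absurd hu h'⟩
    | @tail b c _ h2 ih =>
      obtain ⟨hbc, hbK, hcK⟩ := h2
      by_cases hb : G.Adj p b
      · have hc : ¬ G.Adj p c := fun hc => same_color hχ hb hc hbc
        refine ⟨fun h' => absurd h' hc, fun _ => ⟨b, hbK, hb, ih.1 hb, c, hbc, hcK, hc, hcK, ?_⟩⟩
        exact Relation.ReflTransGen.refl
      · obtain ⟨v', hv'K, hv', hl, y, hvy, hyK, hy, _, hcon⟩ := ih.2 hb
        refine ⟨fun hc => ?_, fun hc => ?_⟩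
        · obtain ⟨z, hz, h3, h4⟩ := holeStar h hno hv' hc
            (X := {x | x ∈ K ∧ ¬ G.Adj p x})
            (by rintro x ⟨hx, hx'⟩; exact ⟨fun hxp => hpK (hxp ▸ hx), hx'⟩)
            ⟨hyK, hy⟩ ⟨hbK, hb⟩ hvy hbc.symm hcon
          exact ltrans _ _ _ hu hv' hc hl (Or.inr ⟨z, hz.1, h3, h4⟩)
        · exact ⟨v', hv'K, hv', hl, y, hvy, hyK, hy, hcK, hcon.tail ⟨hbc, ⟨hbK, hb⟩, ⟨hcK, hc⟩⟩⟩
  exact ((key w (hK u huK w hwK)).1 hw).resolve_left huw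

lemma conn_insert {V : Type*} {G : SimpleGraph V} {K : Set V} {x k : V}
    (hK : ∀ a ∈ K, ∀ b ∈ K, Conn G K a b) (hk : k ∈ K) (hx : G.Adj x k) :
    ∀ a ∈ insert x K, ∀ b ∈ insert x K, Conn G (insert x K) a b := by
  have hmono := Set.subset_insert x K
  have h1 : ∀ b ∈ K, Conn G (insert x K) x b := fun b hb =>
    Relation.ReflTransGen.head ⟨hx, Set.mem_insert _ _, hmono hk⟩ ((hK k hk b hb).mono hmono)
  rintro a (rfl | ha) b (rfl | hb)
  · exact Relation.ReflTransGen.refl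
  · exact h1 b hb
  · exact (h1 a ha).symm
  · exact (hK a ha b hb).mono hmono

/-- An end vertex `s`, with a largest connected set `K` in `G - N[s]`. -/
structure IsEnd {V : Type*} (G : SimpleGraph V) (s : V) (K : Set V) : Prop where
  away : ∀ x ∈ K, x ≠ s ∧ ¬ G.Adj s x
  conn : ∀ a ∈ K, ∀ b ∈ K, Conn G K a b
  bd : ∀ x k, k ∈ K → G.Adj x k → x ∉ K → G.Adj s x
  oth : ∀ w, w ∉ K → w ≠ s → ¬ G.Adj s w → ∀ p k, G.Adj s p → k ∈ K → G.Adj p k → G.Adj p w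
  ne : ∀ w, w ≠ s → ¬ G.Adj s w → K.Nonempty

lemma exists_end {V : Type*} [Fintype V] [Nonempty V] (G : SimpleGraph V) :
    ∃ s K, IsEnd G s K := by
  classical
  let P : V × Finset V → Prop := fun q => (∀ x ∈ q.2, x ≠ q.1 ∧ ¬ G.Adj q.1 x) ∧
    ∀ a ∈ q.2, ∀ b ∈ q.2, Conn G (q.2 : Set V) a b
  obtain ⟨v0⟩ := ‹Nonempty V›
  obtain ⟨⟨s, K⟩, hq, hmax⟩ := Finset.exists_max_image (Finset.univ.filter P) (fun q => q.2.card)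
    ⟨(v0, ∅), by simp [P]⟩
  have hP : P (s, K) := by simpa using hq
  have hmax : ∀ s' K', P (s', K') → K'.card ≤ K.card := fun s' K' h' => hmax (s', K') (by simpa using h')
  obtain ⟨h1, h2⟩ := hP
  simp only at h1 h2
  have bd : ∀ x k, k ∈ K → G.Adj x k → x ∉ K → G.Adj s x := by
    intro x k hk hxk hx
    by_contra hsx
    have := hmax s (insert x K) ⟨?_, ?_⟩
    · rw [Finset.card_insert_of_notMem hx] at this; omega
    · intro y hy
      rcases Finset.mem_insert.1 hy with rfl | hy
      · refine ⟨?_, hsx⟩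
        rintro rfl
        exact (h1 k hk).2 hxk
      · exact h1 y hy
    · have := conn_insert (K := (K : Set V)) h2 hk hxk
      simpa using this
  refine ⟨s, K, h1, h2, bd, ?_, ?_⟩
  · intro w hwK hws hsw p k hsp hk hpk
    by_contra hpw
    have hpK : p ∉ K := fun h' => (h1 p h').2 hsp
    have := hmax w (insert p K) ⟨?_, ?_⟩
    · rw [Finset.card_insert_of_notMem hpK] at this; omega
    · intro y hy
      rcases Finset.mem_insert.1 hy with rfl | hy
      · refine ⟨?_, fun h' => hpw h'.symm⟩
        rintro rfl
        exact hsw hsp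
      · refine ⟨fun h' => hwK (by rw [show y = w from h'] at hy; exact hy), fun h' => hsw (bd w y hy h' hwK)⟩
    · have := conn_insert (K := (K : Set V)) h2 hk hpk
      simpa using this
  · intro w hws hsw
    have := hmax s {w} ⟨?_, ?_⟩
    · have : 0 < K.card := by simpa using this
      exact_mod_cast Finset.card_pos.1 this
    · intro y hy
      rw [Finset.mem_singleton.1 hy]; exact ⟨hws, hsw⟩
    · intro a ha b hb
      rw [Finset.mem_singleton.1 ha, Finset.mem_singleton.1 hb]
      exact Relation.ReflTransGen.refl

/-! ### Layers -/

section Layers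
variable {V : Type*} {G : SimpleGraph V} {d : ℕ} {s : V}

lemma exists_parent (hc : G.Connected) {x : V} {n : ℕ} (hx : G.dist s x = n + 1) :
    ∃ p, G.Adj p x ∧ G.dist s p = n := by
  obtain ⟨q, hq⟩ := hc.exists_walk_length_eq_dist s x
  have hadj := q.adj_getVert_succ (i := n) (by omega)
  have e : q.getVert (n+1) = x := by rw [show n + 1 = q.length by omega]; simp
  rw [e] at hadj
  refine ⟨_, hadj, ?_⟩
  have h1 := SimpleGraph.dist_le (q.take n)
  rw [SimpleGraph.Walk.take_length] at h1
  have h2 := hadj.diff_dist_adj (u := s)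
  omega

lemma dist_color (hc : G.Connected) {χ : V → Bool} (hχ : ∀ u v, G.Adj u v → χ u ≠ χ v) (n : ℕ) :
    ∀ x, G.dist s x = n → χ x = if Even n then χ s else !χ s := by
  induction n with
  | zero =>
    intro x hx
    rw [hc.dist_eq_zero_iff] at hx; subst hx; simp
  | succ n ih =>
    intro x hx
    obtain ⟨p, hp, hpn⟩ := exists_parent hc hx
    rw [color_not hχ hp, ih p hpn]
    by_cases hn : Even n <;> simp [hn, Nat.even_add_one]

lemma layer_adj (h : Nice G d) (hc : G.Connected) {x y : V} (hxy : G.Adj x y) :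
    G.dist s y = G.dist s x + 1 ∨ G.dist s x = G.dist s y + 1 := by
  obtain ⟨χ, hχ⟩ := h.bip
  have h1 := hxy.diff_dist_adj (u := s)
  have h2 : G.dist s x ≠ G.dist s y := by
    intro h2
    apply hχ _ _ hxy
    rw [dist_color (s := s) hc hχ _ x h2, dist_color (s := s) hc hχ _ y rfl]
  omega

/-- No two independent edges between layers `i` and `i+1`. -/
def Nest (G : SimpleGraph V) (s : V) (i : ℕ) : Prop :=
  ∀ u w x y, G.dist s u = i → G.dist s w = i → G.dist s x = i + 1 → G.dist s y = i + 1 →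
    G.Adj u x → G.Adj w y → ¬ G.Adj u y → ¬ G.Adj w x → False

lemma Nest.common (hc : G.Connected) {i : ℕ} (hn : Nest G s i) {x y : V}
    (hx : G.dist s x = i + 1) (hy : G.dist s y = i + 1) :
    ∃ p, G.dist s p = i ∧ G.Adj p x ∧ G.Adj p y := by
  obtain ⟨p, hp, hpi⟩ := exists_parent hc hx
  obtain ⟨q, hq, hqi⟩ := exists_parent hc hy
  by_cases h1 : G.Adj p y
  · exact ⟨p, hpi, hp, h1⟩
  by_cases h2 : G.Adj q x
  · exact ⟨q, hqi, h2, hq⟩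
  exact (hn p q x y hpi hqi hx hy hp hq h1 h2).elim

lemma exit_set (hc : G.Connected) {K : Set V} (hK : K.Nonempty) (hs : s ∉ K) :
    ∃ k ∈ K, ∃ x, x ∉ K ∧ G.Adj x k := by
  obtain ⟨k, hk⟩ := hK
  obtain ⟨q⟩ := hc.preconnected k s
  obtain ⟨e, he, h1, h2⟩ := q.exists_boundary_dart K hk hs
  exact ⟨e.fst, h1, e.snd, h2, e.adj.symm⟩

lemma nest_one (h : Nice G d) (hno : ∀ c, ¬ HoleWalk G c) (hc : G.Connected) {K : Set V}
    (hE : IsEnd G s K) : Nest G s 1 := by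
  intro p p' u w hp hp' hu hw hpu hpw hpw' hpu'
  obtain ⟨χ, hχ⟩ := h.bip
  rw [SimpleGraph.dist_eq_one_iff_adj] at hp hp'
  have far : ∀ z, G.dist s z = 2 → z ≠ s ∧ ¬ G.Adj s z := by
    intro z hz
    refine ⟨?_, ?_⟩
    · rintro rfl; simp at hz
    · intro h'; rw [← SimpleGraph.dist_eq_one_iff_adj] at h'; omega
  have hsK : s ∉ K := fun h' => (hE.away s h').1 rfl
  have nK : ∀ z, G.Adj s z → z ∉ K := fun z hz h' => (hE.away z h').2 hz
  by_cases huK : u ∈ K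
  · by_cases hwK : w ∈ K
    · obtain ⟨z, hzK, hpz, hpz'⟩ := holeStar h hno hp hp' (X := K) hE.away huK hwK hpu hpw
        (hE.conn u huK w hwK)
      have hK' : ∀ x ∈ K, ¬ G.Adj s x := fun x hx => (hE.away x hx).2
      obtain ⟨x, hxK, hux, hzx⟩ := link h hno hp.symm hK' (nK p hp) hE.conn hpu hpz huK hzK
        (by rintro rfl; exact hpu' hpz')
      obtain ⟨y, hyK, hwy, hzy⟩ := link h hno hp'.symm hK' (nK p' hp') hE.conn hpw hpz' hwK hzK
        (by rintro rfl; exact hpw' hpz)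
      have hole : ∀ x, x ∈ K → G.Adj u x → G.Adj w x → False := by
        intro x hx h1 h2
        obtain ⟨z, hz, h3, h4⟩ := holeStar h hno hp hp' (X := {u, x, w}) (y := u) (y' := w)
          (by rintro t (rfl | rfl | rfl) <;> exact hE.away _ (by assumption))
          (by simp) (by simp) hpu hpw
          ((Relation.ReflTransGen.refl.tail ⟨h1, by simp, by simp⟩).tail ⟨h2.symm, by simp, by simp⟩)
        rcases hz with rfl | rfl | rfl
        · exact hpu' h4
        · exact same_color hχ hpu h3 h1
        · exact hpw' h3
      exact h.stir z p u x s p' y hpz.symm hpu hux hzx.symm hp.symm hp' hpz' hzy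
        (fun h' => hpu' h'.symm) (fun h' => hole y hyK h' hwy) (hK' x hxK) (hK' y hyK)
    · exact hpw' (hE.oth w hwK (far w hw).1 (far w hw).2 p u hp huK hpu)
  · by_cases hwK : w ∈ K
    · exact hpu' (hE.oth u huK (far u hu).1 (far u hu).2 p' w hp' hwK hpw)
    · obtain ⟨k, hk, q, hq, hqk⟩ := exit_set hc (hE.ne u (far u hu).1 (far u hu).2) hsK
      have hsq := hE.bd q k hk hqk hq
      have hqu := hE.oth u huK (far u hu).1 (far u hu).2 q k hsq hk hqk
      have hqw := hE.oth w hwK (far w hw).1 (far w hw).2 q k hsq hk hqk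
      refine h.stir q s p u p' w k hsq.symm hp hpu hqu.symm hp' hpw hqw.symm hqk hpw' ?_ hpu' ?_
      · exact fun h' => hpw' (hE.oth w hwK (far w hw).1 (far w hw).2 p k hp hk h')
      · exact fun h' => hpu' (hE.oth u huK (far u hu).1 (far u hu).2 p' k hp' hk h')

lemma nest_two (h : Nice G d) (hno : ∀ c, ¬ HoleWalk G c) (hc : G.Connected) {K : Set V}
    (hE : IsEnd G s K) : Nest G s 2 := by
  intro u w x y hu hw hx hy hux hwy huy hwx
  obtain ⟨χ, hχ⟩ := h.bip
  obtain ⟨p, hp, hpu, hpw⟩ := (nest_one h hno hc hE).common hc hu hw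
  have hsp := SimpleGraph.dist_eq_one_iff_adj.1 hp
  have far : ∀ z, 2 ≤ G.dist s z → z ≠ s ∧ ¬ G.Adj s z := by
    intro z hz
    refine ⟨?_, ?_⟩
    · rintro rfl; simp at hz
    · intro h'; rw [← SimpleGraph.dist_eq_one_iff_adj] at h'; omega
  have hsK : s ∉ K := fun h' => (hE.away s h').1 rfl
  have three : ∀ z, G.dist s z = 3 → z ∈ K := by
    intro z hz
    by_contra hzK
    have hf := far z (by omega)
    obtain ⟨k, hk, q, hq, hqk⟩ := exit_set hc (hE.ne z hf.1 hf.2) hsK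
    have hsq := hE.bd q k hk hqk hq
    have hqz := hE.oth z hzK hf.1 hf.2 q k hsq hk hqk
    have := layer_adj h hc (s := s) hqz
    rw [← SimpleGraph.dist_eq_one_iff_adj] at hsq
    omega
  have two : ∀ z t, G.dist s z = 2 → G.dist s t = 3 → G.Adj z t → z ∈ K := by
    intro z t hz ht hzt
    by_contra hzK
    exact (far z (by omega)).2 (hE.bd z t (three t ht) hzt hzK)
  have huK := two u x hu hx hux
  have hwK := two w y hw hy hwy
  have hpK : p ∉ K := fun h' => (hE.away p h').2 hsp
  obtain ⟨z, hzK, huz, hwz⟩ := link h hno hsp.symm (fun x hx => (hE.away x hx).2) hpK hE.conn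
    hpu hpw huK hwK (by rintro rfl; exact huy hwy)
  exact h.arm u p w z x s y hpu.symm hpw hwz huz.symm hux hsp.symm hwy huy hwx
    (hE.away z hzK).2 (far x (by omega)).2 (far y (by omega)).2

lemma nest_all (h : Nice G d) (hno : ∀ c, ¬ HoleWalk G c) (hc : G.Connected) {K : Set V}
    (hE : IsEnd G s K) (i : ℕ) : Nest G s (i + 1) := by
  induction i with
  | zero => exact nest_one h hno hc hE
  | succ i ih =>
    rcases Nat.eq_zero_or_pos i with rfl | hi
    · exact nest_two h hno hc hE
    obtain ⟨j, rfl⟩ : ∃ j, i = j + 1 := ⟨i - 1, by omega⟩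
    intro u w x y hu hw hx hy hux hwy huy hwx
    obtain ⟨p, hp, hpu, hpw⟩ := ih.common hc hu hw
    obtain ⟨q, hqp, hq⟩ := exists_parent hc hp
    obtain ⟨r, hrq, hr⟩ := exists_parent hc hq
    have na : ∀ a b, G.dist s a + 1 < G.dist s b → ¬ G.Adj a b := by
      intro a b hab h'
      have := layer_adj h hc (s := s) h'
      omega
    exact h.tri p u w q x y r hpu hpw hqp.symm hux hwy hrq.symm huy
      (fun h' => na _ _ (by omega) h'.symm) hwx
      (fun h' => na _ _ (by omega) h'.symm) (na _ _ (by omega)) (na _ _ (by omega))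

/-- Incomparable twins do not exist in deep layers. -/
lemma compat (h : Nice G d) (hno : ∀ c, ¬ HoleWalk G c) (hc : G.Connected) {K : Set V}
    (hE : IsEnd G s K) {j : ℕ} {u w a c : V} (hu : G.dist s u = j + 3) (hw : G.dist s w = j + 3)
    (ha : G.dist s a = j + 2) (hcc : G.dist s c = j + 4) (hau : G.Adj a u) (haw : ¬ G.Adj a w)
    (hcu : G.Adj u c) (hcw : ¬ G.Adj w c) : False := by
  obtain ⟨a', ha', hau', haw'⟩ := (nest_all h hno hc hE (j+1)).common hc hu hw
  obtain ⟨p, hp, hpa, hpa'⟩ := (nest_all h hno hc hE j).common hc ha ha'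
  obtain ⟨q, hqp, hq⟩ := exists_parent hc hp
  have na : ∀ a b, G.dist s a + 1 < G.dist s b → ¬ G.Adj a b := by
    intro a b hab h'
    have := layer_adj h hc (s := s) h'
    omega
  exact h.arm p a' u a q w c hpa' hau' hau.symm hpa.symm hqp.symm haw' hcu (na _ _ (by omega))
    (fun h' => na _ _ (by omega) h'.symm) (fun h' => haw h'.symm)
    (fun h' => na _ _ (by omega) h'.symm) hcw

end Layers

/-! ### Interval models -/

/-- An interval model of `G[U]` with at most `k` intervals over each point. -/
def Model {V : Type*} (G : SimpleGraph V) (U : Set V) (k : ℕ) : Prop :=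
  ∃ lo hi : V → ℕ, (∀ v ∈ U, lo v ≤ hi v) ∧
    (∀ u ∈ U, ∀ v ∈ U, G.Adj u v → lo u ≤ hi v ∧ lo v ≤ hi u) ∧
    ∀ (t : ℕ) (T : Finset V), (∀ v ∈ T, v ∈ U ∧ lo v ≤ t ∧ t ≤ hi v) → T.card ≤ k

theorem model_connected {V : Type*} [Fintype V] {G : SimpleGraph V} {d : ℕ} (h : Nice G d)
    (hno : ∀ c, ¬ HoleWalk G c) (hc : G.Connected) : Model G Set.univ (d + 1) := by
  classical
  haveI := hc.nonempty
  rcases subsingleton_or_nontrivial V with hsub | hnon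
  · refine ⟨fun _ => 0, fun _ => 0, by simp, by simp, fun t T _ => ?_⟩
    have := Finset.card_le_one_of_subsingleton T
    omega
  obtain ⟨s, K, hE⟩ := exists_end G
  set D : V → ℕ := fun v => G.dist s v with hD
  set N := Fintype.card V with hN
  let Nm : V → Finset V := fun b => Finset.univ.filter (fun x => G.Adj x b ∧ D b = D x + 1)
  let Np : V → Finset V := fun b => Finset.univ.filter (fun x => G.Adj b x ∧ D x = D b + 1)
  have mNm : ∀ x b, x ∈ Nm b ↔ G.Adj x b ∧ D b = D x + 1 := fun x b => by simp [Nm]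
  have mNp : ∀ x b, x ∈ Np b ↔ G.Adj b x ∧ D x = D b + 1 := fun x b => by simp [Np]
  have lay : ∀ x y, G.Adj x y → D y = D x + 1 ∨ D x = D y + 1 := fun x y hxy =>
    layer_adj h hc hxy
  have nest : ∀ i, Nest G s (i+1) := nest_all h hno hc hE
  have cmp : ∀ b b', Odd (D b) → D b = D b' →
      (Nm b' ⊆ Nm b ∧ Np b ⊆ Np b') ∨ (Nm b ⊆ Nm b' ∧ Np b' ⊆ Np b) := by
    intro b b' hodd hbb
    have np : Np b ⊆ Np b' ∨ Np b' ⊆ Np b := by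
      by_contra hcon
      push Not at hcon
      obtain ⟨x, hx, hx'⟩ := Finset.not_subset.1 hcon.1
      obtain ⟨y, hy, hy'⟩ := Finset.not_subset.1 hcon.2
      rw [mNp] at hx hx' hy hy'
      obtain ⟨i, hi⟩ : ∃ i, D b = i + 1 := ⟨D b - 1, by obtain ⟨j, hj⟩ := hodd; omega⟩
      exact nest i b b' x y hi (by rw [← hi, hbb]) (by rw [← hi]; exact hx.2)
        (by rw [← hi, hbb]; exact hy.2) hx.1 hy.1 (fun h' => hy' ⟨h', by omega⟩)
        (fun h' => hx' ⟨h', by omega⟩)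
    obtain ⟨j, hj⟩ := hodd
    rcases Nat.eq_zero_or_pos j with rfl | hjpos
    · have e : ∀ z z', D z = 1 → D z' = 1 → Nm z ⊆ Nm z' := by
        intro z z' hz hz' x hx
        rw [mNm] at hx ⊢
        have hx0 : G.dist s x = 0 := by have := hx.2; simp only [hD] at this hz; omega
        rw [hc.dist_eq_zero_iff] at hx0
        subst hx0
        exact ⟨SimpleGraph.dist_eq_one_iff_adj.1 hz', by have := hx.2; omega⟩
      have e1 := e b b' (by omega) (by omega)
      have e2 := e b' b (by omega) (by omega)
      rcases np with np | np
      · exact Or.inl ⟨e2, np⟩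
      · exact Or.inr ⟨e1, np⟩
    obtain ⟨i, hi⟩ : ∃ i, D b = i + 3 := ⟨D b - 3, by omega⟩
    have nm : Nm b ⊆ Nm b' ∨ Nm b' ⊆ Nm b := by
      by_contra hcon
      push Not at hcon
      obtain ⟨x, hx, hx'⟩ := Finset.not_subset.1 hcon.1
      obtain ⟨y, hy, hy'⟩ := Finset.not_subset.1 hcon.2
      rw [mNm] at hx hx' hy hy'
      exact nest (i+1) x y b b' (by have := hx.2; simp only [hD] at *; omega)
        (by have := hy.2; simp only [hD] at *; omega) hi (by rw [← hi, hbb]) hx.1 hy.1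
        (fun h' => hx' ⟨h', by omega⟩) (fun h' => hy' ⟨h', by omega⟩)
    have com : ∀ z z', D z = i + 3 → D z' = i + 3 → ¬ Nm z ⊆ Nm z' → ¬ Np z ⊆ Np z' → False := by
      intro z z' hz hz' h1 h2
      obtain ⟨x, hx, hx'⟩ := Finset.not_subset.1 h1
      obtain ⟨y, hy, hy'⟩ := Finset.not_subset.1 h2
      rw [mNm] at hx hx'
      rw [mNp] at hy hy'
      exact compat h hno hc hE (j := i) hz hz' (a := x) (c := y)
        (by have := hx.2; simp only [hD] at *; omega)
        (by have := hy.2; simp only [hD] at *; omega) hx.1 (fun h' => hx' ⟨h', by omega⟩)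
        hy.1 (fun h' => hy' ⟨h', by omega⟩)
    have c1 := com b b' hi (by omega)
    have c2 := com b' b (by omega) hi
    tauto
  let r : V → ℕ := fun b => D b * (2 * N + 1) + ((N - (Nm b).card) + (Np b).card)
  have cm : ∀ b, (Nm b).card ≤ N := fun b => Finset.card_le_univ _
  have cp : ∀ b, (Np b).card ≤ N := fun b => Finset.card_le_univ _
  have rD : ∀ b b', r b ≤ r b' → D b ≤ D b' := by
    intro b b' hr
    by_contra hlt
    push Not at hlt
    have h1 := cp b'
    have h2 : (D b' + 1) * (2 * N + 1) ≤ D b * (2 * N + 1) := Nat.mul_le_mul_right _ hlt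
    simp only [r] at hr
    rw [Nat.add_mul] at h2
    omega
  have rmono : ∀ b b', Odd (D b) → D b = D b' → r b ≤ r b' → Nm b' ⊆ Nm b ∧ Np b ⊆ Np b' := by
    intro b b' hodd hbb hr
    rcases cmp b b' hodd hbb with h1 | ⟨h1, h2⟩
    · exact h1
    · have k1 := Finset.card_le_card h1
      have k2 := Finset.card_le_card h2
      have k3 := cm b; have k4 := cm b'
      simp only [r] at hr
      rw [hbb] at hr
      have e1 := Finset.eq_of_subset_of_card_le h1 (by omega)
      have e2 := Finset.eq_of_subset_of_card_le h2 (by omega)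
      rw [e1, e2]; exact ⟨subset_rfl, subset_rfl⟩
  have convex : ∀ a b1 b b2, G.Adj a b1 → G.Adj a b2 → Odd (D b1) → Odd (D b) → r b1 ≤ r b →
      r b ≤ r b2 → G.Adj a b := by
    intro a b1 b b2 h1 h2 ho1 ho hr1 hr2
    have k1 := rD _ _ hr1
    have k2 := rD _ _ hr2
    have l1 := lay _ _ h1
    have l2 := lay _ _ h2
    obtain ⟨j1, hj1⟩ := id ho1
    obtain ⟨j, hj⟩ := id ho
    rcases (by omega : D b1 = D b ∧ D a = D b + 1 ∨ D b = D b2 ∧ D b = D a + 1) with ⟨e, e'⟩ | ⟨e, e'⟩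
    · have := (rmono b1 b ho1 e hr1).2 ((mNp a b1).2 ⟨h1.symm, by omega⟩)
      exact ((mNp a b).1 this).1.symm
    · have := (rmono b b2 ho e hr2).1 ((mNm a b2).2 ⟨h2, by omega⟩)
      exact ((mNm a b).1 this).1
  let idx : V → ℕ := fun v => (Fintype.equivFin V v : ℕ)
  have idx_lt : ∀ v, idx v < N := fun v => (Fintype.equivFin V v).2
  have idx_inj : ∀ u v, idx u = idx v → u = v := fun u v huv =>
    (Fintype.equivFin V).injective (Fin.ext huv)
  let pos : V → ℕ := fun b => r b * N + idx b
  have posr : ∀ b b', pos b ≤ pos b' → r b ≤ r b' := by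
    intro b b' hp
    by_contra hlt
    push Not at hlt
    have h2 : (r b' + 1) * N ≤ r b * N := Nat.mul_le_mul_right _ hlt
    have := idx_lt b'
    simp only [pos] at hp
    rw [Nat.add_mul] at h2
    omega
  have pos_inj : ∀ b b', pos b = pos b' → b = b' := by
    intro b b' hp
    have e : r b = r b' := le_antisymm (posr _ _ hp.le) (posr _ _ hp.ge)
    apply idx_inj
    simp only [pos] at hp
    rw [e] at hp; omega
  have hQ : ∀ v, ∃ l hh : ℕ, (Odd (D v) ∧ l = pos v ∧ hh = pos v) ∨ (¬ Odd (D v) ∧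
      ∃ b1 b2, G.Adj v b1 ∧ G.Adj v b2 ∧ l = pos b1 ∧ hh = pos b2 ∧
        ∀ b, G.Adj v b → l ≤ pos b ∧ pos b ≤ hh) := by
    intro v
    by_cases hv : Odd (D v)
    · exact ⟨_, _, Or.inl ⟨hv, rfl, rfl⟩⟩
    · obtain ⟨b0, hb0⟩ := hc.preconnected.exists_adj_of_nontrivial v
      have hne : (Finset.univ.filter (fun b => G.Adj v b)).Nonempty := ⟨b0, by simp [hb0]⟩
      obtain ⟨b1, hb1, hm1⟩ := Finset.exists_min_image _ pos hne
      obtain ⟨b2, hb2, hm2⟩ := Finset.exists_max_image _ pos hne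
      refine ⟨_, _, Or.inr ⟨hv, b1, b2, by simpa using hb1, by simpa using hb2, rfl, rfl, ?_⟩⟩
      intro b hb
      exact ⟨hm1 b (by simp [hb]), hm2 b (by simp [hb])⟩
  choose lo hi hlh using hQ
  have flip : ∀ u v, G.Adj u v → ¬ Odd (D u) → Odd (D v) := by
    intro u v huv hu
    rcases lay _ _ huv with e | e
    · rw [e]; exact (Nat.not_odd_iff_even.1 hu).add_one
    · by_contra hv
      exact hu (by rw [e]; exact (Nat.not_odd_iff_even.1 hv).add_one)
  have flip' : ∀ u v, G.Adj u v → Odd (D u) → ¬ Odd (D v) := by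
    rintro u v huv ⟨j, hj⟩ ⟨j', hj'⟩
    rcases lay _ _ huv with e | e <;> omega
  refine ⟨lo, hi, ?_, ?_, ?_⟩
  · intro v _
    rcases hlh v with ⟨_, h1, h2⟩ | ⟨_, b1, b2, h1, h2, h3, h4, h5⟩
    · omega
    · have := h5 b1 h1; omega
  · intro u _ v _ huv
    rcases hlh u with ⟨o, h1, h2⟩ | ⟨o, b1, b2, h1, h2, h3, h4, h5⟩
    · rcases hlh v with ⟨o', _⟩ | ⟨o', b1, b2, h1', h2', h3, h4, h5⟩
      · exact absurd o' (flip' _ _ huv o)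
      · have := h5 u huv.symm; omega
    · rcases hlh v with ⟨o', h1', h2'⟩ | ⟨o', _⟩
      · have := h5 v huv; omega
      · exact absurd (flip _ _ huv o) o'
  · intro t T hT
    by_cases hex : ∃ b, Odd (D b) ∧ t ≤ pos b
    · obtain ⟨b0, hb0⟩ := hex
      obtain ⟨b, hb, hmin⟩ := Finset.exists_min_image
        (Finset.univ.filter (fun b => Odd (D b) ∧ t ≤ pos b)) pos ⟨b0, by simpa using hb0⟩
      have hb : Odd (D b) ∧ t ≤ pos b := by simpa using hb
      have hmin : ∀ x, Odd (D x) → t ≤ pos x → pos b ≤ pos x := fun x h1 h2 =>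
        hmin x (by simp [h1, h2])
      have hsub : T ⊆ insert b (Finset.univ.filter (fun x => G.Adj b x)) := by
        intro x hx
        obtain ⟨_, hx1, hx2⟩ := hT x hx
        rcases hlh x with ⟨o, h1, h2⟩ | ⟨o, b1, b2, h1, h2, h3, h4, h5⟩
        · have := hmin x o (by omega)
          have : x = b := pos_inj _ _ (by omega)
          simp [this]
        · have h6 := hmin b2 (flip _ _ h2 o) (by omega)
          have := convex x b1 b b2 h1 h2 (flip _ _ h1 o) hb.1 (posr _ _ (by omega)) (posr _ _ h6)
          simp [this.symm]
      have k1 := Finset.card_le_card hsub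
      have k2 := Finset.card_insert_le b (Finset.univ.filter (fun x => G.Adj b x))
      have k3 := h.deg b (Finset.univ.filter (fun x => G.Adj b x)) (by simp)
      omega
    · push Not at hex
      have : T = ∅ := by
        rw [Finset.eq_empty_iff_forall_notMem]
        intro x hx
        obtain ⟨_, hx1, hx2⟩ := hT x hx
        rcases hlh x with ⟨o, h1, h2⟩ | ⟨o, b1, b2, h1, h2, h3, h4, h5⟩
        · have := hex x o; omega
        · have := hex b2 (flip _ _ h2 o); omega
      simp [this]

lemma model_union {V : Type*} [Fintype V] {G : SimpleGraph V} {U₁ U₂ : Set V} {k : ℕ}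
    (hno : ∀ x ∈ U₁, ∀ y ∈ U₂, ¬ G.Adj x y) (h1 : Model G U₁ k) (h2 : Model G U₂ k) :
    Model G (U₁ ∪ U₂) k := by
  classical
  obtain ⟨l1, r1, a1, b1, c1⟩ := h1
  obtain ⟨l2, r2, a2, b2, c2⟩ := h2
  set M := Finset.univ.sup r1 with hM
  have hr : ∀ v, r1 v ≤ M := fun v => Finset.le_sup (Finset.mem_univ v)
  refine ⟨fun v => if v ∈ U₁ then l1 v else l2 v + (M + 1),
    fun v => if v ∈ U₁ then r1 v else r2 v + (M + 1), ?_, ?_, ?_⟩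
  · rintro v hv
    by_cases hv1 : v ∈ U₁
    · simpa [hv1] using a1 v hv1
    · simpa [hv1] using a2 v (hv.resolve_left hv1)
  · rintro u hu v hv huv
    by_cases hu1 : u ∈ U₁ <;> by_cases hv1 : v ∈ U₁
    · simpa [hu1, hv1] using b1 u hu1 v hv1 huv
    · exact absurd huv (hno u hu1 v (hv.resolve_left hv1))
    · exact absurd huv.symm (hno v hv1 u (hu.resolve_left hu1))
    · simpa [hu1, hv1] using b2 u (hu.resolve_left hu1) v (hv.resolve_left hv1) huv
  · intro t T hT
    rcases Nat.lt_or_ge M t with ht | ht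
    · refine c2 (t - (M + 1)) T fun v hv => ?_
      obtain ⟨q1, q2, q3⟩ := hT v hv
      by_cases hv1 : v ∈ U₁
      · simp only [hv1, if_true] at q2 q3
        have := hr v; omega
      · simp only [hv1, if_false] at q2 q3
        exact ⟨q1.resolve_left hv1, by omega, by omega⟩
    · refine c1 t T fun v hv => ?_
      obtain ⟨q1, q2, q3⟩ := hT v hv
      by_cases hv1 : v ∈ U₁
      · simp only [hv1, if_true] at q2 q3
        exact ⟨hv1, q2, q3⟩
      · simp only [hv1, if_false] at q2 q3
        omega

lemma model_components {V : Type*} [Fintype V] {G : SimpleGraph V} {k : ℕ} (n : ℕ) :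
    ∀ U : Set V, U.ncard = n → (∀ K ⊆ U, K.Nonempty → (∀ a ∈ K, ∀ b ∈ K, Conn G K a b) →
      Model G K k) → Model G U k := by
  induction n using Nat.strong_induction_on with
  | _ n ih =>
    intro U hU hK
    rcases U.eq_empty_or_nonempty with rfl | ⟨v, hv⟩
    · refine ⟨fun _ => 0, fun _ => 0, by simp, by simp, fun t T hT => ?_⟩
      have : T = ∅ := by
        rw [Finset.eq_empty_iff_forall_notMem]
        intro x hx
        exact (hT x hx).1
      simp [this]
    set C : Set V := {w | w ∈ U ∧ Conn G U v w} with hC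
    have hCU : C ⊆ U := fun w hw => hw.1
    have hvC : v ∈ C := ⟨hv, Relation.ReflTransGen.refl⟩
    have hCC : ∀ w, Conn G U v w → Conn G C v w := by
      intro w hw
      induction hw with
      | refl => exact Relation.ReflTransGen.refl
      | tail h1 h2 ih' =>
        exact ih'.tail ⟨h2.1, ⟨h2.2.1, h1⟩, ⟨h2.2.2, h1.tail h2⟩⟩
    have e : U = C ∪ (U \ C) := (Set.union_diff_cancel hCU).symm
    rw [e]
    refine model_union ?_ (hK C hCU ⟨v, hvC⟩ ?_) (ih (U \ C).ncard ?_ _ rfl ?_)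
    · intro x hx y hy hxy
      exact hy.2 ⟨hy.1, hx.2.tail ⟨hxy, hx.1, hy.1⟩⟩
    · intro a ha b hb
      exact (hCC a ha.2).symm.trans (hCC b hb.2)
    · rw [← hU]
      exact Set.ncard_lt_ncard ⟨Set.diff_subset, fun h' => (h' hv).2 hvC⟩ (Set.toFinite _)
    · intro K hKU
      exact hK K (hKU.trans Set.diff_subset)

lemma model_of_induce {V : Type*} {G : SimpleGraph V} {K : Set V} {k : ℕ}
    (h : Model (G.induce K) Set.univ k) : Model G K k := by
  classical
  obtain ⟨lo, hi, a, b, c⟩ := h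
  refine ⟨fun v => if hv : v ∈ K then lo ⟨v, hv⟩ else 0,
    fun v => if hv : v ∈ K then hi ⟨v, hv⟩ else 0, ?_, ?_, ?_⟩
  · intro v hv
    simpa [hv] using a ⟨v, hv⟩ trivial
  · intro u hu v hv huv
    simpa [hu, hv] using b ⟨u, hu⟩ trivial ⟨v, hv⟩ trivial huv
  · intro t T hT
    have := c t (T.subtype (· ∈ K)) (by
      rintro ⟨v, hv⟩ hvT
      have := hT v (by simpa using hvT)
      simpa [hv] using this)
    rwa [Finset.card_subtype, Finset.filter_true_of_mem (fun x hx => (hT x hx).1)] at this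

lemma conn_induce {V : Type*} {G : SimpleGraph V} {K : Set V} {a b : V} (ha : a ∈ K)
    (h : Conn G K a b) : ∃ hb : b ∈ K, (G.induce K).Reachable ⟨a, ha⟩ ⟨b, hb⟩ := by
  induction h with
  | refl => exact ⟨ha, SimpleGraph.Reachable.refl _⟩
  | tail h1 h2 ih =>
    obtain ⟨hb, hr⟩ := ih
    exact ⟨h2.2.2, hr.trans (SimpleGraph.Adj.reachable (by simpa using h2.1))⟩

theorem model_component {V : Type*} [Fintype V] {G : SimpleGraph V} {d : ℕ} (h : Nice G d)
    {K : Set V} (hne : K.Nonempty) (hK : ∀ a ∈ K, ∀ b ∈ K, Conn G K a b) :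
    Model G K (2 * d + 1) := by
  classical
  obtain ⟨b, hb⟩ := hne
  set U : Set V := {x | x ∈ K ∧ x ≠ b ∧ ¬ G.Adj b x} with hU
  have hmod : Model G U (d + 1) := by
    refine model_components _ U rfl ?_
    intro L hLU ⟨v, hv⟩ hL
    apply model_of_induce
    refine model_connected (h.induce L) ?_ ?_
    · intro c hc
      have hc' : HoleWalk G (fun i => (c i : V)) := hc
      obtain ⟨j, hj⟩ := holeWalk_dominates h hc' (hK _ (hLU (c 0).2).1 b hb)
      have := hLU (c j).2
      rcases hj with hj | hj
      · exact this.2.1 hj.symm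
      · exact this.2.2 hj.symm
    · haveI : Nonempty L := ⟨⟨v, hv⟩⟩
      refine ⟨?_⟩
      rintro ⟨x, hx⟩ ⟨y, hy⟩
      exact (conn_induce hx (hL x hx y hy)).2
  obtain ⟨lo, hi, p, q, w⟩ := hmod
  set M := Finset.univ.sup hi with hM
  have hr : ∀ v, hi v ≤ M := fun v => Finset.le_sup (Finset.mem_univ v)
  have tri : ∀ v ∈ K, v = b ∨ (v ≠ b ∧ G.Adj b v) ∨ (v ≠ b ∧ ¬ G.Adj b v ∧ v ∈ U) := by
    intro v hv
    by_cases h1 : v = b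
    · exact Or.inl h1
    by_cases h2 : G.Adj b v
    · exact Or.inr (Or.inl ⟨h1, h2⟩)
    · exact Or.inr (Or.inr ⟨h1, h2, hv, h1, h2⟩)
  refine ⟨fun v => if v = b then M + 1 else if G.Adj b v then 0 else lo v,
    fun v => if v = b then M + 1 else if G.Adj b v then M + 1 else hi v, ?_, ?_, ?_⟩
  · intro v hv
    rcases tri v hv with rfl | ⟨h1, h2⟩ | ⟨h1, h2, h3⟩
    · simp
    · simp [h1, h2]
    · simpa [h1, h2] using p v h3
  · intro u hu v hv huv
    have plo : ∀ v ∈ U, lo v ≤ M + 1 := fun v hv => by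
      have := hr v; have := p v hv; omega
    rcases tri u hu with rfl | ⟨h1, h2⟩ | ⟨h1, h2, h3⟩
    · simp [huv.ne', huv]
    · rcases tri v hv with rfl | ⟨k1, k2⟩ | ⟨k1, k2, k3⟩
      · simp [h1, h2]
      · simp [h1, h2, k1, k2]
      · simpa [h1, h2, k1, k2] using plo v k3
    · rcases tri v hv with rfl | ⟨k1, k2⟩ | ⟨k1, k2, k3⟩
      · exact absurd huv.symm h2
      · simpa [h1, h2, k1, k2] using plo u h3
      · simpa [h1, h2, k1, k2] using q u h3 v k3 huv
  · intro t T hT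
    have k1 := h.deg b (T.filter (fun x => G.Adj b x)) (by simp)
    have k2 : (T.filter (fun x => ¬ G.Adj b x)).card ≤ d + 1 := by
      rcases Nat.lt_or_ge M t with ht | ht
      · have : T.filter (fun x => ¬ G.Adj b x) ⊆ {b} := by
          intro x hx
          obtain ⟨hx, hxb⟩ := Finset.mem_filter.1 hx
          obtain ⟨q1, q2, q3⟩ := hT x hx
          by_contra hne
          have hne : x ≠ b := by simpa using hne
          simp only [hne, hxb, if_false] at q3
          have := hr x; omega
        have := Finset.card_le_card this
        simp at this; omega
      · refine w t _ fun x hx => ?_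
        obtain ⟨hx, hxb⟩ := Finset.mem_filter.1 hx
        obtain ⟨q1, q2, q3⟩ := hT x hx
        by_cases hne : x = b
        · simp only [hne, if_true] at q2; omega
        · simp only [hne, hxb, if_false] at q2 q3
          exact ⟨⟨q1, hne, hxb⟩, q2, q3⟩
    have := Finset.card_filter_add_card_filter_not (s := T) (fun x => G.Adj b x)
    omega

lemma pathwidth_le_of_model {V : Type*} [Fintype V] {G : SimpleGraph V} {k : ℕ}
    (h : Model G Set.univ (k + 1)) : pathwidth G ≤ k := by
  classical
  obtain ⟨lo, hi, p, q, w⟩ := h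
  set M := Finset.univ.sup hi with hM
  have hr : ∀ v, hi v ≤ M := fun v => Finset.le_sup (Finset.mem_univ v)
  let D : PathDecomp G :=
    { len := M + 1
      len_pos := Nat.succ_pos _
      bags := fun i => Finset.univ.filter (fun v => lo v ≤ i ∧ (i : ℕ) ≤ hi v)
      mem_bag := fun v => ⟨⟨hi v, Nat.lt_succ_of_le (hr v)⟩, by simpa using p v trivial⟩
      edge_bag := by
        intro u v huv
        have h1 := p u trivial
        have h2 := p v trivial
        have h3 := q u trivial v trivial huv
        have h4 := hr u
        have h5 := hr v
        refine ⟨⟨max (lo u) (lo v), by omega⟩, ?_⟩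
        simp only [Finset.mem_filter, Finset.mem_univ, true_and]
        omega
      interval := by
        intro v i j l hij hjl hi' hl
        simp only [Finset.mem_filter, Finset.mem_univ, true_and] at hi' hl ⊢
        have h1 : (i : ℕ) ≤ j := hij
        have h2 : (j : ℕ) ≤ l := hjl
        omega }
  have hw : D.width ≤ k := by
    unfold PathDecomp.width
    have : (Finset.univ.sup fun i => (D.bags i).card) ≤ k + 1 := by
      refine Finset.sup_le fun i _ => ?_
      refine w i _ fun v hv => ?_
      simpa [D] using hv
    omega
  have hmem : D.width ∈ {w : ℕ | ∃ D : PathDecomp G, D.width = w} := ⟨D, rfl⟩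
  exact (Nat.sInf_le hmem).trans hw

/-- Every bipartite finite simple graph with no induced tripod, armchair,
stirrer or star `K_{1,d+1}` has pathwidth at most `2d`. -/
theorem fast_starfree_pathwidth_le {V : Type*} [Fintype V] (d : ℕ) (hd : 1 ≤ d)
    (G : SimpleGraph V) (hbip : IsBipartiteGraph G)
    (htripod : ¬ HasInducedCopy G tripod)
    (harmchair : ¬ HasInducedCopy G armchair)
    (hstirrer : ¬ HasInducedCopy G stirrer)
    (hstar : ¬ HasInducedCopy G (completeBipartiteGraph (Fin 1) (Fin (d + 1)))) :
    pathwidth G ≤ 2 * d := by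
  have h := nice_of d G hbip htripod harmchair hstirrer hstar
  exact pathwidth_le_of_model (model_components _ _ rfl fun K _ hne hK => model_component h hne hK)
end
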